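/- Let N ≥ 2, m ≥ 1, and let (f, g) be a density pair on ℝ^N with g continuous. Let 𝓔 = (E_1,…,E_m) be a nondegenerate m-cluster of finite perimeter and finite volume in ℝ^N. Then for every constant c > 0 there exist positive constants r̄, ε̄ such that 𝓔 satisfies the ε–ε^{(N−1)/N} property with constants (r̄, ε̄, c); in other words, the ε–ε^{(N−1)/N} property holds with arbitrarily small constant C_per. -/

import Mathlib

open MeasureTheory Metric Set Filter

noncomputable section

abbrev Pt (N : ℕ) := EuclideanSpace ℝ (Fin N)

variable {N : ℕ}

/-- The density ratio of `E` at `x` tends to `l` as the radius tends to `0⁺`. -/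
def densTendsto (E : Set (Pt N)) (x : Pt N) (l : ENNReal) : Prop :=
  Tendsto (fun r : ℝ => volume (E ∩ ball x r) / volume (ball x r))
    (nhdsWithin 0 (Ioi 0)) (nhds l)

/-- The essential boundary of a set. -/
def essBdry (E : Set (Pt N)) : Set (Pt N) :=
  {x | ¬ densTendsto E x 0 ∧ ¬ densTendsto E x 1}

/-- Weighted volume (as an extended nonnegative real). -/
def wVolE (f : Pt N → ℝ) (E : Set (Pt N)) : ENNReal :=
  ∫⁻ x in E, ENNReal.ofReal (f x) ∂(μH[(N : ℝ)])

/-- Weighted volume. -/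
def wVol (f : Pt N → ℝ) (E : Set (Pt N)) : ℝ := (wVolE f E).toReal

/-- Weighted perimeter. -/
def wPer (g : Pt N → ℝ) (E : Set (Pt N)) : ℝ :=
  (∫⁻ x in essBdry E, ENNReal.ofReal (g x) ∂(μH[(N : ℝ) - 1])).toReal

/-- A density pair: lower semicontinuous, positive, locally bounded functions. -/
def IsDensityPair (f g : Pt N → ℝ) : Prop :=
  LowerSemicontinuous f ∧ LowerSemicontinuous g ∧
  (∀ x, 0 < f x) ∧ (∀ x, 0 < g x) ∧
  ∀ K : Set (Pt N), IsCompact K → ∃ C : ℝ, ∀ x ∈ K, f x ≤ C ∧ g x ≤ C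

/-- `g` is locally `α`-Hölder. -/
def LocallyHolder (α : ℝ) (g : Pt N → ℝ) : Prop :=
  ∀ K : Set (Pt N), IsCompact K → ∃ C : ℝ, ∀ y ∈ K, ∀ z ∈ K, |g y - g z| ≤ C * dist y z ^ α

/-- An `m`-cluster: measurable, essentially pairwise disjoint chambers. -/
def IsCluster {m : ℕ} (E : Fin m → Set (Pt N)) : Prop :=
  (∀ i, MeasurableSet (E i)) ∧ ∀ i j, i ≠ j → volume (E i ∩ E j) = 0

/-- The chambers of a cluster including the exterior chamber `E₀`. -/
def chamber {m : ℕ} (E : Fin m → Set (Pt N)) (i : Fin (m + 1)) : Set (Pt N) :=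
  if h : i = 0 then (⋃ j, E j)ᶜ else E (i.pred h)

/-- The weighted perimeter of a cluster. -/
def clPer (g : Pt N → ℝ) {m : ℕ} (E : Fin m → Set (Pt N)) : ℝ :=
  ((∑ i, wPer g (E i)) + wPer g (⋃ i, E i)) / 2

/-- The cluster has finite perimeter. -/
def FinPerCluster {m : ℕ} (E : Fin m → Set (Pt N)) : Prop :=
  ∀ i, μH[(N : ℝ) - 1] (essBdry (E i)) < ⊤

/-- The cluster has finite weighted volume. -/
def FinVolCluster (f : Pt N → ℝ) {m : ℕ} (E : Fin m → Set (Pt N)) : Prop :=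
  ∀ i, wVolE f (E i) < ⊤

/-- Nondegeneracy: all chambers including the exterior one have positive Lebesgue measure. -/
def Nondegenerate {m : ℕ} (E : Fin m → Set (Pt N)) : Prop :=
  0 < volume ((⋃ i, E i)ᶜ) ∧ ∀ i, 0 < volume (E i)

/-- The `ε`–`ε^β` property for clusters with constants `(rbar, εbar, Cper)`. -/
def EpsEpsBeta (f g : Pt N → ℝ) {m : ℕ} (E : Fin m → Set (Pt N))
    (β rbar εbar Cper : ℝ) : Prop :=
  ∀ ε : EuclideanSpace ℝ (Fin m), ‖ε‖ < εbar → ∀ w : Pt N,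
    ∃ F : Fin m → Set (Pt N), IsCluster F ∧
      (∃ (c : Fin (m * (m + 1) / 2 + 1) → Pt N) (ρ : Fin (m * (m + 1) / 2 + 1) → ℝ),
        (∀ k, ρ k ≤ rbar) ∧
        (∀ k, Disjoint (ball (c k) (ρ k)) (ball w rbar)) ∧
        (⋃ i, symmDiff (E i) (F i)) ⊆ ⋃ k, ball (c k) (ρ k)) ∧
      (∀ i, wVol f (F i) = wVol f (E i) + ε i) ∧
      clPer g F ≤ clPer g E + Cper * ‖ε‖ ^ β

theorem volume_ball_pos_ne (x : Pt N) {r : ℝ} (hr : 0 < r) :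
    volume (ball x r) ≠ 0 ∧ volume (ball x r) ≠ ⊤ :=
  ⟨(measure_ball_pos _ _ hr).ne', measure_ball_lt_top.ne⟩

theorem ae_densTendsto [Nontrivial (Pt N)] {E : Set (Pt N)} (hE : MeasurableSet E) :
    ∀ᵐ x, densTendsto E x (E.indicator 1 x) := by
  filter_upwards [Besicovitch.ae_tendsto_measure_inter_div_of_measurableSet
    (volume : Measure (Pt N)) hE] with x hx
  refine hx.congr fun r => ?_
  have h1 := Measure.addHaar_closedBall_eq_addHaar_ball (volume : Measure (Pt N)) x r
  rw [h1]
  congr 1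
  refine le_antisymm ?_ (measure_mono (inter_subset_inter_right _ ball_subset_closedBall))
  calc volume (E ∩ closedBall x r) ≤ volume ((E ∩ ball x r) ∪ sphere x r) := by
        refine measure_mono ?_
        rw [← ball_union_sphere]
        rintro y ⟨h, h' | h'⟩
        · exact Or.inl ⟨h, h'⟩
        · exact Or.inr h'
    _ ≤ volume (E ∩ ball x r) + volume (sphere x r) := measure_union_le _ _
    _ = volume (E ∩ ball x r) := by rw [Measure.addHaar_sphere, add_zero]

/-- A measurable set whose intersection with every line of a given direction is null is null. -/
theorem volume_eq_zero_of_lines {S : Set (Pt N)} (hS : MeasurableSet S) (e : Pt N)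
    (h : ∀ x : Pt N, volume {s : ℝ | x + s • e ∈ S} = 0) : volume S = 0 := by
  have hm : MeasurableSet {q : Pt N × ℝ | q.1 + q.2 • e ∈ S} := by
    have : Measurable fun q : Pt N × ℝ => q.1 + q.2 • e := by fun_prop
    exact this hS
  have h1 : ((volume : Measure (Pt N)).prod (volume : Measure ℝ))
      {q : Pt N × ℝ | q.1 + q.2 • e ∈ S} = 0 := by
    rw [Measure.prod_apply hm]
    simp only [preimage_ofPred_eq, h, lintegral_zero]
  rw [Measure.prod_apply_symm hm] at h1
  have h2 : ∀ y : ℝ, volume ((fun x : Pt N => (x, y)) ⁻¹' {q : Pt N × ℝ | q.1 + q.2 • e ∈ S})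
      = volume S := by
    intro y
    simp only [preimage_ofPred_eq]
    exact measure_preimage_add_right volume (y • e) S
  simp only [h2, lintegral_const, Real.volume_univ] at h1
  rcases mul_eq_zero.1 h1 with h | h
  · exact h
  · exact absurd h ENNReal.top_ne_zero

theorem measurable_volume_inter_ball {X : Set (Pt N)} (hX : MeasurableSet X) (ρ : ℝ) :
    Measurable fun x => volume (X ∩ ball x ρ) := by
  have hm : MeasurableSet {q : Pt N × Pt N | q.2 ∈ X ∧ dist q.2 q.1 < ρ} := by
    refine MeasurableSet.inter (measurable_snd hX) ?_
    exact measurableSet_lt (measurable_snd.dist measurable_fst) measurable_const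
  exact measurable_measure_prodMk_left (ν := (volume : Measure (Pt N))) hm

/-- A set whose mean density at small scales is at most one half is null. -/
theorem volume_eq_zero_of_mean_density [Nontrivial (Pt N)] {X : Set (Pt N)}
    (hX : MeasurableSet X) (hfin : volume X ≠ ⊤) {ρ0 : ℝ} (hρ0 : 0 < ρ0)
    (h : ∀ ρ, 0 < ρ → ρ < ρ0 →
      ∫⁻ x in X, volume (X ∩ ball x ρ) ≤ 2⁻¹ * volume (ball (0 : Pt N) ρ) * volume X) :
    volume X = 0 := by
  obtain ⟨u, -, hu, hu'⟩ := exists_seq_strictAnti_tendsto' hρ0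
  have hu0 : Tendsto u atTop (nhdsWithin 0 (Ioi 0)) :=
    tendsto_nhdsWithin_iff.2 ⟨hu', Eventually.of_forall fun n => (hu n).1⟩
  set F : ℕ → Pt N → ENNReal := fun n x => volume (X ∩ ball x (u n)) / volume (ball x (u n))
  have hF : ∀ n x, F n x = volume (X ∩ ball x (u n)) * (volume (ball (0 : Pt N) (u n)))⁻¹ := by
    intro n x
    simp only [F, Measure.addHaar_ball_center volume x, div_eq_mul_inv]
  have hFm : ∀ n, Measurable (F n) := by
    intro n
    rw [show F n = _ from funext (hF n)]
    exact (measurable_volume_inter_ball hX _).mul_const _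
  have key := lintegral_liminf_le (μ := volume.restrict X) (u := atTop) hFm
  have e1 : ∫⁻ x in X, liminf (fun n => F n x) atTop = volume X := by
    rw [← setLIntegral_one]
    refine setLIntegral_congr_fun_ae hX ?_
    filter_upwards [ae_densTendsto hX] with x hx hxX
    have : densTendsto X x 1 := by simpa [hxX] using hx
    exact (this.comp hu0).liminf_eq
  have e2 : ∀ n, ∫⁻ x in X, F n x ≤ 2⁻¹ * volume X := by
    intro n
    obtain ⟨hb1, hb2⟩ := volume_ball_pos_ne (0 : Pt N) (hu n).1
    simp only [hF]
    rw [lintegral_mul_const _ (measurable_volume_inter_ball hX _)]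
    calc _ ≤ 2⁻¹ * volume (ball (0 : Pt N) (u n)) * volume X * (volume (ball (0 : Pt N) (u n)))⁻¹ :=
          by gcongr; exact h _ (hu n).1 (hu n).2
      _ = 2⁻¹ * volume X * (volume (ball (0 : Pt N) (u n)) * (volume (ball (0 : Pt N) (u n)))⁻¹) :=
          by ring
      _ = _ := by rw [ENNReal.mul_inv_cancel hb1 hb2, mul_one]
  have e3 : volume X ≤ 2⁻¹ * volume X := by
    rw [e1] at key
    refine key.trans ?_
    calc _ ≤ liminf (fun _ : ℕ => 2⁻¹ * volume X) atTop :=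
          liminf_le_liminf (Eventually.of_forall e2)
      _ = _ := by simp
  by_contra h0
  have := ENNReal.half_lt_self h0 hfin
  rw [div_eq_mul_inv, mul_comm] at this
  exact absurd e3 (not_le.2 this)

/-- The projection to the hyperplane orthogonal to the unit vector `e`. -/
def perpPart (e x : Pt N) : Pt N := x - (inner ℝ e x) • e

theorem perpPart_add_smul {e : Pt N} (he : ‖e‖ = 1) (x : Pt N) (t : ℝ) :
    perpPart e (x + t • e) = perpPart e x := by
  simp only [perpPart, inner_add_right, inner_smul_right, real_inner_self_eq_norm_sq, he]
  module

theorem continuous_perpPart (e : Pt N) : Continuous (perpPart e) := by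
  unfold perpPart; fun_prop

theorem inner_add_smul_unit {e : Pt N} (he : ‖e‖ = 1) (x : Pt N) (t : ℝ) :
    inner ℝ e (x + t • e) = inner ℝ e x + t := by
  simp [inner_add_right, inner_smul_right, he]

/-- The heights in `[a, b]` at which the line through `x` in direction `e` meets `G`. -/
def heights (G : Set (Pt N)) (e : Pt N) (a b : ℝ) (x : Pt N) : Set ℝ :=
  {s | s ∈ Icc a b ∧ perpPart e x + s • e ∈ G}

/-- The largest element of `heights G e a b x`, or `a - 1` if there is none. -/
def topHeight (G : Set (Pt N)) (e : Pt N) (a b : ℝ) (x : Pt N) : ℝ :=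
  sSup (insert (a - 1) (heights G e a b x))

theorem isCompact_heights {G : Set (Pt N)} (hG : IsClosed G) (e : Pt N) (a b : ℝ) (x : Pt N) :
    IsCompact (insert (a - 1) (heights G e a b x)) := by
  refine IsCompact.insert (isCompact_Icc.inter_right ?_) _
  exact hG.preimage (by fun_prop : Continuous fun s : ℝ => perpPart e x + s • e)

theorem topHeight_mem {G : Set (Pt N)} (hG : IsClosed G) (e : Pt N) (a b : ℝ) (x : Pt N) :
    topHeight G e a b x ∈ insert (a - 1) (heights G e a b x) :=
  (isCompact_heights hG e a b x).sSup_mem (insert_nonempty _ _)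

theorem le_topHeight {G : Set (Pt N)} (hG : IsClosed G) {e : Pt N} {a b : ℝ} {x : Pt N} {s : ℝ}
    (hs : s ∈ heights G e a b x) : s ≤ topHeight G e a b x :=
  le_csSup (isCompact_heights hG e a b x).bddAbove (mem_insert_of_mem _ hs)

theorem topHeight_mem_heights {G : Set (Pt N)} (hG : IsClosed G) {e : Pt N} {a b : ℝ} {x : Pt N}
    (h : a ≤ topHeight G e a b x) : topHeight G e a b x ∈ heights G e a b x := by
  rcases topHeight_mem hG e a b x with h' | h'
  · linarith
  · exact h'

theorem topHeight_add_smul (G : Set (Pt N)) {e : Pt N} (he : ‖e‖ = 1) (a b : ℝ) (x : Pt N)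
    (t : ℝ) : topHeight G e a b (x + t • e) = topHeight G e a b x := by
  simp only [topHeight, heights, perpPart_add_smul he]

open scoped Pointwise in
theorem measurable_topHeight {G : Set (Pt N)} (hG : IsClosed G) (e : Pt N) (a b : ℝ) :
    Measurable (topHeight G e a b) := by
  refine measurable_of_Ici fun q => ?_
  rcases le_or_gt q (a - 1) with hq | hq
  · convert MeasurableSet.univ
    refine eq_univ_of_forall fun x => ?_
    exact hq.trans (le_csSup (isCompact_heights hG e a b x).bddAbove (mem_insert _ _))
  · have hc : IsClosed (G + (fun s : ℝ => (-s) • e) '' Icc (max q a) b) :=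
      hG.add_right_of_isCompact (isCompact_Icc.image (by fun_prop))
    convert (hc.preimage (continuous_perpPart e)).measurableSet
    ext x
    simp only [mem_preimage, mem_Ici, Set.mem_add, mem_image]
    constructor
    · intro h
      rcases topHeight_mem hG e a b x with h' | h'
      · linarith
      · refine ⟨_, h'.2, _, ⟨topHeight G e a b x, ⟨max_le h h'.1.1, h'.1.2⟩, rfl⟩, ?_⟩
        module
    · rintro ⟨y, hy, _, ⟨s, hs, rfl⟩, h⟩
      refine (le_max_left q a).trans (hs.1.trans (le_topHeight hG ⟨⟨(le_max_right _ _).trans hs.1,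
        hs.2⟩, ?_⟩))
      rw [← h]
      convert hy using 1
      module

/-- The exceptional set in the statement that a set of positive density cannot have a cusp along
a non-null family of parallel lines. -/
def cuspLines (G O : Set (Pt N)) (e : Pt N) (a b δ : ℝ) : Set (Pt N) :=
  {x | a ≤ topHeight G e a b x ∧
    volume {s : ℝ | s ∈ Ioo 0 δ ∧ perpPart e x + (topHeight G e a b x + s) • e ∉ O} = 0}

theorem measurableSet_cuspLines {G O : Set (Pt N)} (hG : IsClosed G) (hO : MeasurableSet O)
    (e : Pt N) (a b δ : ℝ) : MeasurableSet (cuspLines G O e a b δ) := by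
  have h1 := measurable_topHeight hG e a b
  refine MeasurableSet.inter (measurableSet_le measurable_const h1) ?_
  have hm : MeasurableSet {q : Pt N × ℝ | q.2 ∈ Ioo 0 δ ∧
      perpPart e q.1 + (topHeight G e a b q.1 + q.2) • e ∉ O} := by
    refine MeasurableSet.inter (measurable_snd measurableSet_Ioo) ?_
    have : Measurable fun q : Pt N × ℝ =>
        perpPart e q.1 + (topHeight G e a b q.1 + q.2) • e :=
      ((continuous_perpPart e).measurable.comp measurable_fst).add
        (((h1.comp measurable_fst).add measurable_snd).smul_const e)
    exact this hO.compl
  exact (measurable_measure_prodMk_left (ν := (volume : Measure ℝ)) hm) (measurableSet_singleton 0)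

theorem cuspLines_add_smul {G O : Set (Pt N)} {e : Pt N} (he : ‖e‖ = 1) {a b δ : ℝ} {x : Pt N}
    (t : ℝ) (hx : x ∈ cuspLines G O e a b δ) : x + t • e ∈ cuspLines G O e a b δ := by
  unfold cuspLines at *
  simp only [mem_ofPred_eq, topHeight_add_smul G he, perpPart_add_smul he] at *
  exact hx

/-- The points above the top point of `G`, within distance `δ` and outside `O`. -/
theorem volume_cuspLines_exception {G O : Set (Pt N)} (hG : IsClosed G) (hO : MeasurableSet O)
    {e : Pt N} (he : ‖e‖ = 1) (a b δ : ℝ) :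
    volume {z | z ∈ cuspLines G O e a b δ ∧
      inner ℝ e z - topHeight G e a b z ∈ Ioo 0 δ ∧ z ∉ O} = 0 := by
  have h1 := measurable_topHeight hG e a b
  refine volume_eq_zero_of_lines ?_ e fun x => ?_
  · refine (measurableSet_cuspLines hG hO e a b δ).inter (MeasurableSet.inter ?_ hO.compl)
    have : Measurable fun z : Pt N => inner ℝ e z - topHeight G e a b z := by
      refine Measurable.sub ?_ h1
      fun_prop
    exact this measurableSet_Ioo
  · by_cases hx : x ∈ cuspLines G O e a b δ
    · set k : ℝ := inner ℝ e x - topHeight G e a b x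
      have h2 : volume ((fun s : ℝ => s + k) ⁻¹' {s : ℝ | s ∈ Ioo 0 δ ∧
          perpPart e x + (topHeight G e a b x + s) • e ∉ O}) = 0 := by
        rw [measure_preimage_add_right]
        exact hx.2
      refine measure_mono_null ?_ h2
      rintro s ⟨-, hs, hs'⟩
      rw [inner_add_smul_unit he, topHeight_add_smul G he] at hs
      refine ⟨?_, ?_⟩
      · convert hs using 1
        simp only [k]; ring
      · convert hs' using 2
        simp only [k, perpPart]
        module
    · convert measure_empty (μ := (volume : Measure ℝ))
      refine eq_empty_of_forall_notMem fun s hs => hx ?_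
      have := cuspLines_add_smul he (-s) hs.1
      simpa using this

theorem volume_cuspLines_pair [Nontrivial (Pt N)] {G O : Set (Pt N)} (hG : IsClosed G)
    (hO : MeasurableSet O) {e : Pt N} (he : ‖e‖ = 1) {a δ r0 : ℝ}
    (h : ∀ y ∈ G, ∀ r, 0 < r → r < r0 →
      volume (ball y r ∩ O) ≤ (4 * 3 ^ N)⁻¹ * volume (ball y r))
    {x : Pt N} (hx : x ∈ cuspLines G O e a (a + δ / 2) δ) {ρ : ℝ} (hρ : 0 < ρ)
    (hρ1 : 3 * ρ < r0) (hρ2 : 3 * ρ ≤ δ / 2) :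
    volume (cuspLines G O e a (a + δ / 2) δ ∩ ball x ρ ∩
      {x' | topHeight G e a (a + δ / 2) x' ≤ topHeight G e a (a + δ / 2) x}) ≤
      4⁻¹ * volume (ball (0 : Pt N) ρ) := by
  set b := a + δ / 2 with hb
  have hy := topHeight_mem_heights hG hx.1
  set y := perpPart e x + topHeight G e a b x • e
  set τ : ℝ := topHeight G e a b x - inner ℝ e x + 2 * ρ with hτ
  have hxh := hx.1
  have hxb := hy.1.2
  calc _ ≤ volume ((fun z : Pt N => z + τ • e) ⁻¹' ((ball y (3 * ρ) ∩ O) ∪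
        {z | z ∈ cuspLines G O e a b δ ∧
          inner ℝ e z - topHeight G e a b z ∈ Ioo 0 δ ∧ z ∉ O})) := by
        refine measure_mono ?_
        rintro x' ⟨⟨h1, h2⟩, h3⟩
        simp only [mem_ofPred_eq] at h3
        have h4 : |inner ℝ e (x' - x)| < ρ := by
          calc _ ≤ ‖e‖ * ‖x' - x‖ := abs_real_inner_le_norm _ _
            _ < ρ := by rw [he, one_mul, ← dist_eq_norm]; exact h2
        rw [inner_sub_right, abs_lt] at h4
        have h5 : inner ℝ e (x' + τ • e) - topHeight G e a b (x' + τ • e) ∈ Ioo 0 δ := by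
          have := h1.1
          rw [inner_add_smul_unit he, topHeight_add_smul G he]
          constructor <;> linarith [h4.1, h4.2]
        by_cases hzO : x' + τ • e ∈ O
        · left
          refine ⟨?_, hzO⟩
          have : x' + τ • e - y = (x' - x) + (2 * ρ) • e := by
            simp only [y, τ, perpPart]; module
          rw [mem_ball, dist_eq_norm, this]
          calc _ ≤ ‖x' - x‖ + ‖(2 * ρ) • e‖ := norm_add_le _ _
            _ < ρ + 2 * ρ := by
              rw [norm_smul, he, mul_one, Real.norm_of_nonneg (by positivity), ← dist_eq_norm]
              have : dist x' x < ρ := h2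
              linarith
            _ = 3 * ρ := by ring
        · right
          exact ⟨cuspLines_add_smul he _ h1, h5, hzO⟩
    _ ≤ volume (ball y (3 * ρ) ∩ O) + 0 := by
        rw [measure_preimage_add_right]
        refine (measure_union_le _ _).trans ?_
        rw [volume_cuspLines_exception hG hO he]
    _ ≤ (4 * 3 ^ N)⁻¹ * volume (ball y (3 * ρ)) := by
        rw [add_zero]; exact h y hy.2 _ (by positivity) hρ1
    _ = _ := by
        rw [Measure.addHaar_ball_mul _ _ (by norm_num : (0:ℝ) ≤ 3), finrank_euclideanSpace_fin,
          ENNReal.ofReal_pow (by norm_num), ENNReal.mul_inv (by simp) (by simp), ← mul_assoc]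
        congr 1
        have : ENNReal.ofReal 3 = 3 := by simp
        rw [this, mul_assoc, ENNReal.inv_mul_cancel (by positivity) (by simp), mul_one]

theorem volume_cuspLines [Nontrivial (Pt N)] {G O : Set (Pt N)} (hG : IsClosed G)
    (hO : MeasurableSet O) {e : Pt N} (he : ‖e‖ = 1) {a δ r0 : ℝ} (hδ : 0 < δ) (hr0 : 0 < r0)
    (h : ∀ y ∈ G, ∀ r, 0 < r → r < r0 →
      volume (ball y r ∩ O) ≤ (4 * 3 ^ N)⁻¹ * volume (ball y r)) :
    volume (cuspLines G O e a (a + δ / 2) δ) = 0 := by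
  set X := cuspLines G O e a (a + δ / 2) δ with hX
  have hXm : MeasurableSet X := measurableSet_cuspLines hG hO e _ _ _
  have hhm := measurable_topHeight hG e a (a + δ / 2)
  set H := topHeight G e a (a + δ / 2)
  have hcov : X = ⋃ n : ℕ, X ∩ ball 0 n := by
    rw [← inter_iUnion, iUnion_ball_nat, inter_univ]
  rw [hcov, measure_iUnion_null_iff]
  intro n
  set X1 := X ∩ ball 0 (n : ℝ)
  have hX1m : MeasurableSet X1 := hXm.inter measurableSet_ball
  refine volume_eq_zero_of_mean_density hX1m
    ((measure_mono inter_subset_right).trans_lt measure_ball_lt_top).ne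
    (ρ0 := min (r0 / 3) (δ / 6)) (by positivity) ?_
  intro ρ hρ hρ0
  have hρ1 : 3 * ρ < r0 := by linarith [min_le_left (r0 / 3) (δ / 6)]
  have hρ2 : 3 * ρ ≤ δ / 2 := by linarith [min_le_right (r0 / 3) (δ / 6)]
  set μ2 := (volume : Measure (Pt N)).prod (volume : Measure (Pt N))
  set P : Set (Pt N × Pt N) := {q | q.1 ∈ X1 ∧ q.2 ∈ X1 ∧ dist q.2 q.1 < ρ}
  set P1 : Set (Pt N × Pt N) := {q | q.1 ∈ X1 ∧ q.2 ∈ X1 ∧ dist q.2 q.1 < ρ ∧ H q.2 ≤ H q.1}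
  have hdm : MeasurableSet {q : Pt N × Pt N | dist q.2 q.1 < ρ} :=
    measurableSet_lt (measurable_snd.dist measurable_fst) measurable_const
  have hPm : MeasurableSet P :=
    (measurable_fst hX1m).inter ((measurable_snd hX1m).inter hdm)
  have hP1m : MeasurableSet P1 :=
    (measurable_fst hX1m).inter ((measurable_snd hX1m).inter (hdm.inter
      (measurableSet_le (hhm.comp measurable_snd) (hhm.comp measurable_fst))))
  have e1 : ∫⁻ x in X1, volume (X1 ∩ ball x ρ) = μ2 P := by
    rw [Measure.prod_apply hPm, ← lintegral_indicator hX1m]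
    refine lintegral_congr fun x => ?_
    by_cases hx : x ∈ X1
    · rw [indicator_of_mem hx]
      congr 1
      ext z
      simp [P, hx]
    · rw [indicator_of_notMem hx]
      symm
      convert measure_empty (μ := (volume : Measure (Pt N)))
      ext z
      simp [P, hx]
  have e2 : μ2 P1 ≤ 4⁻¹ * volume (ball (0 : Pt N) ρ) * volume X1 := by
    rw [Measure.prod_apply hP1m, ← setLIntegral_const, ← lintegral_indicator hX1m]
    refine lintegral_mono fun x => ?_
    by_cases hx : x ∈ X1
    · rw [indicator_of_mem hx]
      refine le_trans (measure_mono ?_) (volume_cuspLines_pair hG hO he h hx.1 hρ hρ1 hρ2)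
      rintro z ⟨-, h1, h2, h3⟩
      exact ⟨⟨h1.1, h2⟩, h3⟩
    · rw [indicator_of_notMem hx]
      refine le_of_eq ?_
      convert measure_empty (μ := (volume : Measure (Pt N)))
      ext z
      simp [P1, hx]
  have e3 : μ2 (Prod.swap ⁻¹' P1) = μ2 P1 := by
    rw [← Measure.map_apply measurable_swap hP1m, Measure.prod_swap]
  rw [e1]
  calc μ2 P ≤ μ2 (P1 ∪ Prod.swap ⁻¹' P1) := by
        refine measure_mono ?_
        rintro ⟨x, z⟩ ⟨h1, h2, h3⟩
        rcases le_total (H z) (H x) with h4 | h4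
        · exact Or.inl ⟨h1, h2, h3, h4⟩
        · exact Or.inr ⟨h2, h1, by rwa [dist_comm] at h3, h4⟩
    _ ≤ μ2 P1 + μ2 P1 := (measure_union_le _ _).trans (by rw [e3])
    _ ≤ 4⁻¹ * volume (ball (0 : Pt N) ρ) * volume X1 +
          4⁻¹ * volume (ball (0 : Pt N) ρ) * volume X1 :=
        add_le_add e2 e2
    _ = (4⁻¹ + 4⁻¹) * volume (ball (0 : Pt N) ρ) * volume X1 := by ring
    _ = _ := by
        congr 2
        rw [show (4 : ENNReal) = 2 * 2 by norm_num, ENNReal.mul_inv (by simp) (by simp),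
          ← mul_add, ENNReal.inv_two_add_inv_two, mul_one]

/-- The null cusp lemma. -/
theorem volume_cusp_eq_zero [Nontrivial (Pt N)] {G O : Set (Pt N)} (hG : IsClosed G)
    (hO : MeasurableSet O) (hGO : Disjoint G O) {e : Pt N} (he : ‖e‖ = 1) {δ r0 : ℝ} (hδ : 0 < δ)
    (hr0 : 0 < r0) (h : ∀ y ∈ G, ∀ r, 0 < r → r < r0 →
      volume (ball y r ∩ O) ≤ (4 * 3 ^ N)⁻¹ * volume (ball y r)) :
    volume {x : Pt N | ∃ t : ℝ, x + t • e ∈ G ∧ ∀ s ∈ Ioc 0 δ, x + (t + s) • e ∈ O} = 0 := by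
  refine measure_mono_null (t := ⋃ n : ℤ, cuspLines G O e (n * (δ / 2)) (n * (δ / 2) + δ / 2) δ)
    ?_ (measure_iUnion_null fun n => volume_cuspLines hG hO he hδ hr0 h)
  rintro x ⟨t, ht, hs⟩
  set q : ℝ := inner ℝ e x + t with hq
  have hxq : ∀ s : ℝ, perpPart e x + (q + s) • e = x + (t + s) • e := by
    intro s; simp only [perpPart, hq]; module
  set n : ℤ := ⌊q / (δ / 2)⌋
  have hn1 : n * (δ / 2) ≤ q := (le_div_iff₀ (by positivity)).1 (Int.floor_le (q / (δ / 2)))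
  have hn2 : q < (n + 1) * (δ / 2) := (div_lt_iff₀ (by positivity)).1 (Int.lt_floor_add_one _)
  have hmem : q ∈ heights G e (n * (δ / 2)) (n * (δ / 2) + δ / 2) x := by
    refine ⟨⟨hn1, by linarith⟩, ?_⟩
    have := hxq 0
    simp only [add_zero] at this
    rwa [this]
  have hle := le_topHeight hG hmem
  have htop := topHeight_mem_heights hG (hn1.trans hle)
  have heq : topHeight G e (n * (δ / 2)) (n * (δ / 2) + δ / 2) x = q := by
    refine le_antisymm ?_ hle
    by_contra hlt
    push Not at hlt
    have h1 := hs (topHeight G e (n * (δ / 2)) (n * (δ / 2) + δ / 2) x - q)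
      ⟨by linarith, by linarith [htop.1.2]⟩
    rw [← hxq] at h1
    have h2 := htop.2
    rw [show q + (topHeight G e (n * (δ / 2)) (n * (δ / 2) + δ / 2) x - q) =
      topHeight G e (n * (δ / 2)) (n * (δ / 2) + δ / 2) x by ring] at h1
    exact hGO.le_bot ⟨h2, h1⟩
  refine mem_iUnion.2 ⟨n, hn1.trans hle, ?_⟩
  rw [heq]
  convert measure_empty (μ := (volume : Measure ℝ))
  refine eq_empty_of_forall_notMem fun s hs' => hs'.2 ?_
  rw [hxq]
  exact hs s ⟨hs'.1.1, hs'.1.2.le⟩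

/-- If the common frontier of two complementary subsets of an interval is locally contained in
`A'`, then some point of `A'` is the end point of an interval contained in `B`. -/
theorem exists_one_sided_interval {A A' B : Set ℝ} {T : ℝ} (hcov : Icc 0 T ⊆ A ∪ B)
    (hd : Disjoint A B) {p r : ℝ}
    (hp : p ∈ Icc 0 T ∩ (closure (A ∩ Icc 0 T) ∩ closure (B ∩ Icc 0 T)))
    (hr : 0 < r) (hA' : A' ⊆ A)
    (hpr : ball p r ∩ (Icc 0 T ∩ (closure (A ∩ Icc 0 T) ∩ closure (B ∩ Icc 0 T))) ⊆ A') :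
    ∃ t δ : ℝ, 0 < δ ∧ t ∈ A' ∧ (Ioc t (t + δ) ⊆ B ∨ Ico (t - δ) t ⊆ B) := by
  set D := Icc 0 T ∩ (closure (A ∩ Icc 0 T) ∩ closure (B ∩ Icc 0 T)) with hD
  have hDc : IsClosed D := isClosed_Icc.inter (isClosed_closure.inter isClosed_closure)
  obtain ⟨b, ⟨hbB, hbK⟩, hbp⟩ := Metric.mem_closure_iff.1 hp.2.2 r hr
  have hbr : b ∈ ball p r := by rwa [mem_ball, dist_comm]
  have hbD : b ∉ D := fun h => hd.le_bot ⟨hA' (hpr ⟨hbr, h⟩), hbB⟩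
  have hcl : Icc 0 T ⊆ closure (A ∩ Icc 0 T) ∪ closure (B ∩ Icc 0 T) := by
    intro x hx
    rcases hcov hx with h | h
    · exact Or.inl (subset_closure ⟨h, hx⟩)
    · exact Or.inr (subset_closure ⟨h, hx⟩)
  have main : ∀ J : Set ℝ, IsPreconnected J → J ⊆ Icc 0 T → b ∈ J → Disjoint J D → J ⊆ B := by
    intro J hJ hJT hbJ hJD x hx
    rcases hcov (hJT hx) with h | h
    · obtain ⟨y, hy, hy1, hy2⟩ := isPreconnected_closed_iff.1 hJ _ _ isClosed_closure
        isClosed_closure (hJT.trans hcl) ⟨x, hx, subset_closure ⟨h, hJT hx⟩⟩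
        ⟨b, hbJ, subset_closure ⟨hbB, hbK⟩⟩
      exact (hJD.le_bot ⟨hy, hJT hy, hy1, hy2⟩).elim
    · exact h
  have hpb : p ≠ b := fun h => hbD (h ▸ hp)
  have hconv : ∀ t ∈ uIcc p b, t ∈ ball p r := by
    intro t ht
    exact (convex_ball p r).ordConnected.uIcc_subset (mem_ball_self hr) hbr ht
  rcases lt_or_gt_of_ne hpb with h | h
  · have hcomp : IsCompact (D ∩ Icc p b) := isCompact_Icc.inter_left hDc
    have hne : (D ∩ Icc p b).Nonempty := ⟨p, hp, le_rfl, h.le⟩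
    set t := sSup (D ∩ Icc p b)
    have ht := hcomp.sSup_mem hne
    have htb : t < b := lt_of_le_of_ne ht.2.2 fun h => hbD (h ▸ ht.1)
    refine ⟨t, b - t, by linarith, hpr ⟨hconv t (Icc_subset_uIcc ht.2), ht.1⟩, Or.inl ?_⟩
    rw [add_sub_cancel]
    refine main _ isPreconnected_Ioc ?_ ⟨htb, le_rfl⟩ ?_
    · exact fun x hx => ⟨ht.1.1.1.trans hx.1.le, hx.2.trans hbK.2⟩
    · rw [Set.disjoint_left]
      intro x hx hxD
      have := le_csSup hcomp.bddAbove ⟨hxD, ht.2.1.trans hx.1.le, hx.2⟩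
      exact absurd hx.1 (not_lt.2 this)
  · have hcomp : IsCompact (D ∩ Icc b p) := isCompact_Icc.inter_left hDc
    have hne : (D ∩ Icc b p).Nonempty := ⟨p, hp, h.le, le_rfl⟩
    set t := sInf (D ∩ Icc b p)
    have ht := hcomp.sInf_mem hne
    have htb : b < t := lt_of_le_of_ne ht.2.1 fun h => hbD (h.symm ▸ ht.1)
    refine ⟨t, t - b, by linarith, hpr ⟨hconv t (Icc_subset_uIcc' ht.2), ht.1⟩, Or.inr ?_⟩
    rw [sub_sub_cancel]
    refine main _ isPreconnected_Ico ?_ ⟨le_rfl, htb⟩ ?_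
    · exact fun x hx => ⟨hbK.1.trans hx.1, hx.2.le.trans ht.1.1.2⟩
    · rw [Set.disjoint_left]
      intro x hx hxD
      have := csInf_le hcomp.bddBelow ⟨hxD, hx.1, hx.2.le.trans ht.2.2⟩
      exact absurd hx.2 (not_lt.2 this)

theorem exists_cusp_of_cover {A B : ℕ → Set ℝ} (hA : ∀ k, IsClosed (A k))
    (hB : ∀ k, IsClosed (B k)) (hd : Disjoint (⋃ k, A k) (⋃ k, B k)) {T : ℝ} (hT : 0 ≤ T)
    (hcov : Icc 0 T ⊆ (⋃ k, A k) ∪ ⋃ k, B k) (h0 : 0 ∈ ⋃ k, A k) (h1 : T ∈ ⋃ k, B k) :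
    ∃ k, ∃ t δ : ℝ, 0 < δ ∧
      ((t ∈ A k ∧ (Ioc t (t + δ) ⊆ ⋃ k, B k ∨ Ico (t - δ) t ⊆ ⋃ k, B k)) ∨
      (t ∈ B k ∧ (Ioc t (t + δ) ⊆ ⋃ k, A k ∨ Ico (t - δ) t ⊆ ⋃ k, A k))) := by
  set UA := ⋃ k, A k
  set UB := ⋃ k, B k
  set D := Icc 0 T ∩ (closure (UA ∩ Icc 0 T) ∩ closure (UB ∩ Icc 0 T)) with hD
  have hDc : IsClosed D := isClosed_Icc.inter (isClosed_closure.inter isClosed_closure)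
  have hDne : D.Nonempty := by
    refine isPreconnected_closed_iff.1 isPreconnected_Icc _ _ isClosed_closure
        isClosed_closure ?_ ⟨0, ⟨le_rfl, hT⟩, subset_closure ⟨h0, le_rfl, hT⟩⟩
        ⟨T, ⟨hT, le_rfl⟩, subset_closure ⟨h1, hT, le_rfl⟩⟩
    intro x hx
    rcases hcov hx with h | h
    · exact Or.inl (subset_closure ⟨h, hx⟩)
    · exact Or.inr (subset_closure ⟨h, hx⟩)
  have : Nonempty D := hDne.to_subtype
  have : CompleteSpace D := hDc.completeSpace_coe
  let F : ℕ ⊕ ℕ → Set D := fun s => Subtype.val ⁻¹' (Sum.elim A B s)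
  obtain ⟨s, p, hp⟩ := nonempty_interior_of_iUnion_of_closed (f := F)
    (by
      rintro (k | k)
      · exact (hA k).preimage continuous_subtype_val
      · exact (hB k).preimage continuous_subtype_val)
    (by
      refine eq_univ_of_forall fun x => ?_
      rcases hcov x.2.1 with h | h
      · obtain ⟨k, hk⟩ := mem_iUnion.1 h
        exact mem_iUnion.2 ⟨Sum.inl k, hk⟩
      · obtain ⟨k, hk⟩ := mem_iUnion.1 h
        exact mem_iUnion.2 ⟨Sum.inr k, hk⟩)
  obtain ⟨r, hr, hpr⟩ := Metric.isOpen_iff.1 isOpen_interior p hp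
  have hpr' : ball (p : ℝ) r ∩ D ⊆ Sum.elim A B s := by
    rintro x ⟨hx, hxD⟩
    have : (⟨x, hxD⟩ : D) ∈ F s := interior_subset (hpr hx)
    exact this
  rcases s with k | k
  · obtain ⟨t, δ, hδ, ht, h⟩ := exists_one_sided_interval hcov hd p.2 hr
      (subset_iUnion A k) hpr'
    exact ⟨k, t, δ, hδ, Or.inl ⟨ht, h⟩⟩
  · have hsw : D = Icc 0 T ∩ (closure (UB ∩ Icc 0 T) ∩ closure (UA ∩ Icc 0 T)) := by
      rw [hD, inter_comm (closure (UA ∩ _))]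
    obtain ⟨t, δ, hδ, ht, h⟩ := exists_one_sided_interval (by rwa [union_comm]) hd.symm
      (by rw [← hsw]; exact p.2) hr (subset_iUnion B k) (by rw [← hsw]; exact hpr')
    exact ⟨k, t, δ, hδ, Or.inr ⟨ht, h⟩⟩

/-- The points around which `E` occupies all but a small fraction of every ball of radius
less than `1 / (k + 1)`. -/
def fullUpTo (E : Set (Pt N)) (k : ℕ) : Set (Pt N) :=
  {x | ∀ r : ℝ, 0 < r → r < 1 / (k + 1) →
    volume (ball x r \ E) ≤ (4 * 3 ^ N)⁻¹ * volume (ball x r)}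

theorem isClosed_fullUpTo (E : Set (Pt N)) (k : ℕ) : IsClosed (fullUpTo E k) := by
  refine isClosed_of_closure_subset fun x hx r hr hrk => ?_
  have hmono : Monotone fun n : ℕ => ball x (r - r / (n + 1)) \ E := by
    intro n n' hn
    refine sdiff_subset_sdiff_left (ball_subset_ball ?_)
    gcongr
  have hU : ⋃ n : ℕ, ball x (r - r / (n + 1)) \ E = ball x r \ E := by
    rw [← iUnion_sdiff]
    congr 1
    refine subset_antisymm (iUnion_subset fun n => ball_subset_ball ?_) fun y hy => ?_
    · have : 0 ≤ r / (n + 1) := by positivity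
      linarith
    · obtain ⟨n, hn⟩ := exists_nat_gt (r / (r - dist y x))
      have hy' : 0 < r - dist y x := by simpa using hy
      refine mem_iUnion.2 ⟨n, ?_⟩
      rw [mem_ball]
      have h1 : r / (n + 1) < r - dist y x := by
        rw [div_lt_iff₀ (by positivity)]
        rw [div_lt_iff₀ hy'] at hn
        nlinarith
      linarith
  rw [← hU, hmono.measure_iUnion]
  refine iSup_le fun n => ?_
  obtain ⟨y, hy, hxy⟩ := Metric.mem_closure_iff.1 hx (r / (n + 1)) (by positivity)
  calc _ ≤ volume (ball y r \ E) := by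
        refine measure_mono (sdiff_subset_sdiff_left (ball_subset_ball' ?_))
        linarith
    _ ≤ _ := hy r hr hrk
    _ = _ := by rw [Measure.addHaar_ball_center, Measure.addHaar_ball_center volume x]

/-- Points of density one lie in some `fullUpTo E k`. -/
theorem mem_iUnion_fullUpTo {E : Set (Pt N)} (hE : MeasurableSet E) {x : Pt N}
    (hx : densTendsto E x 1) : x ∈ ⋃ k, fullUpTo E k := by
  have h1 : (1 : ENNReal) - (4 * 3 ^ N)⁻¹ < 1 :=
    ENNReal.sub_lt_self (by simp) (by simp) (by simp [ENNReal.mul_eq_top])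
  have h2 := hx.eventually (lt_mem_nhds h1)
  rw [eventually_nhdsWithin_iff, Metric.eventually_nhds_iff] at h2
  obtain ⟨η, hη, h⟩ := h2
  obtain ⟨k, hk⟩ := exists_nat_one_div_lt hη
  refine mem_iUnion.2 ⟨k, fun r hr hrk => ?_⟩
  obtain ⟨hb1, hb2⟩ := volume_ball_pos_ne x hr
  have h3 := (h (y := r) (by simp [abs_of_pos hr]; linarith) hr).le
  rw [ENNReal.le_div_iff_mul_le (Or.inl hb1) (Or.inl hb2)] at h3
  have h4 : volume (ball x r) = volume (E ∩ ball x r) + volume (ball x r \ E) := by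
    rw [inter_comm, measure_inter_add_sdiff _ hE]
  have h5 : volume (ball x r) ≤ (1 - (4 * 3 ^ N)⁻¹) * volume (ball x r) +
      (4 * 3 ^ N)⁻¹ * volume (ball x r) := by
    rw [← add_mul]
    conv_lhs => rw [← one_mul (volume (ball x r))]
    gcongr
    exact le_tsub_add
  have hfin : (1 - (4 * 3 ^ N)⁻¹) * volume (ball x r) ≠ ⊤ :=
    ENNReal.mul_ne_top (ne_top_of_le_ne_top ENNReal.one_ne_top tsub_le_self) hb2
  have h6 : volume (E ∩ ball x r) + volume (ball x r \ E) ≤ volume (E ∩ ball x r) +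
      (4 * 3 ^ N)⁻¹ * volume (ball x r) := by
    rw [← h4]; exact h5.trans (by gcongr)
  exact (ENNReal.add_le_add_iff_left
    ((measure_mono inter_subset_right).trans_lt measure_ball_lt_top).ne).1 h6

theorem densTendsto_compl {E : Set (Pt N)} (hE : MeasurableSet E) {x : Pt N} :
    densTendsto Eᶜ x 1 ↔ densTendsto E x 0 := by
  have key : ∀ F : Set (Pt N), MeasurableSet F → ∀ l : ENNReal, l ≤ 1 → densTendsto F x l →
      densTendsto Fᶜ x (1 - l) := by
    intro F hF l hl h
    have h1 : Tendsto (fun r : ℝ => 1 - volume (F ∩ ball x r) / volume (ball x r))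
        (nhdsWithin 0 (Ioi 0)) (nhds (1 - l)) :=
      ENNReal.Tendsto.sub tendsto_const_nhds h (Or.inl ENNReal.one_ne_top)
    refine h1.congr' ?_
    filter_upwards [self_mem_nhdsWithin] with r hr
    obtain ⟨hb1, hb2⟩ := volume_ball_pos_ne x hr
    have h4 : volume (Fᶜ ∩ ball x r) + volume (F ∩ ball x r) = volume (ball x r) := by
      rw [inter_comm, inter_comm F, ← sdiff_eq, add_comm, measure_inter_add_sdiff _ hF]
    have h5 : volume (Fᶜ ∩ ball x r) / volume (ball x r) +
        volume (F ∩ ball x r) / volume (ball x r) = 1 := by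
      rw [← ENNReal.add_div, h4, ENNReal.div_self hb1 hb2]
    rw [← h5, ENNReal.add_sub_cancel_right]
    exact (ENNReal.div_lt_top (ne_top_of_le_ne_top hb2 (measure_mono inter_subset_right)) hb1).ne
  constructor
  · intro h
    simpa using key _ hE.compl 1 le_rfl h
  · intro h
    simpa using key _ hE 0 zero_le_one h

theorem disjoint_fullUpTo (E : Set (Pt N)) :
    Disjoint (⋃ k, fullUpTo E k) (⋃ k, fullUpTo Eᶜ k) := by
  rw [Set.disjoint_left]
  intro x hx hx'
  obtain ⟨k, hk⟩ := mem_iUnion.1 hx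
  obtain ⟨j, hj⟩ := mem_iUnion.1 hx'
  obtain ⟨r, hr, hr'⟩ := exists_between
    (show (0 : ℝ) < min (1 / ((k : ℝ) + 1)) (1 / ((j : ℝ) + 1)) by positivity)
  have h1 := hk r hr (hr'.trans_le (min_le_left _ _))
  have h2 := hj r hr (hr'.trans_le (min_le_right _ _))
  obtain ⟨hb1, hb2⟩ := volume_ball_pos_ne x hr
  have h3 : volume (ball x r) ≤ 2⁻¹ * volume (ball x r) := by
    calc volume (ball x r) ≤ volume (ball x r \ E) + volume (ball x r \ Eᶜ) := by
          refine (measure_mono ?_).trans (measure_union_le _ _)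
          intro y hy
          by_cases h : y ∈ E
          · exact Or.inr ⟨hy, fun h' => h' h⟩
          · exact Or.inl ⟨hy, h⟩
      _ ≤ _ := add_le_add h1 h2
      _ ≤ 4⁻¹ * volume (ball x r) + 4⁻¹ * volume (ball x r) := by
          have : (4 * 3 ^ N : ENNReal)⁻¹ ≤ 4⁻¹ := by
            refine ENNReal.inv_le_inv.2 ?_
            conv_lhs => rw [← mul_one (4 : ENNReal)]
            gcongr
            exact one_le_pow₀ (by norm_num)
          gcongr
      _ = (4⁻¹ + 4⁻¹) * volume (ball x r) := by ring
      _ = _ := by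
        congr 1
        rw [show (4 : ENNReal) = 2 * 2 by norm_num, ENNReal.mul_inv (by simp) (by simp),
          ← mul_add, ENNReal.inv_two_add_inv_two, mul_one]
  have := ENNReal.half_lt_self hb1 hb2
  rw [div_eq_mul_inv, mul_comm] at this
  exact absurd h3 (not_le.2 this)

theorem volume_fullUpTo_compl_inter [Nontrivial (Pt N)] {E : Set (Pt N)} (hE : MeasurableSet E) :
    volume ((⋃ k, fullUpTo Eᶜ k) ∩ E) = 0 := by
  have h := ae_densTendsto hE
  refine measure_mono_null ?_ h
  rintro x ⟨hx, hxE⟩ h'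
  have : densTendsto E x 1 := by simpa [hxE] using h'
  exact (disjoint_fullUpTo E).le_bot ⟨mem_iUnion_fullUpTo hE this, hx⟩

theorem fullUpTo_cusp [Nontrivial (Pt N)] {E : Set (Pt N)} (hE : MeasurableSet E) (k : ℕ)
    {e : Pt N} (he : ‖e‖ = 1) {δ : ℝ} (hδ : 0 < δ) :
    volume {x : Pt N | ∃ t : ℝ, x + t • e ∈ fullUpTo E k ∧
      ∀ s ∈ Ioc 0 δ, x + (t + s) • e ∈ ⋃ k, fullUpTo Eᶜ k} = 0 := by
  refine volume_cusp_eq_zero (isClosed_fullUpTo E k)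
    (MeasurableSet.iUnion fun j => (isClosed_fullUpTo Eᶜ j).measurableSet)
    ((disjoint_fullUpTo E).mono_left (subset_iUnion _ k)) he hδ
    (show (0 : ℝ) < 1 / (k + 1) by positivity) ?_
  intro y hy r hr hrk
  refine le_trans ?_ (hy r hr hrk)
  calc volume (ball y r ∩ ⋃ k, fullUpTo Eᶜ k)
      ≤ volume (ball y r \ E) + volume ((⋃ k, fullUpTo Eᶜ k) ∩ E) := by
        refine (measure_mono ?_).trans (measure_union_le _ _)
        rintro z ⟨h1, h2⟩
        by_cases h : z ∈ E
        · exact Or.inr ⟨h2, h⟩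
        · exact Or.inl ⟨h1, h⟩
    _ = _ := by rw [volume_fullUpTo_compl_inter hE, add_zero]

theorem fullUpTo_cusp_ae [Nontrivial (Pt N)] {E : Set (Pt N)} (hE : MeasurableSet E)
    {e : Pt N} (he : ‖e‖ = 1) :
    ∀ᵐ x : Pt N, ¬ ∃ k, ∃ t δ : ℝ, 0 < δ ∧ x + t • e ∈ fullUpTo E k ∧
      ∀ s ∈ Ioc 0 δ, x + (t + s) • e ∈ ⋃ k, fullUpTo Eᶜ k := by
  have h : volume (⋃ k : ℕ, ⋃ j : ℕ, {x : Pt N | ∃ t : ℝ, x + t • e ∈ fullUpTo E k ∧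
      ∀ s ∈ Ioc (0 : ℝ) (1 / (j + 1)), x + (t + s) • e ∈ ⋃ k, fullUpTo Eᶜ k}) = 0 :=
    measure_iUnion_null fun k => measure_iUnion_null fun j => fullUpTo_cusp hE k he (by positivity)
  refine measure_mono_null ?_ h
  intro x hx
  simp only [mem_compl_iff, mem_ofPred_eq, not_not] at hx
  obtain ⟨k, t, δ, hδ, h1, h2⟩ := hx
  obtain ⟨j, hj⟩ := exists_nat_one_div_lt hδ
  exact mem_iUnion.2 ⟨k, mem_iUnion.2 ⟨j, t, h1, fun s hs => h2 s ⟨hs.1, hs.2.trans hj.le⟩⟩⟩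

/-- For almost every `x`, if the segment from `x` to `x + u` starts in `E` and ends outside `E`,
then it meets the essential boundary of `E`. -/
theorem ae_segment_meets_essBdry [Nontrivial (Pt N)] {E : Set (Pt N)} (hE : MeasurableSet E)
    (u : Pt N) : ∀ᵐ x : Pt N, x ∈ E → x + u ∉ E → ∃ t ∈ Icc (0 : ℝ) 1, x + t • u ∈ essBdry E := by
  rcases eq_or_ne u 0 with rfl | hu
  · filter_upwards with x h1 h2
    simp [h1] at h2
  set T := ‖u‖ with hT
  have hTpos : 0 < T := norm_pos_iff.2 hu
  set e := T⁻¹ • u with hedef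
  have he : ‖e‖ = 1 := by
    rw [hedef, norm_smul, norm_inv, Real.norm_of_nonneg hTpos.le, inv_mul_cancel₀ hTpos.ne']
  have hne : ‖-e‖ = 1 := by rw [norm_neg, he]
  have hTe : T • e = u := by rw [hedef, smul_inv_smul₀ hTpos.ne']
  have hEc : Eᶜᶜ = E := compl_compl E
  have hshift : ∀ᵐ x : Pt N, densTendsto E (x + u) (E.indicator 1 (x + u)) :=
    (measurePreserving_add_right (volume : Measure (Pt N)) u).quasiMeasurePreserving.ae
      (ae_densTendsto hE)
  filter_upwards [ae_densTendsto hE, hshift, fullUpTo_cusp_ae hE he, fullUpTo_cusp_ae hE hne,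
    fullUpTo_cusp_ae hE.compl he, fullUpTo_cusp_ae hE.compl hne] with x h1 h2 c1 c2 c3 c4 hx hxu
  rw [hEc] at c3 c4
  by_contra hno
  push Not at hno
  have hl : ∀ k, IsClosed ((fun t : ℝ => x + t • e) ⁻¹' fullUpTo E k) := fun k =>
    (isClosed_fullUpTo E k).preimage (by fun_prop)
  have hl' : ∀ k, IsClosed ((fun t : ℝ => x + t • e) ⁻¹' fullUpTo Eᶜ k) := fun k =>
    (isClosed_fullUpTo Eᶜ k).preimage (by fun_prop)
  have d1 : densTendsto E x 1 := by simpa [hx] using h1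
  have d2 : densTendsto E (x + u) 0 := by simpa [hxu] using h2
  obtain ⟨k, t, δ, hδ, h⟩ := exists_cusp_of_cover hl hl'
    (by
      rw [← preimage_iUnion, ← preimage_iUnion]
      exact (disjoint_fullUpTo E).preimage _) hTpos.le
    (by
      intro t ht
      rw [← preimage_iUnion, ← preimage_iUnion]
      have hn := hno (t / T) ⟨div_nonneg ht.1 hTpos.le, (div_le_one hTpos).2 ht.2⟩
      have hte : x + (t / T) • u = x + t • e := by
        rw [hedef, smul_smul, div_eq_mul_inv]
      rw [hte] at hn
      by_cases hd0 : densTendsto E (x + t • e) 0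
      · right
        exact mem_iUnion_fullUpTo hE.compl ((densTendsto_compl hE).2 hd0)
      · left
        refine mem_iUnion_fullUpTo hE ?_
        by_contra hd1
        exact hn ⟨hd0, hd1⟩)
    (by
      rw [← preimage_iUnion]
      simpa using mem_iUnion_fullUpTo hE d1)
    (by
      rw [← preimage_iUnion, mem_preimage, hTe]
      exact mem_iUnion_fullUpTo hE.compl ((densTendsto_compl hE).2 d2))
  rw [← preimage_iUnion, ← preimage_iUnion] at h
  have conv1 : ∀ {U : Set (Pt N)}, Ioc t (t + δ) ⊆ (fun t : ℝ => x + t • e) ⁻¹' U →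
      ∀ s ∈ Ioc 0 δ, x + (t + s) • e ∈ U := fun hU s hs =>
    hU ⟨by linarith [hs.1], by linarith [hs.2]⟩
  have conv2 : ∀ {U : Set (Pt N)}, Ico (t - δ) t ⊆ (fun t : ℝ => x + t • e) ⁻¹' U →
      ∀ s ∈ Ioc 0 δ, x + (-t + s) • -e ∈ U := by
    intro U hU s hs
    have : x + (t - s) • e ∈ U := hU ⟨by linarith [hs.2], by linarith [hs.1]⟩
    convert this using 1
    module
  have hneg : ∀ {U : Set (Pt N)}, x + t • e ∈ U → x + (-t) • -e ∈ U := by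
    intro U h; simpa using h
  rcases h with ⟨ht, h | h⟩ | ⟨ht, h | h⟩
  · exact c1 ⟨k, t, δ, hδ, ht, conv1 h⟩
  · exact c2 ⟨k, -t, δ, hδ, hneg ht, conv2 h⟩
  · exact c3 ⟨k, t, δ, hδ, ht, conv1 h⟩
  · exact c4 ⟨k, -t, δ, hδ, hneg ht, conv2 h⟩

/-- The constant in the tube estimate. -/
def tubeConst (N : ℕ) : ℝ := 3 * 2 ^ N * (volume (ball (0 : Pt N) 1)).toReal

theorem tubeConst_pos : 0 < tubeConst N := by
  obtain ⟨h1, h2⟩ := volume_ball_pos_ne (0 : Pt N) one_pos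
  have := ENNReal.toReal_pos h1 h2
  unfold tubeConst
  positivity

theorem volume_tube_closedBall [Nontrivial (Pt N)] (y u : Pt N) {δ : ℝ} (hδ : 0 < δ)
    (hu : δ ≤ ‖u‖) :
    volume {x : Pt N | ∃ t ∈ Icc (0 : ℝ) 1, x + t • u ∈ closedBall y δ} ≤
      ENNReal.ofReal (tubeConst N * ‖u‖ * δ ^ ((N : ℝ) - 1)) := by
  have hu0 : 0 < ‖u‖ := hδ.trans_le hu
  set K : ℕ := ⌈‖u‖ / δ⌉₊ with hK
  have hK1 : ‖u‖ / δ ≤ K := Nat.le_ceil _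
  have hK2 : (K : ℝ) < ‖u‖ / δ + 1 := Nat.ceil_lt_add_one (by positivity)
  have h1 : 1 ≤ ‖u‖ / δ := (one_le_div hδ).2 hu
  have hKpos : (0 : ℝ) < K := by linarith
  have huK : ‖u‖ ≤ K * δ := (div_le_iff₀ hδ).1 hK1
  have hsub : {x : Pt N | ∃ t ∈ Icc (0 : ℝ) 1, x + t • u ∈ closedBall y δ} ⊆
      ⋃ k ∈ Finset.range (K + 1), closedBall (y - ((k : ℝ) / K) • u) (2 * δ) := by
    rintro x ⟨t, ht, hx⟩
    have h2 : t * K ≤ K := by nlinarith [ht.2]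
    have h0 : 0 ≤ t * K := by nlinarith [ht.1]
    simp only [mem_iUnion, Finset.mem_range]
    refine ⟨⌊t * K⌋₊, ?_, ?_⟩
    · have := Nat.floor_le_of_le h2
      omega
    · have h3 := Nat.floor_le h0
      have h4 := Nat.lt_floor_add_one (t * K)
      have h5 : x - (y - ((⌊t * K⌋₊ : ℝ) / K) • u) =
          (x + t • u - y) - (t - (⌊t * K⌋₊ : ℝ) / K) • u := by module
      rw [mem_closedBall, dist_eq_norm, h5]
      have h6 : |t - (⌊t * K⌋₊ : ℝ) / K| ≤ 1 / K := by
        rw [abs_of_nonneg]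
        · rw [le_div_iff₀ hKpos, sub_mul, div_mul_cancel₀ _ hKpos.ne']; linarith
        · rw [sub_nonneg, div_le_iff₀ hKpos]; exact h3
      calc _ ≤ ‖x + t • u - y‖ + ‖(t - (⌊t * K⌋₊ : ℝ) / K) • u‖ := norm_sub_le _ _
        _ ≤ δ + 1 / K * ‖u‖ := by
          rw [norm_smul, Real.norm_eq_abs]
          have : ‖x + t • u - y‖ ≤ δ := by rwa [mem_closedBall, dist_eq_norm] at hx
          gcongr
        _ ≤ δ + δ := by
          have : 1 / K * ‖u‖ ≤ δ := by
            rw [one_div_mul_eq_div, div_le_iff₀ hKpos, mul_comm]; exact huK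
          linarith
        _ = 2 * δ := by ring
  have hball : ∀ z : Pt N, volume (closedBall z (2 * δ)) =
      ENNReal.ofReal ((2 * δ) ^ N * (volume (ball (0 : Pt N) 1)).toReal) := by
    intro z
    have := Measure.addHaar_ball_mul (volume : Measure (Pt N)) z
      (by positivity : (0 : ℝ) ≤ 2 * δ) 1
    rw [Measure.addHaar_closedBall_eq_addHaar_ball, ENNReal.ofReal_mul (by positivity),
      ENNReal.ofReal_toReal (volume_ball_pos_ne _ one_pos).2]
    rwa [mul_one, finrank_euclideanSpace_fin] at this
  calc _ ≤ ∑ k ∈ Finset.range (K + 1), volume (closedBall (y - ((k : ℝ) / K) • u) (2 * δ)) :=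
        (measure_mono hsub).trans (measure_biUnion_finset_le _ _)
    _ = ENNReal.ofReal ((K + 1) * ((2 * δ) ^ N * (volume (ball (0 : Pt N) 1)).toReal)) := by
        simp only [hball, Finset.sum_const, Finset.card_range]
        rw [nsmul_eq_mul, ← ENNReal.ofReal_natCast, ← ENNReal.ofReal_mul (by positivity)]
        push_cast
        rfl
    _ ≤ _ := by
        refine ENNReal.ofReal_le_ofReal ?_
        have e1 : δ ^ ((N : ℝ) - 1) = δ ^ N / δ := by
          rw [Real.rpow_sub hδ, Real.rpow_one, Real.rpow_natCast]
        rw [e1, tubeConst, mul_pow]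
        have e2 : (K : ℝ) + 1 ≤ 3 * (‖u‖ / δ) := by linarith
        calc _ ≤ 3 * (‖u‖ / δ) * (2 ^ N * δ ^ N * (volume (ball (0 : Pt N) 1)).toReal) := by
              gcongr
          _ = _ := by ring

theorem volume_tube_le_diam (hN : 2 ≤ N) (u : Pt N) {S : Set (Pt N)} (hS : S.Nonempty)
    (hu0 : u ≠ 0) (hd : ediam S ≤ ENNReal.ofReal ‖u‖) :
    volume {x : Pt N | ∃ t ∈ Icc (0 : ℝ) 1, x + t • u ∈ S} ≤
      ENNReal.ofReal (tubeConst N * ‖u‖) * ediam S ^ ((N : ℝ) - 1) := by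
  have : NeZero N := ⟨by omega⟩
  have hN' : (2 : ℝ) ≤ N := by exact_mod_cast hN
  obtain ⟨y, hy⟩ := hS
  have hfin : ediam S ≠ ⊤ := ne_top_of_le_ne_top ENNReal.ofReal_ne_top hd
  have hu : 0 < ‖u‖ := norm_pos_iff.2 hu0
  have hsub : ∀ δ : ℝ, ediam S ≤ ENNReal.ofReal δ → 0 ≤ δ → S ⊆ closedBall y δ := by
    intro δ hδ hδ0 z hz
    rw [mem_closedBall, dist_edist]
    exact ENNReal.toReal_le_of_le_ofReal hδ0 ((edist_le_ediam_of_mem hz hy).trans hδ)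
  have hmain : ∀ δ : ℝ, ediam S ≤ ENNReal.ofReal δ → 0 < δ → δ ≤ ‖u‖ →
      volume {x : Pt N | ∃ t ∈ Icc (0 : ℝ) 1, x + t • u ∈ S} ≤
      ENNReal.ofReal (tubeConst N * ‖u‖ * δ ^ ((N : ℝ) - 1)) := by
    intro δ h1 h2 h3
    refine le_trans (measure_mono ?_) (volume_tube_closedBall y u h2 h3)
    rintro x ⟨t, ht, hx⟩
    exact ⟨t, ht, hsub δ h1 h2.le hx⟩
  rcases eq_or_ne (ediam S) 0 with h0 | h0
  · have hlim : Tendsto (fun δ : ℝ => ENNReal.ofReal (tubeConst N * ‖u‖ * δ ^ ((N : ℝ) - 1)))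
        (nhdsWithin 0 (Ioi 0)) (nhds 0) := by
      have : Continuous fun δ : ℝ => ENNReal.ofReal (tubeConst N * ‖u‖ * δ ^ ((N : ℝ) - 1)) :=
        ENNReal.continuous_ofReal.comp (continuous_const.mul
          (Real.continuous_rpow_const (by linarith)))
      have h := (this.tendsto 0).mono_left (nhdsWithin_le_nhds (s := Ioi 0))
      rwa [Real.zero_rpow (by linarith), mul_zero, ENNReal.ofReal_zero] at h
    have hz : volume {x : Pt N | ∃ t ∈ Icc (0 : ℝ) 1, x + t • u ∈ S} ≤ 0 := by
      refine ge_of_tendsto hlim ?_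
      filter_upwards [Ioo_mem_nhdsGT hu] with δ hδ
      exact hmain δ (by rw [h0]; exact zero_le) hδ.1 hδ.2.le
    exact hz.trans zero_le
  · have h1 : 0 < (ediam S).toReal := ENNReal.toReal_pos h0 hfin
    refine (hmain (ediam S).toReal (ENNReal.ofReal_toReal hfin).ge h1
      (ENNReal.toReal_le_of_le_ofReal hu.le hd)).trans_eq ?_
    rw [ENNReal.ofReal_mul (mul_nonneg tubeConst_pos.le hu.le),
      ← ENNReal.ofReal_rpow_of_pos h1, ENNReal.ofReal_toReal hfin]

theorem volume_tube_le (hN : 2 ≤ N) (u : Pt N) (T : Set (Pt N)) :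
    volume {x : Pt N | ∃ t ∈ Icc (0 : ℝ) 1, x + t • u ∈ T} ≤
      ENNReal.ofReal (tubeConst N * ‖u‖) * μH[(N : ℝ) - 1] T ∨ u = 0 := by
  by_cases hu0 : u = 0
  · exact Or.inr hu0
  left
  have hu : 0 < ‖u‖ := norm_pos_iff.2 hu0
  have hc : ENNReal.ofReal (tubeConst N * ‖u‖) ≠ 0 := by
    simpa using mul_pos tubeConst_pos hu
  rw [Measure.hausdorffMeasure_apply, mul_comm, ← ENNReal.div_le_iff_le_mul (Or.inl hc)
    (Or.inl ENNReal.ofReal_ne_top)]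
  refine le_trans ?_ (le_iSup₂ (ENNReal.ofReal ‖u‖) (by simpa using hu0))
  refine le_iInf fun t => le_iInf fun hT => le_iInf fun hd => ?_
  rw [ENNReal.div_le_iff_le_mul (Or.inl hc) (Or.inl ENNReal.ofReal_ne_top), mul_comm,
    ← ENNReal.tsum_mul_left]
  calc volume {x : Pt N | ∃ s ∈ Icc (0 : ℝ) 1, x + s • u ∈ T}
      ≤ volume (⋃ n, {x : Pt N | ∃ s ∈ Icc (0 : ℝ) 1, x + s • u ∈ t n}) := by
        refine measure_mono ?_
        rintro x ⟨s, hs, hx⟩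
        obtain ⟨n, hn⟩ := mem_iUnion.1 (hT hx)
        exact mem_iUnion.2 ⟨n, s, hs, hn⟩
    _ ≤ ∑' n, volume {x : Pt N | ∃ s ∈ Icc (0 : ℝ) 1, x + s • u ∈ t n} := measure_iUnion_le _
    _ ≤ _ := by
        refine ENNReal.tsum_le_tsum fun n => ?_
        rcases (t n).eq_empty_or_nonempty with h | h
        · simp [h]
        · refine (volume_tube_le_diam hN u h hu0 (hd n)).trans ?_
          gcongr
          exact le_iSup (fun _ : (t n).Nonempty => ediam (t n) ^ ((N : ℝ) - 1)) h

/-- The interface measure of a labelling. -/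
def bdryMeas {m : ℕ} (c : Pt N → Fin (m + 1)) : Measure (Pt N) :=
  (μH[(N : ℝ) - 1]).restrict (⋃ i, essBdry (c ⁻¹' {i}))

theorem volume_ne_shift_le {m : ℕ} (hN : 2 ≤ N) {c : Pt N → Fin (m + 1)} (hc : Measurable c)
    (u : Pt N) {A A' : Set (Pt N)} (hA' : MeasurableSet A')
    (hAA : ∀ x ∈ A, ∀ t ∈ Icc (0 : ℝ) 1, x + t • u ∈ A') :
    volume (A ∩ {x | c (x + u) ≠ c x}) ≤ ENNReal.ofReal (tubeConst N * ‖u‖) * bdryMeas c A' := by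
  have : NeZero N := ⟨by omega⟩
  rcases eq_or_ne u 0 with rfl | hu
  · simp
  have hae : ∀ᵐ x : Pt N, ∀ i, x ∈ c ⁻¹' {i} → x + u ∉ c ⁻¹' {i} →
      ∃ t ∈ Icc (0 : ℝ) 1, x + t • u ∈ essBdry (c ⁻¹' {i}) :=
    ae_all_iff.2 fun i => ae_segment_meets_essBdry (hc (measurableSet_singleton i)) u
  rw [bdryMeas, Measure.restrict_apply hA']
  refine le_trans (measure_mono_ae ?_)
    ((volume_tube_le hN u (A' ∩ ⋃ i, essBdry (c ⁻¹' {i}))).resolve_right hu)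
  filter_upwards [hae] with x hx
  rintro ⟨h1, h2⟩
  obtain ⟨t, ht, h⟩ := hx (c x) rfl h2
  exact ⟨t, ht, hAA x h1 t ht, mem_iUnion.2 ⟨c x, h⟩⟩

/-- A subadditive function with linear bounds has a linear rate at zero. -/
theorem exists_tendsto_div_of_subadditive {φ : ℝ → ℝ} {K : ℝ}
    (hsub : ∀ s t, 0 ≤ s → 0 ≤ t → φ (s + t) ≤ φ s + φ t)
    (h0 : ∀ t, 0 ≤ t → 0 ≤ φ t) (hK : ∀ t, 0 ≤ t → φ t ≤ K * t) :
    ∃ L : ℝ, (∀ t, 0 < t → φ t / t ≤ L) ∧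
      Tendsto (fun t => φ t / t) (nhdsWithin 0 (Ioi 0)) (nhds L) := by
  set A : Set ℝ := (fun t => φ t / t) '' Ioi 0
  have hbdd : BddAbove A := by
    refine ⟨K, ?_⟩
    rintro _ ⟨t, ht, rfl⟩
    exact (div_le_iff₀ ht).2 (hK t (le_of_lt ht))
  have hle : ∀ t, 0 < t → φ t / t ≤ sSup A := fun t ht => le_csSup hbdd ⟨t, ht, rfl⟩
  have hne : A.Nonempty := ⟨_, 1, mem_Ioi.2 one_pos, rfl⟩
  refine ⟨sSup A, hle, ?_⟩
  have hmul : ∀ (n : ℕ) (t : ℝ), 0 ≤ t → φ (n * t) ≤ n * φ t := by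
    intro n t ht
    induction n with
    | zero => simpa using hK 0 le_rfl
    | succ n ih =>
      push_cast
      rw [add_mul, one_mul, add_mul, one_mul]
      exact (hsub _ _ (by positivity) ht).trans (by linarith)
  have hKpos : 0 ≤ |K| := abs_nonneg K
  rw [tendsto_order]
  constructor
  · intro a ha
    obtain ⟨_, ⟨t1, ht1, rfl⟩, h1⟩ := exists_lt_of_lt_csSup hne ha
    have ht1' : 0 < t1 := ht1
    have hη : 0 < φ t1 / t1 - a := sub_pos.2 h1
    have hev : ∀ᶠ t : ℝ in nhdsWithin 0 (Ioi 0), |K| * t / t1 < φ t1 / t1 - a := by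
      have : Tendsto (fun t : ℝ => |K| * t / t1) (nhdsWithin 0 (Ioi 0)) (nhds (|K| * 0 / t1)) :=
        (((continuous_const.mul continuous_id).div_const t1).tendsto 0).mono_left
          nhdsWithin_le_nhds
      exact this.eventually (gt_mem_nhds (by simpa using hη))
    filter_upwards [hev, self_mem_nhdsWithin] with t ht htpos
    have htpos' : 0 < t := htpos
    set n := ⌊t1 / t⌋₊
    have hn1 : (n : ℝ) ≤ t1 / t := Nat.floor_le (by positivity)
    have hn2 : t1 / t < n + 1 := Nat.lt_floor_add_one _
    have hn1' : n * t ≤ t1 := (le_div_iff₀ htpos').1 hn1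
    have hn2' : t1 < (n + 1) * t := (div_lt_iff₀ htpos').1 hn2
    have h2 : φ t1 ≤ n * φ t + |K| * t := by
      have := hsub (n * t) (t1 - n * t) (by positivity) (by linarith)
      rw [add_sub_cancel] at this
      have h3 := hK (t1 - n * t) (by linarith)
      have h4 := hmul n t htpos'.le
      have h5 : K * (t1 - n * t) ≤ |K| * t := by
        calc _ ≤ |K| * (t1 - n * t) := mul_le_mul_of_nonneg_right (le_abs_self K) (by linarith)
          _ ≤ _ := by gcongr; linarith
      linarith
    have h6 : φ t1 / t1 ≤ φ t / t + |K| * t / t1 := by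
      have := h0 t htpos'.le
      rw [← sub_le_iff_le_add, ← sub_div, div_le_div_iff₀ ht1' htpos']
      nlinarith
    linarith
  · intro a ha
    filter_upwards [self_mem_nhdsWithin] with t ht
    exact (hle t ht).trans_lt ha

/-- The points of `S` that leave `S` under the shift by `u`. -/
def exitSet {m : ℕ} (c : Pt N → Fin (m + 1)) (S : Set (Fin (m + 1))) (u : Pt N) : Set (Pt N) :=
  {x | c x ∈ S ∧ c (x + u) ∉ S}

/-- The points from which two consecutive shifts both change, or undo, the label. -/
def badSet {m : ℕ} (c : Pt N → Fin (m + 1)) (u w : Pt N) : Set (Pt N) :=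
  {x | c (x + u) ≠ c x ∧ c (x + u) ≠ c (x + u + w)}

section PureCubes

variable {m : ℕ} {c : Pt N → Fin (m + 1)}

theorem measurableSet_label (hc : Measurable c) {u : Pt N} (S : Set (Fin (m + 1))) :
    MeasurableSet {x | c (x + u) ∈ S} :=
  (hc.comp (measurable_add_const u)) (MeasurableSet.of_discrete (s := S))

theorem measurableSet_exitSet (hc : Measurable c) (S : Set (Fin (m + 1))) (u : Pt N) :
    MeasurableSet (exitSet c S u) :=
  (hc (MeasurableSet.of_discrete (s := S))).inter (measurableSet_label hc Sᶜ)

theorem volume_exitSet_le (hN : 2 ≤ N) (hc : Measurable c) (S : Set (Fin (m + 1))) (u : Pt N) :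
    volume (exitSet c S u) ≤ ENNReal.ofReal (tubeConst N * ‖u‖) * bdryMeas c univ := by
  refine (measure_mono ?_).trans
    (volume_ne_shift_le hN hc u MeasurableSet.univ (A := univ) (by simp))
  rintro x ⟨h1, h2⟩
  exact ⟨trivial, fun h => h2 (h ▸ h1)⟩

theorem volume_exitSet_add (hc : Measurable c) (S : Set (Fin (m + 1))) (u w : Pt N) :
    volume (exitSet c S (u + w)) + volume {x | c x ∈ S ∧ c (x + u) ∉ S ∧ c (x + u + w) ∈ S} ≤
      volume (exitSet c S u) + volume (exitSet c S w) := by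
  have hw : volume (exitSet c S w) = volume ((fun x => x + u) ⁻¹' exitSet c S w) :=
    (measure_preimage_add_right _ _ _).symm
  have m0 : MeasurableSet {x | c x ∈ S} := hc (MeasurableSet.of_discrete (s := S))
  have m1 := measurableSet_label hc (u := u) Sᶜ
  have m2 : MeasurableSet {x | c (x + u + w) ∈ S} := by
    simpa only [add_assoc] using measurableSet_label hc (u := u + w) S
  rw [hw, ← measure_union, ← measure_union]
  · refine measure_mono ?_
    rintro x (⟨h1, h2⟩ | ⟨h1, h2, -⟩)
    · by_cases h : c (x + u) ∈ S
      · exact Or.inr ⟨h, by rwa [add_assoc]⟩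
      · exact Or.inl ⟨h1, h⟩
    · exact Or.inl ⟨h1, h2⟩
  · rw [Set.disjoint_left]
    rintro x ⟨-, h1⟩ ⟨h2, -⟩
    exact h1 h2
  · exact (measurable_add_const u) (measurableSet_exitSet hc S w)
  · rw [Set.disjoint_left]
    rintro x ⟨-, h1⟩ ⟨-, -, h2⟩
    rw [add_assoc] at h2
    exact h1 h2
  · exact m0.inter (m1.inter m2)

theorem exitSet_rate (hN : 2 ≤ N) (hc : Measurable c) (hM : bdryMeas c univ ≠ ⊤)
    (S : Set (Fin (m + 1))) (v : Pt N) :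
    ∃ L : ℝ, (∀ t, 0 < t → (volume (exitSet c S (t • v))).toReal / t ≤ L) ∧
      Tendsto (fun t : ℝ => (volume (exitSet c S (t • v))).toReal / t)
        (nhdsWithin 0 (Ioi 0)) (nhds L) := by
  have hfin : ∀ u, volume (exitSet c S u) ≠ ⊤ := fun u =>
    ne_top_of_le_ne_top (ENNReal.mul_ne_top ENNReal.ofReal_ne_top hM) (volume_exitSet_le hN hc S u)
  refine exists_tendsto_div_of_subadditive (K := tubeConst N * ‖v‖ * (bdryMeas c univ).toReal)
    ?_ (fun t _ => ENNReal.toReal_nonneg) ?_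
  · intro s t hs ht
    rw [← ENNReal.toReal_add (hfin _) (hfin _), add_smul]
    refine ENNReal.toReal_mono (ENNReal.add_ne_top.2 ⟨hfin _, hfin _⟩) ?_
    exact le_self_add.trans (volume_exitSet_add hc S (s • v) (t • v))
  · intro t ht
    have := ENNReal.toReal_mono (ENNReal.mul_ne_top ENNReal.ofReal_ne_top hM)
      (volume_exitSet_le hN hc S (t • v))
    rw [ENNReal.toReal_mul, ENNReal.toReal_ofReal (mul_nonneg tubeConst_pos.le (norm_nonneg _)),
      norm_smul, Real.norm_of_nonneg ht] at this
    linarith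

theorem measurableSet_badSet (hc : Measurable c) (u w : Pt N) : MeasurableSet (badSet c u w) := by
  have h1 : Measurable fun x => c (x + u) := hc.comp (measurable_add_const u)
  have h2 : Measurable fun x => c (x + u + w) := by
    simp only [add_assoc]
    exact hc.comp (measurable_add_const (u + w))
  exact (measurableSet_eq_fun h1 hc).compl.inter (measurableSet_eq_fun h1 h2).compl

theorem badSet_zero_right (u : Pt N) : badSet c u 0 = ∅ := by
  ext x; simp [badSet]

theorem volume_badSet_le (u w : Pt N) :
    volume (badSet c u w) ≤ ∑ i : Fin (m + 1),
      volume {x | c x ∈ ({i}ᶜ : Set (Fin (m + 1))) ∧ c (x + u) ∉ ({i}ᶜ : Set (Fin (m + 1))) ∧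
        c (x + u + w) ∈ ({i}ᶜ : Set (Fin (m + 1)))} := by
  refine (measure_mono ?_).trans (measure_iUnion_fintype_le _ _)
  rintro x ⟨h1, h2⟩
  exact mem_iUnion.2 ⟨c (x + u), h1.symm, by simp, h2.symm⟩

/-- Bad patterns along a line have vanishing rate. -/
theorem tendsto_volume_badSet (hN : 2 ≤ N) (hc : Measurable c) (hM : bdryMeas c univ ≠ ⊤)
    (v : Pt N) {q : ℝ} (hq : 0 ≤ q) :
    Tendsto (fun h : ℝ => volume (badSet c (h • v) ((q * h) • v)) / ENNReal.ofReal h)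
      (nhdsWithin 0 (Ioi 0)) (nhds 0) := by
  rcases hq.eq_or_lt with rfl | hq
  · simp only [zero_mul, zero_smul, badSet_zero_right, measure_empty, ENNReal.zero_div]
    exact tendsto_const_nhds
  have hS : ∀ S : Set (Fin (m + 1)), Tendsto (fun h : ℝ =>
      volume {x | c x ∈ S ∧ c (x + h • v) ∉ S ∧ c (x + h • v + (q * h) • v) ∈ S} /
        ENNReal.ofReal h) (nhdsWithin 0 (Ioi 0)) (nhds 0) := by
    intro S
    have hfin : ∀ u, volume (exitSet c S u) ≠ ⊤ := fun u =>
      ne_top_of_le_ne_top (ENNReal.mul_ne_top ENNReal.ofReal_ne_top hM)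
        (volume_exitSet_le hN hc S u)
    obtain ⟨L, -, hL⟩ := exitSet_rate hN hc hM S v
    have hscale : ∀ a : ℝ, 0 < a → Tendsto (fun h : ℝ =>
        (volume (exitSet c S ((a * h) • v))).toReal / h) (nhdsWithin 0 (Ioi 0)) (nhds (L * a)) := by
      intro a ha
      have h1 : Tendsto (fun h : ℝ => a * h) (nhdsWithin 0 (Ioi 0)) (nhdsWithin 0 (Ioi 0)) := by
        refine tendsto_nhdsWithin_iff.2 ⟨?_, ?_⟩
        · have : Tendsto (fun h : ℝ => a * h) (nhds 0) (nhds (a * 0)) :=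
            (continuous_const.mul continuous_id).tendsto 0
          rw [mul_zero] at this
          exact this.mono_left nhdsWithin_le_nhds
        · filter_upwards [self_mem_nhdsWithin] with h hh
          exact mul_pos ha hh
      refine ((hL.comp h1).mul_const a).congr' ?_
      filter_upwards [self_mem_nhdsWithin] with h hh
      have : (0 : ℝ) < h := hh
      simp only [Function.comp]
      field_simp
    have hlim := ((hscale 1 one_pos).add (hscale q hq)).sub (hscale (1 + q) (by linarith))
    rw [show L * 1 + L * q - L * (1 + q) = 0 by ring] at hlim
    have hlim' := ENNReal.tendsto_ofReal hlim
    rw [ENNReal.ofReal_zero] at hlim'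
    refine tendsto_of_tendsto_of_tendsto_of_le_of_le' tendsto_const_nhds hlim'
      (Eventually.of_forall fun _ => zero_le) ?_
    filter_upwards [self_mem_nhdsWithin] with h hh
    have hpos : (0 : ℝ) < h := hh
    have hadd := volume_exitSet_add hc S (h • v) ((q * h) • v)
    rw [show h • v + (q * h) • v = ((1 + q) * h) • v by module] at hadd
    set V := volume {x | c x ∈ S ∧ c (x + h • v) ∉ S ∧ c (x + h • v + (q * h) • v) ∈ S}
    have hVfin : V ≠ ⊤ := ne_top_of_le_ne_top (ENNReal.add_ne_top.2 ⟨hfin _, hfin _⟩)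
      (le_add_self.trans hadd)
    have h3 := ENNReal.toReal_mono (ENNReal.add_ne_top.2 ⟨hfin _, hfin _⟩) hadd
    rw [ENNReal.toReal_add (hfin _) hVfin, ENNReal.toReal_add (hfin _) (hfin _)] at h3
    rw [ENNReal.div_le_iff (by simpa using hpos) ENNReal.ofReal_ne_top,
      ← ENNReal.ofReal_mul' hpos.le, ← ENNReal.ofReal_toReal hVfin]
    refine ENNReal.ofReal_le_ofReal ?_
    rw [one_mul, ← add_div, ← sub_div, div_mul_cancel₀ _ hpos.ne']
    linarith
  have hsum := tendsto_finsetSum Finset.univ fun (i : Fin (m + 1)) _ => hS {i}ᶜ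
  rw [Finset.sum_const_zero] at hsum
  refine tendsto_of_tendsto_of_tendsto_of_le_of_le tendsto_const_nhds hsum
    (fun _ => zero_le) fun h => ?_
  simp only [div_eq_mul_inv]
  rw [← Finset.sum_mul]
  gcongr
  exact volume_badSet_le _ _

theorem volume_badSet_le_norm (hN : 2 ≤ N) (hc : Measurable c) (u w : Pt N) :
    volume (badSet c u w) ≤ ENNReal.ofReal (tubeConst N * ‖u‖) * bdryMeas c univ := by
  refine (measure_mono ?_).trans
    (volume_ne_shift_le hN hc u MeasurableSet.univ (A := univ) (by simp))
  exact fun x hx => ⟨trivial, hx.1⟩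

theorem measurableSet_badSet_prod (hc : Measurable c) {b z w : Pt N → Pt N} (hb : Measurable b)
    (hz : Measurable z) (hw : Measurable w) :
    MeasurableSet {q : Pt N × Pt N | q.1 + b q.2 ∈ badSet c (z q.2) (w q.2)} := by
  have h0 : Measurable fun q : Pt N × Pt N => q.1 + b q.2 :=
    measurable_fst.add (hb.comp measurable_snd)
  have h1 : Measurable fun q : Pt N × Pt N => q.1 + b q.2 + z q.2 :=
    h0.add (hz.comp measurable_snd)
  have h2 : Measurable fun q : Pt N × Pt N => q.1 + b q.2 + z q.2 + w q.2 :=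
    h1.add (hw.comp measurable_snd)
  exact (measurableSet_eq_fun (hc.comp h1) (hc.comp h0)).compl.inter
    (measurableSet_eq_fun (hc.comp h1) (hc.comp h2)).compl

/-- Bad patterns with averaged directions have vanishing rate. -/
theorem tendsto_lintegral_badSet (hN : 2 ≤ N) (hc : Measurable c) (hM : bdryMeas c univ ≠ ⊤)
    {b z : Pt N → Pt N} (hb : Continuous b) (hz : Continuous z) {q : ℝ} (hq : 0 ≤ q)
    {K : Set (Pt N)} (hK : IsCompact K) :
    Tendsto (fun h : ℝ => (∫⁻ y, volume {d | d ∈ K ∧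
        y + h • b d ∈ badSet c (h • z d) ((q * h) • z d)}) / ENNReal.ofReal h)
      (nhdsWithin 0 (Ioi 0)) (nhds 0) := by
  obtain ⟨R, hR⟩ := (hK.image hz).isBounded.exists_norm_le
  have hKm := hK.measurableSet
  have hset : ∀ h : ℝ, MeasurableSet {p : Pt N × Pt N | p.1 + h • b p.2 ∈
      badSet c (h • z p.2) ((q * h) • z p.2)} := fun h =>
    measurableSet_badSet_prod hc (hb.const_smul h).measurable (hz.const_smul h).measurable
      (hz.const_smul (q * h)).measurable
  have hfub : ∀ h : ℝ, ∫⁻ y, volume {d | d ∈ K ∧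
      y + h • b d ∈ badSet c (h • z d) ((q * h) • z d)} =
      ∫⁻ d in K, volume (badSet c (h • z d) ((q * h) • z d)) := by
    intro h
    have hm : MeasurableSet {p : Pt N × Pt N | p.2 ∈ K ∧ p.1 + h • b p.2 ∈
        badSet c (h • z p.2) ((q * h) • z p.2)} := (measurable_snd hKm).inter (hset h)
    have e1 := Measure.prod_apply (μ := (volume : Measure (Pt N)))
      (ν := (volume : Measure (Pt N))) hm
    have e2 := Measure.prod_apply_symm (μ := (volume : Measure (Pt N)))
      (ν := (volume : Measure (Pt N))) hm
    refine e1.symm.trans (e2.trans ?_)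
    rw [← lintegral_indicator hKm]
    refine lintegral_congr fun d => ?_
    by_cases hd : d ∈ K
    · rw [indicator_of_mem hd]
      refine Eq.trans ?_ (measure_preimage_add_right volume (h • b d) _)
      congr 1
      ext y
      simp [hd]
    · rw [indicator_of_notMem hd]
      convert measure_empty (μ := (volume : Measure (Pt N)))
      ext y
      simp [hd]
  simp only [hfub]
  have hmeas : ∀ h : ℝ, Measurable fun d => volume (badSet c (h • z d) ((q * h) • z d)) := by
    intro h
    have := measurableSet_badSet_prod hc (measurable_const (a := (0 : Pt N)))
      (hz.const_smul h).measurable (hz.const_smul (q * h)).measurable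
    simp only [add_zero] at this
    exact measurable_measure_prodMk_right this
  have hconv : ∀ h : ℝ, (∫⁻ d in K, volume (badSet c (h • z d) ((q * h) • z d))) /
      ENNReal.ofReal h = ∫⁻ d in K, volume (badSet c (h • z d) ((q * h) • z d)) /
        ENNReal.ofReal h := by
    intro h
    simp only [div_eq_mul_inv]
    rw [lintegral_mul_const _ (hmeas h)]
  simp only [hconv]
  have := tendsto_lintegral_filter_of_dominated_convergence (μ := volume.restrict K)
    (l := nhdsWithin (0 : ℝ) (Ioi 0))
    (F := fun h d => volume (badSet c (h • z d) ((q * h) • z d)) / ENNReal.ofReal h)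
    (f := fun _ => 0) (fun _ => ENNReal.ofReal (tubeConst N * R) * bdryMeas c univ)
    (Eventually.of_forall fun h => (hmeas h).div_const _) ?_ ?_ ?_
  · simpa using this
  · filter_upwards [self_mem_nhdsWithin] with h hh
    have hpos : (0 : ℝ) < h := hh
    refine (ae_restrict_iff' hKm).2 (Eventually.of_forall fun d hd => ?_)
    rw [ENNReal.div_le_iff (by simpa using hpos) ENNReal.ofReal_ne_top]
    refine (volume_badSet_le_norm hN hc _ _).trans ?_
    have h1 : ‖z d‖ ≤ R := hR _ ⟨d, hd, rfl⟩
    rw [mul_right_comm, ← ENNReal.ofReal_mul' hpos.le]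
    refine mul_le_mul_left (ENNReal.ofReal_le_ofReal ?_) _
    rw [norm_smul, Real.norm_of_nonneg hpos.le, mul_comm h, ← mul_assoc]
    exact mul_le_mul_of_nonneg_right (mul_le_mul_of_nonneg_left h1 tubeConst_pos.le) hpos.le
  · rw [lintegral_const]
    refine ENNReal.mul_ne_top (ENNReal.mul_ne_top ENNReal.ofReal_ne_top hM) ?_
    rw [Measure.restrict_apply_univ]
    exact hK.measure_lt_top.ne
  · exact Eventually.of_forall fun d => tendsto_volume_badSet hN hc hM (z d) hq

/-- Two complementary non-null sets exchange mass under a suitable shift, at a positive rate. -/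
theorem exists_exit_rate (hN : 2 ≤ N) (hc : Measurable c) (hM : bdryMeas c univ ≠ ⊤)
    (S : Set (Fin (m + 1))) (h1 : volume (c ⁻¹' S) ≠ 0) (h2 : volume (c ⁻¹' Sᶜ) ≠ 0) :
    ∃ v : Pt N, v ≠ 0 ∧ ∃ β : ℝ, 0 < β ∧ ∀ᶠ h : ℝ in nhdsWithin 0 (Ioi 0),
      ENNReal.ofReal (β * h) ≤ volume (exitSet c S (h • v)) := by
  have hex : ∃ v, volume (exitSet c S v) ≠ 0 := by
    by_contra hno
    push Not at hno
    have hm : MeasurableSet {q : Pt N × Pt N | c q.1 ∈ S ∧ c (q.1 + q.2) ∈ Sᶜ} := by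
      have hS : MeasurableSet S := MeasurableSet.of_discrete
      have h0 : Measurable fun q : Pt N × Pt N => q.1 + q.2 := measurable_fst.add measurable_snd
      exact ((hc.comp measurable_fst) hS).inter ((hc.comp h0) hS.compl)
    have e1 := Measure.prod_apply (μ := (volume : Measure (Pt N)))
      (ν := (volume : Measure (Pt N))) hm
    have e2 := Measure.prod_apply_symm (μ := (volume : Measure (Pt N)))
      (ν := (volume : Measure (Pt N))) hm
    rw [e2] at e1
    have e3 : ∀ v : Pt N, volume ((fun x : Pt N => (x, v)) ⁻¹'
        {q : Pt N × Pt N | c q.1 ∈ S ∧ c (q.1 + q.2) ∈ Sᶜ}) = 0 := fun v => hno v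
    have hA : MeasurableSet (c ⁻¹' S) := hc (MeasurableSet.of_discrete (s := S))
    have e4 : ∫⁻ x, volume (Prod.mk x ⁻¹' {q : Pt N × Pt N | c q.1 ∈ S ∧ c (q.1 + q.2) ∈ Sᶜ}) =
        volume (c ⁻¹' S) * volume (c ⁻¹' Sᶜ) := by
      rw [mul_comm, ← setLIntegral_const, ← lintegral_indicator hA]
      refine lintegral_congr fun x => ?_
      by_cases hx : x ∈ c ⁻¹' S
      · rw [indicator_of_mem hx, ← measure_preimage_add volume x (c ⁻¹' Sᶜ)]
        congr 1
        ext v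
        have : c x ∈ S := hx
        simp [this]
      · rw [indicator_of_notMem hx]
        convert measure_empty (μ := (volume : Measure (Pt N)))
        ext v
        have : c x ∉ S := hx
        simp [this]
    rw [e4] at e1
    simp only [e3, lintegral_zero] at e1
    rcases mul_eq_zero.1 e1.symm with h | h
    · exact h1 h
    · exact h2 h
  obtain ⟨v, hv⟩ := hex
  have hv0 : v ≠ 0 := by
    rintro rfl
    apply hv
    convert measure_empty (μ := (volume : Measure (Pt N)))
    ext x
    simp [exitSet]
  obtain ⟨L, hL1, hL2⟩ := exitSet_rate hN hc hM S v
  have hfin : ∀ u, volume (exitSet c S u) ≠ ⊤ := fun u =>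
    ne_top_of_le_ne_top (ENNReal.mul_ne_top ENNReal.ofReal_ne_top hM) (volume_exitSet_le hN hc S u)
  have hLpos : 0 < L := by
    have := hL1 1 one_pos
    rw [one_smul, div_one] at this
    exact (ENNReal.toReal_pos hv (hfin v)).trans_le this
  refine ⟨v, hv0, L / 2, by positivity, ?_⟩
  filter_upwards [hL2.eventually (lt_mem_nhds (half_lt_self hLpos)), self_mem_nhdsWithin]
    with h hh hpos
  have hpos' : (0 : ℝ) < h := hpos
  rw [← ENNReal.ofReal_toReal (hfin (h • v))]
  exact ENNReal.ofReal_le_ofReal ((lt_div_iff₀ hpos').1 hh).le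

/-- The closed cube with centre `x` and half side `s`. -/
def cube (x : Pt N) (s : ℝ) : Set (Pt N) := {z | ∀ k, |z k - x k| ≤ s}

theorem isClosed_cube (x : Pt N) (s : ℝ) : IsClosed (cube x s) := by
  have : cube x s = ⋂ k, {z : Pt N | |z k - x k| ≤ s} := by
    ext z
    simp [cube]
  rw [this]
  exact isClosed_iInter fun k => isClosed_le (by fun_prop) continuous_const

theorem measurableSet_cube (x : Pt N) (s : ℝ) : MeasurableSet (cube x s) :=
  (isClosed_cube x s).measurableSet

theorem mem_cube_comm {x z : Pt N} {s : ℝ} : z ∈ cube x s ↔ x ∈ cube z s := by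
  simp only [cube, mem_ofPred_eq, abs_sub_comm]

theorem cube_mono (x : Pt N) {s t : ℝ} (h : s ≤ t) : cube x s ⊆ cube x t :=
  fun _ hz k => (hz k).trans h

theorem mem_cube_trans {x y z : Pt N} {s t : ℝ} (h1 : y ∈ cube x s) (h2 : z ∈ cube y t) :
    z ∈ cube x (s + t) := by
  intro k
  calc |z k - x k| ≤ |z k - y k| + |y k - x k| := abs_sub_le _ _ _
    _ ≤ s + t := by linarith [h1 k, h2 k]

theorem cube_subset_cube {x y : Pt N} {s t : ℝ} (h : y ∈ cube x s) : cube y t ⊆ cube x (s + t) :=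
  fun _ hz => mem_cube_trans h hz

theorem add_mem_cube (x u : Pt N) : x + u ∈ cube x ‖u‖ := by
  intro k
  simpa using PiLp.norm_apply_le u k

theorem convex_cube (x : Pt N) (s : ℝ) : Convex ℝ (cube x s) := by
  have : cube x s = ⋂ k, {z : Pt N | z k ∈ Icc (x k - s) (x k + s)} := by
    ext z
    simp only [cube, mem_ofPred_eq, mem_iInter, mem_Icc, abs_le]
    refine forall_congr' fun k => ?_
    constructor <;> rintro ⟨h1, h2⟩ <;> constructor <;> linarith
  rw [this]
  refine convex_iInter fun k => ?_
  exact (convex_Icc (x k - s) (x k + s)).linear_preimage (EuclideanSpace.proj k).toLinearMap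

theorem norm_sub_le_of_mem_cube {x z : Pt N} {s : ℝ} (hs : 0 ≤ s) (h : z ∈ cube x s) :
    ‖z - x‖ ≤ N * s := by
  rw [EuclideanSpace.norm_eq]
  refine Real.sqrt_le_iff.2 ⟨by positivity, ?_⟩
  calc ∑ i, ‖(z - x) i‖ ^ 2 ≤ ∑ _i : Fin N, s ^ 2 := by
        refine Finset.sum_le_sum fun i _ => ?_
        have := h i
        rw [Real.norm_eq_abs]
        exact pow_le_pow_left₀ (abs_nonneg _) this 2
    _ = N * s ^ 2 := by simp
    _ ≤ (N * s) ^ 2 := by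
        rw [mul_pow]
        refine mul_le_mul_of_nonneg_right ?_ (sq_nonneg s)
        have : N ≤ N ^ 2 := Nat.le_self_pow two_ne_zero N
        exact_mod_cast this

theorem isCompact_cube (x : Pt N) {s : ℝ} (hs : 0 ≤ s) : IsCompact (cube x s) := by
  refine isCompact_of_isClosed_isBounded (isClosed_cube x s) ?_
  refine (isBounded_closedBall (x := x) (r := N * s)).subset fun z hz => ?_
  rw [mem_closedBall, dist_eq_norm]
  exact norm_sub_le_of_mem_cube hs hz

theorem volume_cube (x : Pt N) {s : ℝ} (hs : 0 ≤ s) :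
    volume (cube x s) = ENNReal.ofReal ((2 * s) ^ N) := by
  have h := (EuclideanSpace.volume_preserving_symm_measurableEquiv_toLp (Fin N)).symm
  have h2 : cube x s = (MeasurableEquiv.toLp 2 (Fin N → ℝ)).symm ⁻¹'
      Icc (fun k => x k - s) (fun k => x k + s) := by
    ext z
    simp only [cube, mem_ofPred_eq, mem_preimage, Set.mem_Icc, Pi.le_def, ← forall_and, abs_le]
    refine forall_congr' fun k => ?_
    simp only [MeasurableEquiv.coe_toLp_symm]
    constructor <;> rintro ⟨h1, h2⟩ <;> constructor <;> linarith
  rw [h2, (EuclideanSpace.volume_preserving_symm_measurableEquiv_toLp (Fin N)).measure_preimage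
    measurableSet_Icc.nullMeasurableSet, Real.volume_Icc_pi]
  simp only [show ∀ k, x k + s - (x k - s) = 2 * s by intro k; ring]
  rw [Finset.prod_const, Finset.card_univ, Fintype.card_fin, ENNReal.ofReal_pow (by positivity)]

theorem measurableSet_cube_prod (s : ℝ) :
    MeasurableSet {q : Pt N × Pt N | q.2 ∈ cube q.1 s} := by
  have : {q : Pt N × Pt N | q.2 ∈ cube q.1 s} = {q | q.2 - q.1 ∈ cube 0 s} := by
    ext q
    simp [cube]
  rw [this]
  exact (measurable_snd.sub measurable_fst) (measurableSet_cube 0 s)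

theorem measurable_measure_cube (ν : Measure (Pt N)) [SFinite ν] (s : ℝ) :
    Measurable fun x => ν (cube x s) :=
  measurable_measure_prodMk_left (measurableSet_cube_prod s)

theorem lintegral_measure_cube (ν : Measure (Pt N)) [SFinite ν] {s : ℝ} (hs : 0 ≤ s) :
    ∫⁻ x, ν (cube x s) = ENNReal.ofReal ((2 * s) ^ N) * ν univ := by
  have hm := measurableSet_cube_prod (N := N) s
  have e1 := Measure.prod_apply (μ := (volume : Measure (Pt N))) (ν := ν) hm
  have e2 := Measure.prod_apply_symm (μ := (volume : Measure (Pt N))) (ν := ν) hm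
  refine e1.symm.trans (e2.trans ?_)
  rw [← lintegral_const]
  refine lintegral_congr fun z => ?_
  rw [← volume_cube z hs]
  congr 1
  ext x
  exact mem_cube_comm

/-- A cube on which one measure dominates two others, found by averaging. -/
theorem exists_cube_measure_lt (a b o : Measure (Pt N)) [SFinite a] [SFinite b] [SFinite o]
    {s t r : ℝ} (hs : 0 ≤ s) (ht : 0 ≤ t) (hr : 0 ≤ r) {θ lam : ENNReal}
    (h : θ * (ENNReal.ofReal ((2 * t) ^ N) * b univ) +
      lam * (ENNReal.ofReal ((2 * r) ^ N) * o univ) < ENNReal.ofReal ((2 * s) ^ N) * a univ) :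
    ∃ x, θ * b (cube x t) + lam * o (cube x r) < a (cube x s) := by
  by_contra! hno
  refine h.not_ge ?_
  rw [← lintegral_measure_cube a hs, ← lintegral_measure_cube b ht, ← lintegral_measure_cube o hr,
    ← lintegral_const_mul _ (measurable_measure_cube b t),
    ← lintegral_const_mul _ (measurable_measure_cube o r),
    ← lintegral_add_left ((measurable_measure_cube b t).const_mul θ)]
  exact lintegral_mono hno

theorem lintegral_volume_shift {A B : Set (Pt N)} (hA : MeasurableSet A) (hB : MeasurableSet B) :
    ∫⁻ d, volume {z | z ∈ A ∧ z + d ∈ B} = volume A * volume B := by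
  have hm : MeasurableSet {q : Pt N × Pt N | q.1 ∈ A ∧ q.1 + q.2 ∈ B} :=
    (measurable_fst hA).inter ((measurable_fst.add measurable_snd) hB)
  have e1 := Measure.prod_apply (μ := (volume : Measure (Pt N)))
    (ν := (volume : Measure (Pt N))) hm
  have e2 := Measure.prod_apply_symm (μ := (volume : Measure (Pt N)))
    (ν := (volume : Measure (Pt N))) hm
  refine e2.symm.trans (e1.trans ?_)
  rw [mul_comm, ← setLIntegral_const, ← lintegral_indicator hA]
  refine lintegral_congr fun x => ?_
  by_cases hx : x ∈ A
  · rw [indicator_of_mem hx, ← measure_preimage_add volume x B]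
    congr 1
    ext v
    simp [hx]
  · rw [indicator_of_notMem hx]
    convert measure_empty (μ := (volume : Measure (Pt N)))
    ext v
    simp [hx]

/-- A Poincaré type inequality on cubes. -/
theorem volume_mul_volume_le (hN : 2 ≤ N) (hc : Measurable c) (S : Set (Fin (m + 1)))
    (y : Pt N) {s : ℝ} (hs : 0 ≤ s) :
    volume {z | z ∈ cube y s ∧ c z ∈ S} * volume {z | z ∈ cube y s ∧ c z ∉ S} ≤
      ENNReal.ofReal ((2 * (2 * s)) ^ N) *
        (ENNReal.ofReal (tubeConst N * (N * (2 * s))) * bdryMeas c (cube y s)) := by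
  have hA : MeasurableSet {z | z ∈ cube y s ∧ c z ∈ S} :=
    (measurableSet_cube y s).inter (hc (MeasurableSet.of_discrete (s := S)))
  have hB : MeasurableSet {z | z ∈ cube y s ∧ c z ∉ S} :=
    (measurableSet_cube y s).inter (hc (MeasurableSet.of_discrete (s := Sᶜ)))
  rw [← lintegral_volume_shift hA hB, ← volume_cube (0 : Pt N) (by positivity), mul_comm,
    ← setLIntegral_const, ← lintegral_indicator (measurableSet_cube _ _)]
  refine lintegral_mono fun d => ?_
  by_cases hd : d ∈ cube 0 (2 * s)
  · rw [indicator_of_mem hd]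
    have h1 := volume_ne_shift_le hN hc d (measurableSet_cube y s)
      (A := {z | z ∈ cube y s ∧ z + d ∈ cube y s}) (by
        rintro x ⟨hx1, hx2⟩ t ht
        have h2 := (convex_cube y s).add_smul_sub_mem hx1 hx2 ht
        simpa using h2)
    refine (measure_mono ?_).trans (h1.trans ?_)
    · rintro z ⟨⟨h1, h2⟩, h3, h4⟩
      exact ⟨⟨h1, h3⟩, fun h => h4 (h ▸ h2)⟩
    · refine mul_le_mul_left (ENNReal.ofReal_le_ofReal ?_) _
      refine mul_le_mul_of_nonneg_left ?_ tubeConst_pos.le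
      simpa using norm_sub_le_of_mem_cube (by positivity) hd
  · rw [indicator_of_notMem hd]
    refine le_of_eq ?_
    convert measure_empty (μ := (volume : Measure (Pt N)))
    ext z
    simp only [mem_ofPred_eq, mem_empty_iff_false, iff_false]
    rintro ⟨⟨h1, -⟩, h2, -⟩
    refine hd ?_
    intro k
    have := mem_cube_trans (mem_cube_comm.1 h1) h2 k
    rw [← two_mul] at this
    simpa using this

/-- A configuration of three collinear points, affine in a fixed vector `v` and a variable `d`. -/
structure Pattern where
  (b₁ b₂ z₁ z₂ q : ℝ)

/-- The label pattern along the three points is not a single jump adjacent to a constancy. -/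
def Pattern.Bad (P : Pattern) (c : Pt N → Fin (m + 1)) (v y d : Pt N) : Prop :=
  y + (P.b₁ • v + P.b₂ • d) ∈
    badSet c (P.z₁ • v + P.z₂ • d) (P.q • (P.z₁ • v + P.z₂ • d))

/-- The patterns used to see half-density and uniqueness of the two labels. -/
def patterns : List Pattern :=
  [⟨0, 1, 1, -1, 1⟩, ⟨0, 1, 0, -1, 1⟩,
   ⟨0, 0, 1 / 2, 1 / 2, 1⟩, ⟨1, 0, -1 / 2, 1 / 2, 1⟩,
   ⟨0, 0, 1, 0, 1⟩, ⟨0, 1, 1, 0, 1⟩, ⟨2, 1, -1, -1, 1⟩, ⟨2, 0, -1, 1, 1⟩, ⟨0, -1, 0, 1, 2⟩,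
   ⟨1, 0, -1, 0, 1⟩, ⟨1, 1, -1, 0, 1⟩, ⟨-1, 1, 1, -1, 1⟩, ⟨-1, 0, 1, 1, 1⟩, ⟨1, -1, 0, 1, 2⟩]

/-- The directions for which some pattern based at `y` is bad. -/
def badDirs (c : Pt N → Fin (m + 1)) (v y : Pt N) (s : ℝ) : Set (Pt N) :=
  {d | d ∈ cube 0 s ∧ ∃ P ∈ patterns, P.Bad c v y d}

theorem half_of_not_bad {v y d : Pt N} {S : Set (Fin (m + 1))}
    (hd : ∀ P ∈ patterns, ¬ P.Bad c v y d) (h1 : c y ∈ S) (h2 : c (y + v) ∉ S) :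
    (c (y + d) ∈ S ∨ c (y - d) ∈ S) ∧ (c (y + d) ∉ S ∨ c (y - d + (2 : ℝ) • v) ∉ S) := by
  have hA := hd ⟨0, 1, 1, -1, 1⟩ (by simp [patterns])
  have hB := hd ⟨0, 1, 0, -1, 1⟩ (by simp [patterns])
  simp only [Pattern.Bad, badSet, mem_ofPred_eq, ← add_assoc] at hA hB
  rw [show y + (0 : ℝ) • v + (1 : ℝ) • d = y + d by module] at hA hB
  rw [show y + d + (1 : ℝ) • v + (-1 : ℝ) • d = y + v by module,
    show y + v + (1 : ℝ) • ((1 : ℝ) • v + (-1 : ℝ) • d) = y - d + (2 : ℝ) • v by module] at hA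
  rw [show y + d + (0 : ℝ) • v + (-1 : ℝ) • d = y by module,
    show y + (1 : ℝ) • ((0 : ℝ) • v + (-1 : ℝ) • d) = y - d by module] at hB
  constructor
  · by_contra! h
    exact hB ⟨fun e => h.1 (e ▸ h1), fun e => h.2 (e ▸ h1)⟩
  · by_contra! h
    exact hA ⟨fun e => h2 (e ▸ h.1), fun e => h2 (e ▸ h.2)⟩

theorem label_eq_of_not_bad {v y d : Pt N}
    (hd : ∀ P ∈ patterns, ¬ P.Bad c v y d) (h1 : c y ≠ c (y + v))
    (h2 : c (y + d) ≠ c (y + d + v)) : c y = c (y + d) ∧ c (y + v) = c (y + d + v) := by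
  have e1 := hd ⟨0, 0, 1 / 2, 1 / 2, 1⟩ (by simp [patterns])
  have e2 := hd ⟨1, 0, -1 / 2, 1 / 2, 1⟩ (by simp [patterns])
  have e3 := hd ⟨0, 0, 1, 0, 1⟩ (by simp [patterns])
  have e4 := hd ⟨0, 1, 1, 0, 1⟩ (by simp [patterns])
  have e5 := hd ⟨2, 1, -1, -1, 1⟩ (by simp [patterns])
  have e6 := hd ⟨2, 0, -1, 1, 1⟩ (by simp [patterns])
  have e7 := hd ⟨0, -1, 0, 1, 2⟩ (by simp [patterns])
  have f3 := hd ⟨1, 0, -1, 0, 1⟩ (by simp [patterns])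
  have f4 := hd ⟨1, 1, -1, 0, 1⟩ (by simp [patterns])
  have f5 := hd ⟨-1, 1, 1, -1, 1⟩ (by simp [patterns])
  have f6 := hd ⟨-1, 0, 1, 1, 1⟩ (by simp [patterns])
  have f7 := hd ⟨1, -1, 0, 1, 2⟩ (by simp [patterns])
  have key : ∀ (P : Pattern) (p₀ p₁ p₂ : Pt N), ¬ P.Bad c v y d →
      p₀ = y + (P.b₁ • v + P.b₂ • d) → p₁ = p₀ + (P.z₁ • v + P.z₂ • d) →
      p₂ = p₁ + P.q • (P.z₁ • v + P.z₂ • d) → c p₁ = c p₀ ∨ c p₁ = c p₂ := by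
    rintro P p₀ p₁ p₂ h rfl rfl rfl
    by_contra! hh
    exact h hh
  have e1 := key _ y (y + (1 / 2 : ℝ) • (v + d)) (y + d + v) e1 (by dsimp only; module)
    (by dsimp only; module) (by dsimp only; module)
  have e2 := key _ (y + v) (y + (1 / 2 : ℝ) • (v + d)) (y + d) e2 (by dsimp only; module)
    (by dsimp only; module) (by dsimp only; module)
  have e3 := key _ y (y + v) (y + (2 : ℝ) • v) e3 (by dsimp only; module)
    (by dsimp only; module) (by dsimp only; module)
  have e4 := key _ (y + d) (y + d + v) (y + d + (2 : ℝ) • v) e4 (by dsimp only; module)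
    (by dsimp only; module) (by dsimp only; module)
  have e5 := key _ (y + d + (2 : ℝ) • v) (y + v) (y - d) e5 (by dsimp only; module)
    (by dsimp only; module) (by dsimp only; module)
  have e6 := key _ (y + (2 : ℝ) • v) (y + d + v) (y + (2 : ℝ) • d) e6 (by dsimp only; module)
    (by dsimp only; module) (by dsimp only; module)
  have e7 := key _ (y - d) y (y + (2 : ℝ) • d) e7 (by dsimp only; module)
    (by dsimp only; module) (by dsimp only; module)
  have f3 := key _ (y + v) y (y - v) f3 (by dsimp only; module)
    (by dsimp only; module) (by dsimp only; module)
  have f4 := key _ (y + d + v) (y + d) (y + d - v) f4 (by dsimp only; module)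
    (by dsimp only; module) (by dsimp only; module)
  have f5 := key _ (y + d - v) y (y + v - d) f5 (by dsimp only; module)
    (by dsimp only; module) (by dsimp only; module)
  have f6 := key _ (y - v) (y + d) (y + v + (2 : ℝ) • d) f6 (by dsimp only; module)
    (by dsimp only; module) (by dsimp only; module)
  have f7 := key _ (y + v - d) (y + v) (y + v + (2 : ℝ) • d) f7 (by dsimp only; module)
    (by dsimp only; module) (by dsimp only; module)
  clear key hd
  generalize c y = a0 at *
  generalize c (y + v) = a1 at *
  generalize c (y + d) = a2 at *
  generalize c (y + d + v) = a3 at *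
  grind

theorem measurableSet_badDirs_prod (hc : Measurable c) (v : Pt N) (s : ℝ) :
    MeasurableSet {q : Pt N × Pt N | q.2 ∈ badDirs c v q.1 s} := by
  have h1 : ∀ P ∈ patterns, MeasurableSet {q : Pt N × Pt N | P.Bad c v q.1 q.2} := fun P _ =>
    measurableSet_badSet_prod hc (b := fun d => P.b₁ • v + P.b₂ • d)
      (z := fun d => P.z₁ • v + P.z₂ • d) (w := fun d => P.q • (P.z₁ • v + P.z₂ • d))
      (by fun_prop) (by fun_prop) (by fun_prop)
  have h2 : {q : Pt N × Pt N | q.2 ∈ badDirs c v q.1 s} = {q | q.2 ∈ cube 0 s} ∩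
      ⋃ P ∈ {P | P ∈ patterns}, {q : Pt N × Pt N | P.Bad c v q.1 q.2} := by
    ext q
    simp [badDirs]
  rw [h2]
  exact (measurable_snd (measurableSet_cube 0 s)).inter
    (Set.Finite.measurableSet_biUnion (List.finite_toSet patterns) h1)

theorem measurable_volume_badDirs (hc : Measurable c) (v : Pt N) (s : ℝ) :
    Measurable fun y => volume (badDirs c v y s) :=
  measurable_measure_prodMk_left (measurableSet_badDirs_prod hc v s)

theorem volume_smul_preimage {h : ℝ} (hh : 0 < h) (A : Set (Pt N)) :
    volume A = ENNReal.ofReal (h ^ N) * volume ((fun d => h • d) ⁻¹' A) := by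
  rw [Measure.addHaar_preimage_smul _ hh.ne', finrank_euclideanSpace_fin,
    abs_of_pos (by positivity), ← mul_assoc, ← ENNReal.ofReal_mul (by positivity),
    mul_inv_cancel₀ (by positivity), ENNReal.ofReal_one, one_mul]

theorem eventually_lintegral_badDirs (hN : 2 ≤ N) (hc : Measurable c)
    (hM : bdryMeas c univ ≠ ⊤) (v : Pt N) {L η : ℝ} (hL : 0 ≤ L) (hη : 0 < η) :
    ∀ᶠ h : ℝ in nhdsWithin 0 (Ioi 0),
      ∫⁻ y, volume (badDirs c (h • v) y (L * h)) ≤ ENNReal.ofReal (η * h * h ^ N) := by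
  have h1 : ∀ P ∈ patterns, Tendsto (fun h : ℝ => (∫⁻ y, volume {d | d ∈ cube 0 L ∧
      P.Bad c (h • v) y (h • d)}) / ENNReal.ofReal h) (nhdsWithin 0 (Ioi 0)) (nhds 0) := by
    intro P hP
    have hq : 0 ≤ P.q := by
      simp only [patterns, List.mem_cons, List.not_mem_nil, or_false] at hP
      rcases hP with rfl | rfl | rfl | rfl | rfl | rfl | rfl | rfl | rfl | rfl | rfl | rfl | rfl |
        rfl <;> norm_num
    have := tendsto_lintegral_badSet hN hc hM (b := fun d => P.b₁ • v + P.b₂ • d)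
      (z := fun d => P.z₁ • v + P.z₂ • d) (by fun_prop) (by fun_prop) hq
      (isCompact_cube (0 : Pt N) hL)
    convert this using 10 with h y d
    simp only [Pattern.Bad, smul_add, smul_smul]
    simp only [mul_comm, mul_left_comm]
  have hsum : Tendsto (fun h : ℝ => (patterns.map fun P => (∫⁻ y, volume {d | d ∈ cube 0 L ∧
      P.Bad c (h • v) y (h • d)}) / ENNReal.ofReal h).sum) (nhdsWithin 0 (Ioi 0)) (nhds 0) := by
    have := tendsto_list_sum patterns h1
    simpa using this
  filter_upwards [hsum.eventually (gt_mem_nhds (ENNReal.ofReal_pos.2 hη)), self_mem_nhdsWithin]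
    with h hh hpos
  have hpos' : (0 : ℝ) < h := hpos
  have hset : ∀ y, volume (badDirs c (h • v) y (L * h)) =
      ENNReal.ofReal (h ^ N) * volume {d | d ∈ cube 0 L ∧
        ∃ P ∈ patterns, P.Bad c (h • v) y (h • d)} := by
    intro y
    rw [volume_smul_preimage hpos' (badDirs c (h • v) y (L * h))]
    congr 2
    ext d
    simp only [badDirs, mem_preimage, mem_ofPred_eq, cube, PiLp.smul_apply, smul_eq_mul,
      PiLp.zero_apply, sub_zero, abs_mul, abs_of_pos hpos', mul_comm L]
    simp only [mul_le_mul_iff_right₀ hpos']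
  have hmeas : ∀ P : Pattern, Measurable fun y => volume {d | d ∈ cube 0 L ∧
      P.Bad c (h • v) y (h • d)} := by
    intro P
    have e1 := measurableSet_badSet_prod hc (b := fun d => P.b₁ • (h • v) + P.b₂ • (h • d))
      (z := fun d => P.z₁ • (h • v) + P.z₂ • (h • d))
      (w := fun d => P.q • (P.z₁ • (h • v) + P.z₂ • (h • d)))
      (by fun_prop) (by fun_prop) (by fun_prop)
    exact measurable_measure_prodMk_left ((measurable_snd (measurableSet_cube 0 L)).inter e1)
  have hlist : ∀ (l : List Pattern) , ∫⁻ y, volume {d | d ∈ cube 0 L ∧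
        ∃ P ∈ l, P.Bad c (h • v) y (h • d)} ≤ (l.map fun P => ∫⁻ y, volume {d | d ∈ cube 0 L ∧
      P.Bad c (h • v) y (h • d)}).sum := by
    intro l
    induction l with
    | nil => simp
    | cons P l ih =>
      rw [List.map_cons, List.sum_cons]
      refine le_trans ?_ (add_le_add_right ih _)
      rw [← lintegral_add_left (hmeas P)]
      refine lintegral_mono fun y => (measure_mono ?_).trans (measure_union_le _ _)
      rintro d ⟨h1, Q, hQ, h2⟩
      rcases List.mem_cons.1 hQ with rfl | hQ
      · exact Or.inl ⟨h1, h2⟩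
      · exact Or.inr ⟨h1, Q, hQ, h2⟩
  simp only [hset]
  rw [lintegral_const_mul' _ _ ENNReal.ofReal_ne_top, mul_comm, ENNReal.ofReal_mul (by positivity)]
  refine mul_le_mul_left ((hlist _).trans ?_) _
  have h3 := hh.le
  simp only [div_eq_mul_inv] at h3
  rw [List.sum_map_mul_right, ← div_eq_mul_inv,
    ENNReal.div_le_iff (by simpa using hpos') ENNReal.ofReal_ne_top,
    ← ENNReal.ofReal_mul hη.le] at h3
  exact h3

theorem volume_cube_add (y : Pt N) (s : ℝ) (p : Pt N → Prop) :
    volume {d | d ∈ cube 0 s ∧ p (y + d)} = volume {z | z ∈ cube y s ∧ p z} := by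
  rw [← measure_preimage_add volume y {z | z ∈ cube y s ∧ p z}]
  congr 1
  ext d
  simp [cube]

theorem volume_cube_sub (y : Pt N) (s : ℝ) (p : Pt N → Prop) :
    volume {d | d ∈ cube 0 s ∧ p (y - d)} = volume {z | z ∈ cube y s ∧ p z} := by
  rw [← volume_cube_add y s p, ← Measure.measure_preimage_neg volume {d | d ∈ cube 0 s ∧ p (y + d)}]
  congr 1
  ext d
  simp [cube, sub_eq_add_neg]

theorem exists_le_bdryMeas_of_half (hN : 2 ≤ N) :
    ∃ κ : ℝ, 0 < κ ∧ ∀ {m : ℕ} {c : Pt N → Fin (m + 1)}, Measurable c →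
      ∀ {v y : Pt N} {s : ℝ} {S : Set (Fin (m + 1))}, 0 < s → 2 * ‖v‖ ≤ s →
      c y ∈ S → c (y + v) ∉ S → volume (badDirs c v y s) ≤ ENNReal.ofReal ((2 * s) ^ N / 4) →
      ENNReal.ofReal (κ * s ^ (N - 1)) ≤ bdryMeas c (cube y (2 * s)) := by
  have hT : 0 < tubeConst N := tubeConst_pos
  have hN0 : (0 : ℝ) < N := by exact_mod_cast (by omega : 0 < N)
  refine ⟨1 / (64 * N * tubeConst N), by positivity, ?_⟩
  intro m c hc v y s S hs hv hy hyv hb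
  set b := bdryMeas c (cube y (2 * s)) with hbdef
  by_cases hbt : b = ⊤
  · rw [hbt]; exact le_top
  set U := badDirs c v y s
  set G := {z | z ∈ cube y s ∧ c z ∈ S}
  set G' := {z | z ∈ cube y s ∧ c z ∉ S}
  set X := {z | z ∈ cube y s ∧ c z ∈ S ∧ c (z + (2 : ℝ) • v) ∉ S}
  have hGm : MeasurableSet {z | c z ∈ S} := hc (MeasurableSet.of_discrete (s := S))
  have hsum : volume G + volume G' = ENNReal.ofReal ((2 * s) ^ N) := by
    rw [← volume_cube y hs.le, ← measure_inter_add_sdiff (cube y s) hGm]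
    rfl
  have hGG' : volume G' ≤ volume G + volume U := by
    rw [← volume_cube_add y s (fun z => c z ∉ S), ← volume_cube_sub y s (fun z => c z ∈ S)]
    refine (measure_mono ?_).trans (measure_union_le _ _)
    rintro d ⟨hd1, hd2⟩
    by_cases hU : ∃ P ∈ patterns, P.Bad c v y d
    · exact Or.inr ⟨hd1, hU⟩
    · push Not at hU
      exact Or.inl ⟨hd1, (half_of_not_bad hU hy hyv).1.resolve_left hd2⟩
  have hG'G : volume G ≤ volume G' + volume X + volume U := by
    rw [← volume_cube_add y s (fun z => c z ∈ S), ← volume_cube_sub y s (fun z => c z ∉ S),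
      ← volume_cube_sub y s (fun z => c z ∈ S ∧ c (z + (2 : ℝ) • v) ∉ S)]
    refine (measure_mono ?_).trans ((measure_union_le _ _).trans
      (add_le_add_left (measure_union_le _ _) _))
    rintro d ⟨hd1, hd2⟩
    by_cases hU : ∃ P ∈ patterns, P.Bad c v y d
    · exact Or.inr ⟨hd1, hU⟩
    · push Not at hU
      have h2 := (half_of_not_bad hU hy hyv).2.resolve_left (fun h => h hd2)
      by_cases h3 : c (y - d) ∈ S
      · exact Or.inl (Or.inr ⟨hd1, h3, h2⟩)
      · exact Or.inl (Or.inl ⟨hd1, h3⟩)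
  have hX : volume X ≤ ENNReal.ofReal (tubeConst N * s) * b := by
    have h1 := volume_ne_shift_le hN hc ((2 : ℝ) • v) (measurableSet_cube y (2 * s))
      (A := cube y s) (by
        intro x hx t ht
        refine cube_mono y ?_ (mem_cube_trans hx (add_mem_cube x (t • (2 : ℝ) • v)))
        rw [norm_smul, norm_smul, Real.norm_two, Real.norm_of_nonneg ht.1]
        have : t * (2 * ‖v‖) ≤ 1 * s :=
          mul_le_mul ht.2 hv (by positivity) zero_le_one
        linarith)
    refine (measure_mono ?_).trans (h1.trans ?_)
    · rintro z ⟨h1, h2, h3⟩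
      exact ⟨h1, fun h => h3 (h ▸ h2)⟩
    · refine mul_le_mul_left (ENNReal.ofReal_le_ofReal ?_) _
      refine mul_le_mul_of_nonneg_left ?_ hT.le
      rwa [norm_smul, Real.norm_two]
  have hP : volume G * volume G' ≤ ENNReal.ofReal ((2 * (2 * s)) ^ N) *
      (ENNReal.ofReal (tubeConst N * (N * (2 * s))) * b) :=
    (volume_mul_volume_le hN hc S y hs.le).trans
    (mul_le_mul_right (mul_le_mul_right (measure_mono (cube_mono y (by linarith : s ≤ 2 * s)))
      _) _)
  have hκ : ENNReal.ofReal ((2 * s) ^ N) ≠ ⊤ := ENNReal.ofReal_ne_top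
  have hGt : volume G ≠ ⊤ := ne_top_of_le_ne_top hκ (le_self_add.trans hsum.le)
  have hGt' : volume G' ≠ ⊤ := ne_top_of_le_ne_top hκ (le_add_self.trans hsum.le)
  have hXt : volume X ≠ ⊤ :=
    ne_top_of_le_ne_top (ENNReal.mul_ne_top ENNReal.ofReal_ne_top hbt) hX
  have hUt : volume U ≠ ⊤ := ne_top_of_le_ne_top ENNReal.ofReal_ne_top hb
  rw [← ENNReal.ofReal_toReal hbt] at hX hP ⊢
  rw [← ENNReal.ofReal_toReal hGt, ← ENNReal.ofReal_toReal hGt'] at hsum hGG' hG'G hP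
  rw [← ENNReal.ofReal_toReal hXt] at hG'G hX
  rw [← ENNReal.ofReal_toReal hUt] at hGG' hG'G hb
  have g0 : 0 ≤ (volume G).toReal := ENNReal.toReal_nonneg
  have g0' : 0 ≤ (volume G').toReal := ENNReal.toReal_nonneg
  have x0 : 0 ≤ (volume X).toReal := ENNReal.toReal_nonneg
  have u0 : 0 ≤ (volume U).toReal := ENNReal.toReal_nonneg
  have b0 : 0 ≤ b.toReal := ENNReal.toReal_nonneg
  generalize (volume G).toReal = g at *
  generalize (volume G').toReal = g' at *
  generalize (volume X).toReal = x at *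
  generalize (volume U).toReal = u at *
  generalize b.toReal = r at *
  rw [← ENNReal.ofReal_add g0 g0', ENNReal.ofReal_eq_ofReal_iff (by positivity) (by positivity)]
    at hsum
  rw [← ENNReal.ofReal_add g0 u0, ENNReal.ofReal_le_ofReal_iff (by positivity)] at hGG'
  rw [← ENNReal.ofReal_add g0' x0, ← ENNReal.ofReal_add (by positivity) u0,
    ENNReal.ofReal_le_ofReal_iff (by positivity)] at hG'G
  rw [ENNReal.ofReal_le_ofReal_iff (by positivity)] at hb
  rw [← ENNReal.ofReal_mul (by positivity), ENNReal.ofReal_le_ofReal_iff (by positivity)] at hX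
  rw [← ENNReal.ofReal_mul (by positivity), ← ENNReal.ofReal_mul (by positivity),
    ← ENNReal.ofReal_mul (by positivity), ENNReal.ofReal_le_ofReal_iff (by positivity)] at hP
  refine ENNReal.ofReal_le_ofReal ?_
  obtain ⟨n, rfl⟩ : ∃ n, N = n + 1 := ⟨N - 1, by omega⟩
  rw [Nat.add_sub_cancel]
  set K := (2 * s) ^ (n + 1) with hK
  have hK0 : 0 < K := by positivity
  have hKs : K = 2 ^ (n + 1) * (s * s ^ n) := by rw [hK, mul_pow, pow_succ' s]
  have h2n : (1 : ℝ) ≤ 2 ^ (n + 1) := one_le_pow₀ (by norm_num)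
  rw [div_mul_eq_mul_div, one_mul, div_le_iff₀ (by positivity)]
  set T := tubeConst (n + 1)
  have hsn : 0 < s ^ n := by positivity
  have hN1 : (1 : ℝ) ≤ ((n + 1 : ℕ) : ℝ) := by exact_mod_cast Nat.succ_pos n
  set ν : ℝ := ((n + 1 : ℕ) : ℝ)
  rcases le_total x (K / 4) with hx | hx
  · have hg1 : 3 / 8 * K ≤ g := by linarith
    have hg2 : K / 4 ≤ g' := by linarith
    have h3 : 3 / 8 * K * (K / 4) ≤ g * g' := mul_le_mul hg1 hg2 (by positivity) g0
    have h4 : (2 * (2 * s)) ^ (n + 1) = 2 ^ (n + 1) * K := by rw [hK, ← mul_pow]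
    rw [h4] at hP
    have h5 : 3 / 32 * K ≤ 2 ^ (n + 1) * (T * (ν * (2 * s)) * r) := by
      refine le_of_mul_le_mul_left ?_ hK0
      calc K * (3 / 32 * K) = 3 / 8 * K * (K / 4) := by ring
        _ ≤ g * g' := h3
        _ ≤ _ := hP
        _ = _ := by ring
    have h6 : 3 / 32 * s ^ n ≤ T * ν * 2 * r := by
      refine le_of_mul_le_mul_left (a := 2 ^ (n + 1) * s) ?_ (by positivity)
      rw [hKs] at h5
      linarith
    linarith
  · have h5 : s ^ n ≤ 4 * T * r := by
      refine le_of_mul_le_mul_left (a := s) ?_ hs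
      have : s * s ^ n ≤ K := by
        rw [hKs]
        exact le_mul_of_one_le_left (by positivity) h2n
      linarith
    have : 4 * T * r ≤ r * (64 * ν * T) := by
      have : 0 ≤ T * r := by positivity
      nlinarith
    linarith

theorem eventually_volume_biUnion_badSet (hN : 2 ≤ N) (hc : Measurable c)
    (hM : bdryMeas c univ ≠ ⊤) (n : ℕ) (w : ℕ → Pt N) (q : ℕ → ℝ) (hq : ∀ k < n, 0 ≤ q k)
    {η : ℝ} (hη : 0 < η) :
    ∀ᶠ h : ℝ in nhdsWithin 0 (Ioi 0),
      volume (⋃ k ∈ Finset.range n, badSet c (h • w k) ((q k * h) • w k)) ≤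
        ENNReal.ofReal (η * h) := by
  have hsum := tendsto_finsetSum (Finset.range n) fun k hk =>
    tendsto_volume_badSet hN hc hM (w k) (hq k (Finset.mem_range.1 hk))
  rw [Finset.sum_const_zero] at hsum
  filter_upwards [hsum.eventually (gt_mem_nhds (ENNReal.ofReal_pos.2 hη)), self_mem_nhdsWithin]
    with h hh hpos
  have hpos' : (0 : ℝ) < h := hpos
  have h3 := hh.le
  simp only [div_eq_mul_inv] at h3
  rw [← Finset.sum_mul, ← div_eq_mul_inv,
    ENNReal.div_le_iff (by simpa using hpos') ENNReal.ofReal_ne_top,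
    ← ENNReal.ofReal_mul hη.le] at h3
  exact (measure_biUnion_finset_le _ _).trans h3

/-- Disjoint translates bound the volume of the exit set in a cube. -/
theorem mul_volume_le_of_translates {B : Set (Pt N)} (hB : MeasurableSet B) {x u : Pt N}
    {s r : ℝ} {L : ℕ} (hs : 0 ≤ s) (hr : 0 ≤ r) (hBs : B ⊆ cube x s) (hL : L * ‖u‖ ≤ r)
    (hdis : ∀ z ∈ B, ∀ j : ℕ, 0 < j → j < L → z + (j : ℝ) • u ∉ B) :
    (L : ENNReal) * volume B ≤ ENNReal.ofReal ((2 * (s + r)) ^ N) := by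
  set T : ℕ → Set (Pt N) := fun j => (fun z => z + (-(j : ℝ) • u)) ⁻¹' B
  have hT : ∀ j, volume (T j) = volume B := fun j => measure_preimage_add_right _ _ _
  have hlt : ∀ i j : ℕ, i < j → j < L → Disjoint (T i) (T j) := by
    intro i j hij hj
    rw [Set.disjoint_left]
    intro z h1 h2
    refine hdis _ h2 (j - i) (by omega) (by omega) ?_
    have : z + (-(j : ℝ) • u) + ((j - i : ℕ) : ℝ) • u = z + (-(i : ℝ) • u) := by
      rw [Nat.cast_sub hij.le]
      module
    rw [this]
    exact h1
  have hsum : volume (⋃ j ∈ Finset.range L, T j) = L * volume B := by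
    rw [measure_biUnion_finset, Finset.sum_congr rfl fun j _ => hT j]
    · simp
    · intro i hi j hj hij
      rcases lt_or_gt_of_ne hij with h | h
      · exact hlt i j h (Finset.mem_range.1 hj)
      · exact (hlt j i h (Finset.mem_range.1 hi)).symm
    · exact fun j _ => (measurable_add_const _) hB
  rw [← hsum, ← volume_cube x (by positivity)]
  refine measure_mono (iUnion₂_subset fun j hj z hz => ?_)
  have h1 : z + (-(j : ℝ) • u) ∈ cube x s := hBs hz
  have h2 := mem_cube_trans h1 (add_mem_cube (z + (-(j : ℝ) • u)) ((j : ℝ) • u))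
  rw [show z + (-(j : ℝ) • u) + (j : ℝ) • u = z by module] at h2
  refine cube_mono x ?_ h2
  have h3 : ‖(j : ℝ) • u‖ ≤ L * ‖u‖ := by
    rw [norm_smul, Real.norm_of_nonneg (by positivity)]
    have : (j : ℝ) ≤ L := by exact_mod_cast (Finset.mem_range.1 hj).le
    gcongr
  linarith

set_option maxHeartbeats 1000000 in
/-- At every small scale there is a cube on which the labels are essentially two, separated in
direction `v`, with boundary measure of the expected order. -/
theorem exists_pure_cube (hN : 2 ≤ N) (hc : Measurable c) (hM : bdryMeas c univ ≠ ⊤)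
    {S : Set (Fin (m + 1))} {v : Pt N} {β : ℝ} (hβ : 0 < β)
    (hrate : ∀ᶠ h : ℝ in nhdsWithin 0 (Ioi 0),
      ENNReal.ofReal (β * h) ≤ volume (exitSet c S (h • v))) :
    ∃ c₁ : ℝ, 0 < c₁ ∧ ∃ C₁ : ℝ, 0 < C₁ ∧ ∀ (n L : ℕ) (τ : ℝ), 0 < n → 1 ≤ L → 2 * ‖v‖ ≤ L →
      0 < τ → ∀ᶠ H : ℝ in nhdsWithin 0 (Ioi 0), ∀ Z Z' : Set (Pt N), MeasurableSet Z →
      MeasurableSet Z' → (∀ z ∈ Z, ∀ t ∈ Icc (0 : ℝ) 1, z + t • (H • v) ∈ Z') →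
      ENNReal.ofReal (tubeConst N * ‖v‖) * bdryMeas c Z' ≤ ENNReal.ofReal (β / 2) →
      ∃ x, ∃ i ∈ S, ∃ j ∉ S, (∃ z ∈ cube x (L * H), z ∉ Z) ∧
        bdryMeas c (cube x (8 * (L * H))) ≤ ENNReal.ofReal (C₁ * (L * H) ^ (N - 1)) ∧
        ENNReal.ofReal (c₁ * H * (L * H) ^ (N - 1)) ≤
          volume {z | z ∈ cube x (L * H) ∧ c z = i ∧ c (z + H • v) = j} ∧
        ∀ k ≤ n, volume {z | z ∈ cube x (2 * (L * H)) ∧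
          c z ≠ c (z + ((k : ℝ) / n) • H • v) ∧
          ¬ (c z = i ∧ c (z + ((k : ℝ) / n) • H • v) = j)} ≤
            ENNReal.ofReal (τ * H * (L * H) ^ (N - 1)) := by
  obtain ⟨κ, hκ, hhalf⟩ := exists_le_bdryMeas_of_half hN
  set M := (bdryMeas c univ).toReal with hMdef
  have hM0 : 0 ≤ M := ENNReal.toReal_nonneg
  have hfinμ : ∀ A, bdryMeas c A ≠ ⊤ := fun A =>
    ne_top_of_le_ne_top hM (measure_mono (subset_univ _))
  have : IsFiniteMeasure (bdryMeas c) := ⟨hM.lt_top⟩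
  set θ := β / (8 * 8 ^ N * (M + 1)) with hθ
  have hθ0 : 0 < θ := by positivity
  set C₂ := 2 * (2 * (1 + ‖v‖)) ^ N with hC₂
  have hC₂0 : 0 < C₂ := by positivity
  refine ⟨θ * κ / (m + 1) ^ 2, by positivity, C₂ / θ, by positivity, ?_⟩
  intro n L τ hn hL hvL hτ
  have hL0 : (1 : ℝ) ≤ L := by exact_mod_cast hL
  set lam := ((m + 1) ^ 2 + C₂) / τ + 2 with hlam
  have hlam2 : 2 ≤ lam := le_add_of_nonneg_left (by positivity)
  have hlam0 : 0 < lam := by linarith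
  set η := β / (8 * 2 ^ N * lam) with hη
  have hη0 : 0 < η := by positivity
  filter_upwards [hrate, self_mem_nhdsWithin,
    eventually_volume_biUnion_badSet hN hc hM L (fun _ => v) (fun j => j)
      (fun _ _ => Nat.cast_nonneg _) (η := η / 4) (by positivity),
    eventually_volume_biUnion_badSet hN hc hM (n + 1) (fun k => ((k : ℝ) / n) • v)
      (fun k => ((n : ℝ) - k) / k) (fun k hk => div_nonneg
        (sub_nonneg.2 (by exact_mod_cast Nat.lt_succ_iff.1 hk)) (Nat.cast_nonneg _))
      (η := η / 4) (by positivity),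
    eventually_lintegral_badDirs hN hc hM v (L := 4 * L) (η := η / 2) (by positivity)
      (by positivity)] with H hX hpos hY1 hY2 hD
  have hH : (0 : ℝ) < H := hpos
  intro Z Z' hZ hZ' hZZ hZM
  set ℓ := (L : ℝ) * H with hℓ
  have hℓ0 : 0 < ℓ := by positivity
  have hHℓ : H ≤ ℓ := le_mul_of_one_le_left hH.le hL0
  set X := exitSet c S (H • v)
  have hXm : MeasurableSet X := measurableSet_exitSet hc S _
  set Y1 := ⋃ k ∈ Finset.range L, badSet c (H • v) (((k : ℝ) * H) • v)
  set Y2 := ⋃ k ∈ Finset.range (n + 1), badSet c (H • ((k : ℝ) / n) • v)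
    ((((n : ℝ) - k) / k * H) • ((k : ℝ) / n) • v)
  set D : Pt N → ENNReal := fun y => volume (badDirs c (H • v) y (4 * L * H))
  have hDm : Measurable D := measurable_volume_badDirs hc _ _
  set o : Measure (Pt N) := volume.restrict (Y1 ∪ Y2) +
    (ENNReal.ofReal (H ^ N))⁻¹ • volume.withDensity D
  have hHN : ENNReal.ofReal (H ^ N) ≠ 0 := by simpa using pow_pos hH N
  have hY1m : MeasurableSet Y1 :=
    Finset.measurableSet_biUnion _ fun k _ => measurableSet_badSet hc _ _
  have hY2m : MeasurableSet Y2 :=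
    Finset.measurableSet_biUnion _ fun k _ => measurableSet_badSet hc _ _
  have ho : o univ ≤ ENNReal.ofReal (η * H) := by
    have e1 : o univ = volume (Y1 ∪ Y2) + (ENNReal.ofReal (H ^ N))⁻¹ * ∫⁻ y, D y := by
      simp [o, withDensity_apply]
    have e2 : (ENNReal.ofReal (H ^ N))⁻¹ * ∫⁻ y, D y ≤ ENNReal.ofReal (η / 2 * H) := by
      rw [mul_comm, ← div_eq_mul_inv, ENNReal.div_le_iff hHN ENNReal.ofReal_ne_top,
        ← ENNReal.ofReal_mul (by positivity)]
      exact hD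
    rw [e1]
    refine (add_le_add ((measure_union_le _ _).trans (add_le_add hY1 hY2)) e2).trans ?_
    rw [← ENNReal.ofReal_add (by positivity) (by positivity),
      ← ENNReal.ofReal_add (by positivity) (by positivity)]
    exact ENNReal.ofReal_le_ofReal (by linarith)
  have hofin : IsFiniteMeasure o := ⟨ho.trans_lt ENNReal.ofReal_lt_top⟩
  have hXZ : ENNReal.ofReal (β / 2 * H) ≤ volume (X \ Z) := by
    have h1 : volume (X ∩ Z) ≤ ENNReal.ofReal (β / 2 * H) := by
      have h2 := volume_ne_shift_le hN hc (H • v) hZ' hZZ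
      refine (measure_mono ?_).trans (h2.trans ?_)
      · rintro z ⟨⟨h1, h2⟩, h3⟩
        exact ⟨h3, fun h => h2 (h ▸ h1)⟩
      · rw [norm_smul, Real.norm_of_nonneg hH.le, mul_comm H, ← mul_assoc,
          ENNReal.ofReal_mul' hH.le, ENNReal.ofReal_mul' hH.le, mul_right_comm]
        exact mul_le_mul_left hZM _
    have h3 : ENNReal.ofReal (β / 2 * H) + ENNReal.ofReal (β / 2 * H) ≤
        volume (X \ Z) + ENNReal.ofReal (β / 2 * H) := by
      rw [← ENNReal.ofReal_add (by positivity) (by positivity)]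
      refine le_trans (le_of_eq (by ring_nf)) (hX.trans ?_)
      rw [← measure_inter_add_sdiff X hZ, add_comm]
      gcongr
    exact (ENNReal.add_le_add_iff_right ENNReal.ofReal_ne_top).1 h3
  obtain ⟨x, hx⟩ := exists_cube_measure_lt (volume.restrict (X \ Z)) (bdryMeas c) o hℓ0.le
    (t := 8 * ℓ) (r := 2 * ℓ) (by positivity) (by positivity) (θ := ENNReal.ofReal (θ * H))
    (lam := ENNReal.ofReal lam) (by
      rw [Measure.restrict_apply_univ]
      refine lt_of_lt_of_le ?_ (mul_le_mul_right hXZ _)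
      have h1 : ENNReal.ofReal lam * (ENNReal.ofReal ((2 * (2 * ℓ)) ^ N) * o univ) ≤
          ENNReal.ofReal (lam * ((2 * (2 * ℓ)) ^ N * (η * H))) := by
        rw [ENNReal.ofReal_mul hlam0.le, ENNReal.ofReal_mul (by positivity)]
        gcongr
      refine lt_of_le_of_lt (add_le_add_right h1 _) ?_
      rw [← ENNReal.ofReal_toReal hM, ← hMdef, ← ENNReal.ofReal_mul (by positivity),
        ← ENNReal.ofReal_mul (by positivity), ← ENNReal.ofReal_mul (by positivity),
        ← ENNReal.ofReal_add (by positivity) (by positivity)]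
      refine (ENNReal.ofReal_lt_ofReal_iff (by positivity)).2 ?_
      have e1 : θ * H * ((2 * (8 * ℓ)) ^ N * M) ≤ (2 * ℓ) ^ N * (β / 8 * H) := by
        rw [show 2 * (8 * ℓ) = 8 * (2 * ℓ) by ring, mul_pow 8, hθ]
        rw [show β / (8 * 8 ^ N * (M + 1)) * H * (8 ^ N * (2 * ℓ) ^ N * M) =
          (2 * ℓ) ^ N * (β / 8 * H) * (M / (M + 1)) by field_simp]
        refine mul_le_of_le_one_right (by positivity) ?_
        rw [div_le_one (by positivity)]
        linarith
      have e2 : lam * ((2 * (2 * ℓ)) ^ N * (η * H)) = (2 * ℓ) ^ N * (β / 8 * H) := by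
        rw [mul_pow 2 (2 * ℓ), hη]
        field_simp
      rw [e2]
      have : 0 < (2 * ℓ) ^ N * (β / 8 * H) := by positivity
      nlinarith)
  have hXZm : MeasurableSet (X \ Z) := hXm.diff hZ
  rw [Measure.restrict_apply (measurableSet_cube _ _), inter_comm] at hx
  set A := (X \ Z) ∩ cube x ℓ with hA
  have hAm : MeasurableSet A := hXZm.inter (measurableSet_cube _ _)
  have hAfin : volume A ≠ ⊤ := ne_top_of_le_ne_top
    (by rw [volume_cube x hℓ0.le]; exact ENNReal.ofReal_ne_top) (measure_mono inter_subset_right)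
  have hofin2 : o (cube x (2 * ℓ)) ≠ ⊤ := measure_ne_top _ _
  set a := (volume A).toReal with ha
  set b := (bdryMeas c (cube x (8 * ℓ))).toReal with hb
  set p := (o (cube x (2 * ℓ))).toReal with hp
  have ha0 : 0 ≤ a := ENNReal.toReal_nonneg
  have hb0 : 0 ≤ b := ENNReal.toReal_nonneg
  have hp0 : 0 ≤ p := ENNReal.toReal_nonneg
  have hvA : volume A = ENNReal.ofReal a := (ENNReal.ofReal_toReal hAfin).symm
  have hvb : bdryMeas c (cube x (8 * ℓ)) = ENNReal.ofReal b :=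
    (ENNReal.ofReal_toReal (hfinμ _)).symm
  have hvp : o (cube x (2 * ℓ)) = ENNReal.ofReal p := (ENNReal.ofReal_toReal hofin2).symm
  have hx' : θ * H * b + lam * p < a := by
    rw [hvA, hvb, hvp, ← ENNReal.ofReal_mul (by positivity), ← ENNReal.ofReal_mul (by positivity),
      ← ENNReal.ofReal_add (by positivity) (by positivity)] at hx
    exact ENNReal.ofReal_lt_ofReal_iff_of_nonneg (by positivity) |>.1 hx
  have hapos : 0 < a := lt_of_le_of_lt (by positivity) hx'
  have hplam : p ≤ a / lam := by
    rw [le_div_iff₀ hlam0, mul_comm]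
    have : 0 ≤ θ * H * b := by positivity
    linarith
  have hHN' : ℓ ^ N = ℓ * ℓ ^ (N - 1) := by
    rw [← pow_succ', Nat.sub_add_cancel (by omega)]
  have hYp : ∀ B : Set (Pt N), MeasurableSet B → B ⊆ cube x (2 * ℓ) →
      volume (B ∩ (Y1 ∪ Y2)) ≤ ENNReal.ofReal p := by
    intro B hBm hB
    rw [← hvp, ← Measure.restrict_apply hBm]
    refine le_trans ?_ (measure_mono hB)
    exact Measure.le_iff.1 (Measure.le_add_right le_rfl) _ hBm
  have hDp : ∀ B : Set (Pt N), MeasurableSet B → B ⊆ cube x (2 * ℓ) →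
      ∫⁻ y in B, D y ≤ ENNReal.ofReal (H ^ N) * ENNReal.ofReal p := by
    intro B hBm hB
    rw [← hvp, mul_comm, ← ENNReal.div_le_iff hHN ENNReal.ofReal_ne_top, div_eq_mul_inv, mul_comm,
      ← withDensity_apply _ hBm]
    refine le_trans ?_ (measure_mono hB)
    exact Measure.le_iff.1 (Measure.le_add_left le_rfl) _ hBm
  have hAcube : A ⊆ cube x (2 * ℓ) := inter_subset_right.trans (cube_mono x (by linarith))
  -- upper bound
  have haup : a ≤ C₂ * H * ℓ ^ (N - 1) := by
    have h1 := mul_volume_le_of_translates (B := A \ (Y1 ∪ Y2)) (hAm.diff (hY1m.union hY2m))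
      (x := x) (u := H • v) (s := ℓ) (r := ‖v‖ * ℓ) (L := L) hℓ0.le (by positivity)
      (sdiff_subset.trans inter_subset_right)
      (by rw [norm_smul, Real.norm_of_nonneg hH.le, hℓ]; exact le_of_eq (by ring)) (by
        rintro z ⟨⟨⟨⟨hz1, hz2⟩, -⟩, -⟩, hz3⟩ j hj0 hjL ⟨⟨⟨⟨hz4, -⟩, -⟩, -⟩, -⟩
        refine hz3 (Or.inl (mem_iUnion₂.2 ⟨j - 1, Finset.mem_range.2 (by omega), ?_, ?_⟩))
        · exact fun h => hz2 (h ▸ hz1)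
        · rw [show z + H • v + ((((j - 1 : ℕ) : ℝ)) * H) • v = z + (j : ℝ) • H • v by
            rw [Nat.cast_sub (by omega)]; push_cast; module]
          exact fun h => hz2 (h ▸ hz4))
    have h2 : volume A ≤ volume (A \ (Y1 ∪ Y2)) + ENNReal.ofReal p := by
      rw [← measure_inter_add_sdiff A (hY1m.union hY2m), add_comm]
      gcongr
      exact hYp A hAm hAcube
    set w := volume (A \ (Y1 ∪ Y2)) with hw
    have hwfin : w ≠ ⊤ := ne_top_of_le_ne_top hAfin (measure_mono sdiff_subset)
    rw [← ENNReal.ofReal_toReal hwfin] at h1 h2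
    have hw0 : 0 ≤ w.toReal := ENNReal.toReal_nonneg
    rw [← ENNReal.ofReal_natCast, ← ENNReal.ofReal_mul (by positivity),
      ENNReal.ofReal_le_ofReal_iff (by positivity)] at h1
    rw [hvA, ← ENNReal.ofReal_add hw0 hp0, ENNReal.ofReal_le_ofReal_iff (by positivity)] at h2
    have h3 : p ≤ a / 2 := hplam.trans (div_le_div_of_nonneg_left ha0 two_pos hlam2)
    have h4 : (2 * (ℓ + ‖v‖ * ℓ)) ^ N = L * ((2 * (1 + ‖v‖)) ^ N * H * ℓ ^ (N - 1)) := by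
      rw [show 2 * (ℓ + ‖v‖ * ℓ) = 2 * (1 + ‖v‖) * ℓ by ring, mul_pow (2 * (1 + ‖v‖)), hHN']
      nth_rewrite 1 [hℓ]
      ring
    rw [h4] at h1
    have h5 := le_of_mul_le_mul_left h1 (by linarith)
    rw [hC₂]
    linarith
  -- lower bound
  have hy : ∃ y ∈ A, D y ≤ ENNReal.ofReal ((2 * ℓ) ^ N / 4) := by
    by_contra! hno
    have h1 := hDp A hAm hAcube
    have h2 : ENNReal.ofReal ((2 * ℓ) ^ N / 4) * volume A ≤ ∫⁻ y in A, D y := by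
      rw [← setLIntegral_const]
      exact setLIntegral_mono hDm fun y hy => (hno y hy).le
    have h3 := h2.trans h1
    rw [hvA, ← ENNReal.ofReal_mul (by positivity), ← ENNReal.ofReal_mul (by positivity),
      ENNReal.ofReal_le_ofReal_iff (by positivity)] at h3
    have h4 : H ^ N ≤ (2 * ℓ) ^ N / 4 := by
      rw [mul_pow 2 ℓ]
      have e1 : H ^ N ≤ ℓ ^ N := pow_le_pow_left₀ hH.le hHℓ N
      have e2 : (4 : ℝ) ≤ 2 ^ N := by
        calc (4 : ℝ) = 2 ^ 2 := by norm_num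
          _ ≤ 2 ^ N := pow_le_pow_right₀ (by norm_num) hN
      have e3 : 0 < ℓ ^ N := by positivity
      nlinarith
    have h5 : H ^ N * a ≤ H ^ N * p := (mul_le_mul_of_nonneg_right h4 ha0).trans h3
    have h6 := le_of_mul_le_mul_left h5 (by positivity)
    have h7 : p ≤ a / 2 := hplam.trans (div_le_div_of_nonneg_left ha0 two_pos hlam2)
    linarith
  have halow : θ * κ * H * ℓ ^ (N - 1) ≤ a := by
    obtain ⟨y, ⟨⟨⟨hy1, hy2⟩, -⟩, hy3⟩, hy4⟩ := hy
    have h1 := hhalf hc (v := H • v) (y := y) (s := ℓ) (S := S) hℓ0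
      (by rw [norm_smul, Real.norm_of_nonneg hH.le, hℓ]; nlinarith) hy1 hy2
      ((measure_mono (show badDirs c (H • v) y ℓ ⊆ badDirs c (H • v) y (4 * L * H) from
        fun d hd => ⟨cube_mono 0 (by linarith) hd.1, hd.2⟩)).trans hy4)
    have h2 := h1.trans (measure_mono ((cube_subset_cube hy3).trans
      (cube_mono x (by linarith : ℓ + 2 * ℓ ≤ 8 * ℓ))))
    rw [hvb, ENNReal.ofReal_le_ofReal_iff hb0] at h2
    have h3 : θ * H * (κ * ℓ ^ (N - 1)) ≤ θ * H * b := mul_le_mul_of_nonneg_left h2 (by positivity)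
    have h4 : 0 ≤ lam * p := by positivity
    linarith
  -- choice of the labels
  set B : Fin (m + 1) × Fin (m + 1) → Set (Pt N) := fun q =>
    A ∩ {z | c z = q.1 ∧ c (z + H • v) = q.2}
  have hBm : ∀ q, MeasurableSet (B q) := fun q =>
    hAm.inter ((hc (measurableSet_singleton q.1)).inter
      ((hc.comp (measurable_add_const (H • v))) (measurableSet_singleton q.2)))
  have hBtype : ∃ q, ENNReal.ofReal (a / (m + 1) ^ 2) ≤ volume (B q) := by
    by_contra! hno
    have h1 : volume A ≤ ∑ q, volume (B q) := by
      refine (measure_mono ?_).trans (measure_iUnion_fintype_le _ _)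
      exact fun z hz => mem_iUnion.2 ⟨(c z, c (z + H • v)), hz, rfl, rfl⟩
    have h2 : ∑ q, volume (B q) < ∑ _q : Fin (m + 1) × Fin (m + 1),
        ENNReal.ofReal (a / (m + 1) ^ 2) :=
      ENNReal.sum_lt_sum_of_nonempty Finset.univ_nonempty fun q _ => hno q
    rw [Finset.sum_const, Finset.card_univ, Fintype.card_prod, Fintype.card_fin, nsmul_eq_mul,
      ← ENNReal.ofReal_natCast, ← ENNReal.ofReal_mul (by positivity)] at h2
    refine (h1.trans_lt h2).ne ?_
    rw [hvA]
    congr 1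
    push_cast
    rw [← pow_two, mul_div_cancel₀ _ (by positivity)]
  obtain ⟨⟨i, j⟩, hij⟩ := hBtype
  have hBne : (B (i, j)).Nonempty := by
    refine nonempty_of_measure_ne_zero (μ := volume) fun h => ?_
    rw [h, nonpos_iff_eq_zero, ENNReal.ofReal_eq_zero] at hij
    have : 0 < a / ((m : ℝ) + 1) ^ 2 := by positivity
    linarith
  obtain ⟨z₀, ⟨⟨⟨hz1, hz2⟩, hz3⟩, hz4⟩, hz5, hz6⟩ := hBne
  dsimp only at hz5 hz6
  -- purity
  set I := {z | z ∈ cube x (2 * ℓ) ∧ c z ≠ c (z + H • v) ∧ ¬ (c z = i ∧ c (z + H • v) = j)}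
  have hI : volume I ≤ ENNReal.ofReal ((m + 1) ^ 2 * H ^ N / lam) := by
    have h1 : ∀ y ∈ B (i, j), volume I ≤ D y := by
      rintro y ⟨⟨⟨⟨hy1, hy2⟩, -⟩, hy3⟩, hy4, hy5⟩
      dsimp only at hy4 hy5
      rw [← measure_preimage_add volume y I]
      refine measure_mono ?_
      rintro d ⟨hd1, hd2, hd3⟩
      refine ⟨?_, ?_⟩
      · have h2 := mem_cube_trans (mem_cube_comm.1 hy3) hd1
        intro k
        have h3 := h2 k
        simp only [PiLp.add_apply, add_sub_cancel_left] at h3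
        simp only [PiLp.zero_apply, sub_zero]
        rw [mul_assoc]
        linarith
      · by_contra! hno
        have h2 := label_eq_of_not_bad hno (fun h => hy2 (h ▸ hy1)) hd2
        exact hd3 ⟨h2.1 ▸ hy4, h2.2 ▸ hy5⟩
    have h2 : volume I * volume (B (i, j)) ≤ ENNReal.ofReal (H ^ N) * ENNReal.ofReal p := by
      refine le_trans ?_ (hDp _ (hBm (i, j)) (inter_subset_left.trans hAcube))
      rw [← setLIntegral_const]
      exact setLIntegral_mono hDm h1
    have h3 := (mul_le_mul_right hij _).trans h2
    rw [← ENNReal.le_div_iff_mul_le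
      (Or.inl (ENNReal.ofReal_pos.2 (by positivity)).ne') (Or.inl ENNReal.ofReal_ne_top),
      ← ENNReal.ofReal_mul (by positivity), ← ENNReal.ofReal_div_of_pos (by positivity)] at h3
    refine h3.trans (ENNReal.ofReal_le_ofReal ?_)
    rw [div_le_div_iff₀ (by positivity) hlam0]
    have h4 : p * lam ≤ a := (le_div_iff₀ hlam0).1 hplam
    calc H ^ N * p * lam = H ^ N * (p * lam) := by ring
      _ ≤ H ^ N * a := by gcongr
      _ = _ := by field_simp
  refine ⟨x, i, hz5 ▸ hz1, j, hz6 ▸ hz2, ⟨z₀, hz4, hz3⟩, ?_, ?_, ?_⟩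
  · rw [hvb]
    refine ENNReal.ofReal_le_ofReal ?_
    have h1 : θ * H * b ≤ C₂ * H * ℓ ^ (N - 1) := by
      have : 0 ≤ lam * p := by positivity
      linarith
    rw [div_mul_eq_mul_div, le_div_iff₀ hθ0]
    refine le_of_mul_le_mul_left ?_ hH
    linarith
  · refine le_trans (ENNReal.ofReal_le_ofReal ?_) (hij.trans (measure_mono ?_))
    · rw [div_mul_eq_mul_div, div_mul_eq_mul_div]
      gcongr
    · rintro z ⟨⟨-, h1⟩, h2⟩
      exact ⟨h1, h2⟩
  · intro k hk
    have hcov : {z | z ∈ cube x (2 * ℓ) ∧ c z ≠ c (z + ((k : ℝ) / n) • H • v) ∧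
        ¬ (c z = i ∧ c (z + ((k : ℝ) / n) • H • v) = j)} ⊆
        I ∪ (cube x (2 * ℓ) ∩ (Y1 ∪ Y2)) := by
      rintro z ⟨h1, h2, h3⟩
      by_cases hY : z ∈ Y2
      · exact Or.inr ⟨h1, Or.inr hY⟩
      refine Or.inl ?_
      have hk0 : (k : ℝ) ≠ 0 := by
        rintro h
        rw [h] at h2
        simp at h2
      have hn0 : (n : ℝ) ≠ 0 := by positivity
      have h4 : z ∉ badSet c (H • ((k : ℝ) / n) • v)
          ((((n : ℝ) - k) / k * H) • ((k : ℝ) / n) • v) := fun h =>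
        hY (mem_iUnion₂.2 ⟨k, Finset.mem_range.2 (by omega), h⟩)
      rw [smul_comm H, smul_smul (((n : ℝ) - k) / k * H),
        show ((n : ℝ) - k) / k * H * (k / n) = H - k / n * H by field_simp] at h4
      have h5 : c (z + ((k : ℝ) / n) • H • v) = c (z + H • v) := by
        by_contra hne
        refine h4 ⟨h2.symm, ?_⟩
        rwa [show z + ((k : ℝ) / n) • H • v + (H - k / n * H) • v = z + H • v by module]
      rw [h5] at h2 h3
      exact ⟨h1, h2, h3⟩
    refine (measure_mono hcov).trans ((measure_union_le _ _).trans
      ((add_le_add hI (hYp _ (measurableSet_cube _ _) subset_rfl)).trans ?_))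
    rw [← ENNReal.ofReal_add (by positivity) hp0]
    refine ENNReal.ofReal_le_ofReal ?_
    have h1 : p ≤ C₂ * H * ℓ ^ (N - 1) / lam := hplam.trans (by gcongr)
    have h2 : H ^ N ≤ H * ℓ ^ (N - 1) := by
      calc H ^ N = H * H ^ (N - 1) := by rw [← pow_succ', Nat.sub_add_cancel (by omega)]
        _ ≤ _ := by gcongr
    have h3 : ((m : ℝ) + 1) ^ 2 * H ^ N / lam ≤ (m + 1) ^ 2 * (H * ℓ ^ (N - 1)) / lam := by gcongr
    have h4 : ((m : ℝ) + 1) ^ 2 + C₂ ≤ τ * lam := by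
      rw [hlam, mul_add, mul_div_cancel₀ _ hτ.ne']
      linarith
    have h5 : ((m : ℝ) + 1) ^ 2 * (H * ℓ ^ (N - 1)) / lam + C₂ * H * ℓ ^ (N - 1) / lam ≤
        τ * H * ℓ ^ (N - 1) := by
      rw [← add_div, div_le_iff₀ hlam0]
      have : 0 < H * ℓ ^ (N - 1) := by positivity
      nlinarith
    linarith

end PureCubes

theorem lipschitzWith_insertNth {M : ℕ} (k : Fin (M + 1)) (a : ℝ) :
    LipschitzWith (((M + 1 : ℕ) : NNReal) ^ (1 / (2 : ENNReal)).toReal)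
      (fun y : Fin M → ℝ => (WithLp.toLp 2 (k.insertNth a y : Fin (M + 1) → ℝ) : Pt (M + 1))) := by
  have h1 : LipschitzWith 1 (fun y : Fin M → ℝ => (k.insertNth a y : Fin (M + 1) → ℝ)) := by
    refine LipschitzWith.of_dist_le_mul fun y z => ?_
    rw [NNReal.coe_one, one_mul, dist_pi_le_iff dist_nonneg]
    intro j
    induction j using Fin.succAboveCases k with
    | x => simp
    | p j => simpa using dist_le_pi_dist y z j
  have := (PiLp.lipschitzWith_toLp 2 (fun _ : Fin (M + 1) => ℝ)).comp h1
  simpa [Function.comp_def] using this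

theorem hausdorffMeasure_slice_le {M : ℕ} (k : Fin (M + 1)) (a : ℝ) (A : Set (Pt (M + 1))) :
    μH[((M + 1 : ℕ) : ℝ) - 1] (A ∩ {z | z k = a}) ≤
      ((((M + 1 : ℕ) : NNReal) ^ (1 / (2 : ENNReal)).toReal : NNReal) : ENNReal) ^ (M : ℝ) *
        volume {y : Fin M → ℝ | (WithLp.toLp 2 (k.insertNth a y : Fin (M + 1) → ℝ) :
          Pt (M + 1)) ∈ A} := by
  have hM : ((M + 1 : ℕ) : ℝ) - 1 = M := by push_cast; ring
  rw [hM]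
  have h1 := (lipschitzWith_insertNth k a).hausdorffMeasure_image_le (d := (M : ℝ))
    (Nat.cast_nonneg _) {y : Fin M → ℝ | (WithLp.toLp 2 (k.insertNth a y : Fin (M + 1) → ℝ) :
          Pt (M + 1)) ∈ A}
  have h2 : (μH[(M : ℝ)] : Measure (Fin M → ℝ)) = volume := by
    have := hausdorffMeasure_pi_real (ι := Fin M)
    rwa [Fintype.card_fin] at this
  rw [h2] at h1
  refine (measure_mono ?_).trans h1
  rintro z ⟨hz, hza⟩
  have hz' : (WithLp.toLp 2 (k.insertNth a (fun j => z (k.succAbove j)) : Fin (M + 1) → ℝ) :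
      Pt (M + 1)) = z := by
    ext j
    induction j using Fin.succAboveCases k with
    | x => simpa using hza.symm
    | p j => simp
  refine ⟨fun j => z (k.succAbove j), ?_, hz'⟩
  rw [mem_ofPred_eq, hz']
  exact hz

theorem measurePreserving_toLp_insertNth {M : ℕ} (k : Fin (M + 1)) :
    MeasurePreserving (fun p : ℝ × (Fin M → ℝ) =>
      (WithLp.toLp 2 (k.insertNth p.1 p.2 : Fin (M + 1) → ℝ) : Pt (M + 1))) volume volume :=
  (PiLp.volume_preserving_toLp (Fin (M + 1))).comp
    (volume_preserving_piFinSuccAbove (fun _ => ℝ) k).symm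

/-- Fubini bound for the measure of the slices of a set by coordinate hyperplanes. -/
theorem exists_slice_bound (hN : 1 ≤ N) : ∃ K : ℝ, 0 < K ∧ ∀ W : Set (Pt N), MeasurableSet W →
    ∀ k : Fin N, ∃ ψ : ℝ → ENNReal, Measurable ψ ∧
      (∀ a, μH[(N : ℝ) - 1] (W ∩ {z | z k = a}) ≤ ψ a) ∧
      ∫⁻ a, ψ a = ENNReal.ofReal K * volume W := by
  obtain ⟨M, rfl⟩ : ∃ M, N = M + 1 := ⟨N - 1, by omega⟩
  set q : NNReal := ((M + 1 : ℕ) : NNReal) ^ (1 / (2 : ENNReal)).toReal with hq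
  have hq0 : 0 < q := NNReal.rpow_pos (by positivity)
  have hK : ENNReal.ofReal ((q ^ (M : ℝ) : NNReal) : ℝ) = (q : ENNReal) ^ (M : ℝ) := by
    rw [ENNReal.ofReal_coe_nnreal, ENNReal.coe_rpow_of_nonneg _ (Nat.cast_nonneg _)]
  refine ⟨(q ^ (M : ℝ) : NNReal), NNReal.coe_pos.2 (NNReal.rpow_pos hq0), fun W hW k => ?_⟩
  have hmp := measurePreserving_toLp_insertNth k
  have hmeas := hmp.measurable hW
  refine ⟨fun a => (q : ENNReal) ^ (M : ℝ) * volume {y : Fin M → ℝ |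
    (WithLp.toLp 2 (k.insertNth a y : Fin (M + 1) → ℝ) : Pt (M + 1)) ∈ W}, ?_, ?_, ?_⟩
  · exact (measurable_measure_prodMk_left hmeas).const_mul _
  · exact fun a => hausdorffMeasure_slice_le k a W
  · refine (lintegral_const_mul _ (measurable_measure_prodMk_left hmeas)).trans ?_
    rw [hK]
    congr 1
    rw [← hmp.measure_preimage hW.nullMeasurableSet, Measure.volume_eq_prod,
      Measure.prod_apply hmeas]

/-- The boundary of the cube. -/
def cubeBdry (x : Pt N) (s : ℝ) : Set (Pt N) := {z | z ∈ cube x s ∧ ∃ k, |z k - x k| = s}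

theorem cubeBdry_subset (x : Pt N) (s : ℝ) :
    cubeBdry x s ⊆ ⋃ k, ({z | z k = x k + s} ∪ {z | z k = x k - s}) := by
  rintro z ⟨-, k, hk⟩
  refine mem_iUnion.2 ⟨k, ?_⟩
  rcases abs_choice (z k - x k) with h | h <;> rw [h] at hk
  · left; rw [mem_ofPred_eq]; linarith
  · right; rw [mem_ofPred_eq]; linarith

theorem hausdorffMeasure_cubeBdry_inter_le (x : Pt N) (s : ℝ) (W : Set (Pt N)) :
    μH[(N : ℝ) - 1] (cubeBdry x s ∩ W) ≤ ∑ k, (μH[(N : ℝ) - 1] (W ∩ {z | z k = x k + s}) +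
      μH[(N : ℝ) - 1] (W ∩ {z | z k = x k - s})) := by
  calc μH[(N : ℝ) - 1] (cubeBdry x s ∩ W)
      ≤ μH[(N : ℝ) - 1] (⋃ k, (W ∩ {z | z k = x k + s} ∪ W ∩ {z | z k = x k - s})) := by
        refine measure_mono ?_
        rintro z ⟨hz, hW⟩
        obtain ⟨k, hk⟩ := mem_iUnion.1 (cubeBdry_subset x s hz)
        exact mem_iUnion.2 ⟨k, hk.imp (⟨hW, ·⟩) (⟨hW, ·⟩)⟩
    _ ≤ _ := by
        refine (measure_iUnion_fintype_le _ _).trans (Finset.sum_le_sum fun k _ => ?_)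
        exact measure_union_le _ _

theorem exists_hausdorffMeasure_cubeBdry_le (hN : 1 ≤ N) : ∃ K : ℝ, 0 < K ∧
    ∀ (x : Pt N) (s : ℝ), 0 ≤ s →
      μH[(N : ℝ) - 1] (cubeBdry x s) ≤ ENNReal.ofReal (K * s ^ (N - 1)) := by
  obtain ⟨M, rfl⟩ : ∃ M, N = M + 1 := ⟨N - 1, by omega⟩
  set q : NNReal := ((M + 1 : ℕ) : NNReal) ^ (1 / (2 : ENNReal)).toReal with hq
  have hq0 : 0 < q := NNReal.rpow_pos (by positivity)
  have hK : ENNReal.ofReal ((q ^ (M : ℝ) : NNReal) : ℝ) = (q : ENNReal) ^ (M : ℝ) := by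
    rw [ENNReal.ofReal_coe_nnreal, ENNReal.coe_rpow_of_nonneg _ (Nat.cast_nonneg _)]
  have hqM : 0 < ((q ^ (M : ℝ) : NNReal) : ℝ) := NNReal.coe_pos.2 (NNReal.rpow_pos hq0)
  set q' : ℝ := ((q ^ (M : ℝ) : NNReal) : ℝ) with hq'
  refine ⟨(M + 1) * (2 * (q' * 2 ^ M)), by positivity, fun x s hs => ?_⟩
  have key : ∀ (k : Fin (M + 1)) (a : ℝ), μH[((M + 1 : ℕ) : ℝ) - 1] (cube x s ∩ {z | z k = a}) ≤
      ENNReal.ofReal (q' * (2 * s) ^ M) := by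
    intro k a
    refine (hausdorffMeasure_slice_le k a _).trans ?_
    rw [ENNReal.ofReal_mul hqM.le, hq', hK]
    refine mul_le_mul_right ?_ _
    calc volume {y : Fin M → ℝ | (WithLp.toLp 2 (k.insertNth a y : Fin (M + 1) → ℝ) :
          Pt (M + 1)) ∈ cube x s}
        ≤ volume (Icc (fun j => x (k.succAbove j) - s) (fun j => x (k.succAbove j) + s)) := by
          refine measure_mono fun y hy => ?_
          have : ∀ j, |y j - x (k.succAbove j)| ≤ s := fun j => by
            simpa using hy (k.succAbove j)
          exact ⟨fun j => by have := abs_le.1 (this j); simp only; linarith,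
            fun j => by have := abs_le.1 (this j); simp only; linarith⟩
      _ = ENNReal.ofReal ((2 * s) ^ M) := by
          rw [Real.volume_Icc_pi]
          simp only [add_sub_sub_cancel]
          rw [Finset.prod_const, Finset.card_univ, Fintype.card_fin, ← two_mul,
            ENNReal.ofReal_pow (by positivity)]
  have h1 := hausdorffMeasure_cubeBdry_inter_le x s (cube x s)
  rw [inter_eq_left.2 (fun z hz => hz.1)] at h1
  refine h1.trans ((Finset.sum_le_sum fun k _ => add_le_add (key k _) (key k _)).trans ?_)
  rw [Finset.sum_const, Finset.card_univ, Fintype.card_fin, nsmul_eq_mul,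
    ← ENNReal.ofReal_add (by positivity) (by positivity), ← ENNReal.ofReal_natCast,
    ← ENNReal.ofReal_mul (by positivity)]
  refine ENNReal.ofReal_le_ofReal (le_of_eq ?_)
  rw [mul_pow, Nat.add_sub_cancel]
  push_cast
  ring

theorem mem_cube_iff_norm (hN : 1 ≤ N) {x z : Pt N} {s : ℝ} :
    z ∈ cube x s ↔ ‖(fun k => z k - x k : Fin N → ℝ)‖ ≤ s := by
  have : Nonempty (Fin N) := ⟨⟨0, hN⟩⟩
  rw [pi_norm_le_iff_of_nonempty]
  simp [cube]

theorem lintegral_shell_le (hN : 1 ≤ N) (ν : Measure (Pt N)) [SFinite ν] (x : Pt N) {b : ℝ} :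
    Measurable (fun s => ν (cube x (s + b) \ cube x s)) ∧
    ∫⁻ s, ν (cube x (s + b) \ cube x s) ≤ ENNReal.ofReal b * ν univ := by
  set d : Pt N → ℝ := fun z => ‖(fun k => z k - x k : Fin N → ℝ)‖ with hd
  have hdm : Measurable d := by
    have : Continuous d := by fun_prop
    exact this.measurable
  have hset : ∀ s, cube x (s + b) \ cube x s = {z | d z ≤ s + b ∧ s < d z} := by
    intro s
    ext z
    rw [Set.mem_sdiff, mem_cube_iff_norm hN, mem_cube_iff_norm hN, not_le]
    rfl
  have hmeas : MeasurableSet {p : ℝ × Pt N | d p.2 ≤ p.1 + b ∧ p.1 < d p.2} :=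
    (measurableSet_le (hdm.comp measurable_snd) (measurable_fst.add_const b)).inter
      (measurableSet_lt measurable_fst (hdm.comp measurable_snd))
  simp only [hset]
  refine ⟨measurable_measure_prodMk_left hmeas, ?_⟩
  calc ∫⁻ s, ν {z | d z ≤ s + b ∧ s < d z}
      = (volume.prod ν) {p : ℝ × Pt N | d p.2 ≤ p.1 + b ∧ p.1 < d p.2} := by
        rw [Measure.prod_apply hmeas]
        rfl
    _ = ∫⁻ z, volume {s | d z ≤ s + b ∧ s < d z} ∂ν := by
        rw [Measure.prod_apply_symm hmeas]
        rfl
    _ ≤ ∫⁻ z, ENNReal.ofReal b ∂ν := by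
        refine lintegral_mono fun z => ?_
        calc volume {s | d z ≤ s + b ∧ s < d z} ≤ volume (Ico (d z - b) (d z)) :=
              measure_mono fun s hs => ⟨by linarith [hs.1], hs.2⟩
          _ = ENNReal.ofReal b := by rw [Real.volume_Ico]; congr 1; ring
    _ = _ := by rw [lintegral_const]

theorem exists_good_radius (hN : 1 ≤ N) : ∃ K : ℝ, 0 < K ∧
    ∀ {ι : Type} (ν : Measure (Pt N)) [SFinite ν] (x : Pt N) (ℓ b : ℝ) (J : Finset ι)
      (W : ι → Set (Pt N)), 0 < ℓ → (∀ j ∈ J, MeasurableSet (W j)) →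
      ∃ s ∈ Icc (5 / 4 * ℓ) (7 / 4 * ℓ),
        ν (cube x (s + b) \ cube x s) + ∑ j ∈ J, μH[(N : ℝ) - 1] (cubeBdry x s ∩ W j) ≤
          ENNReal.ofReal (K / ℓ) * (ENNReal.ofReal b * ν univ + ∑ j ∈ J, volume (W j)) := by
  obtain ⟨K, hK, hslice⟩ := exists_slice_bound hN
  refine ⟨2 * (2 * N * K + 1), by positivity, fun {ι} ν _ x ℓ b J W hℓ hW => ?_⟩
  have : ∀ j : ι, ∃ ψ : Fin N → ℝ → ENNReal, j ∈ J → ∀ k, Measurable (ψ k) ∧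
      (∀ a, μH[(N : ℝ) - 1] (W j ∩ {z | z k = a}) ≤ ψ k a) ∧
      ∫⁻ a, ψ k a = ENNReal.ofReal K * volume (W j) := by
    intro j
    by_cases hj : j ∈ J
    · choose ψ hψ using hslice (W j) (hW j hj)
      exact ⟨ψ, fun _ => hψ⟩
    · exact ⟨fun _ _ => 0, fun h => absurd h hj⟩
  choose ψ hψ using this
  obtain ⟨hm1, hi1⟩ := lintegral_shell_le hN ν x (b := b)
  set φ : ℝ → ENNReal := fun s => ν (cube x (s + b) \ cube x s) +
    ∑ j ∈ J, ∑ k, (ψ j k (x k + s) + ψ j k (x k - s)) with hφ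
  have hm2 : ∀ j ∈ J, ∀ k, Measurable fun s => ψ j k (x k + s) := fun j hj k =>
    (hψ j hj k).1.comp (measurable_const_add _)
  have hm3 : ∀ j ∈ J, ∀ k, Measurable fun s => ψ j k (x k - s) := fun j hj k =>
    (hψ j hj k).1.comp (measurable_const_sub _)
  have hm4 : ∀ j ∈ J, ∀ k, Measurable fun s => ψ j k (x k + s) + ψ j k (x k - s) :=
    fun j hj k => (hm2 j hj k).add (hm3 j hj k)
  have hmS : ∀ j ∈ J, Measurable fun s => ∑ k, (ψ j k (x k + s) + ψ j k (x k - s)) :=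
    fun j hj => Finset.measurable_sum _ fun k _ => hm4 j hj k
  have hφm : Measurable φ := hm1.add (Finset.measurable_sum _ hmS)
  have hle_int : ∫⁻ s, φ s ≤ ENNReal.ofReal (2 * N * K + 1) *
      (ENNReal.ofReal b * ν univ + ∑ j ∈ J, volume (W j)) := by
    have h2 : ∫⁻ s, ∑ j ∈ J, ∑ k, (ψ j k (x k + s) + ψ j k (x k - s)) =
        ENNReal.ofReal (2 * N * K) * ∑ j ∈ J, volume (W j) := by
      rw [lintegral_finsetSum _ hmS, Finset.mul_sum]
      refine Finset.sum_congr rfl fun j hj => ?_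
      rw [lintegral_finsetSum _ fun k _ => hm4 j hj k]
      have : ∀ k, ∫⁻ s, (ψ j k (x k + s) + ψ j k (x k - s)) =
          2 * (ENNReal.ofReal K * volume (W j)) := by
        intro k
        rw [lintegral_add_left (hm2 j hj k), lintegral_add_left_eq_self (ψ j k),
          lintegral_sub_left_eq_self (ψ j k), (hψ j hj k).2.2, two_mul]
      rw [Finset.sum_congr rfl fun k _ => this k, Finset.sum_const, Finset.card_univ,
        Fintype.card_fin, nsmul_eq_mul, ENNReal.ofReal_mul (by positivity),
        ENNReal.ofReal_mul (by positivity), ENNReal.ofReal_natCast, ENNReal.ofReal_ofNat]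
      ring
    rw [hφ, lintegral_add_left hm1, h2, mul_add]
    refine add_le_add (hi1.trans ?_) (mul_le_mul_left (ENNReal.ofReal_le_ofReal (by linarith)) _)
    refine le_mul_of_one_le_left zero_le ?_
    rw [ENNReal.one_le_ofReal]
    have : 0 ≤ 2 * N * K := by positivity
    linarith
  have hvol : volume (Icc (5 / 4 * ℓ) (7 / 4 * ℓ)) = ENNReal.ofReal (ℓ / 2) := by
    rw [Real.volume_Icc]; congr 1; ring
  have hv0 : ENNReal.ofReal (ℓ / 2) ≠ 0 := (ENNReal.ofReal_pos.2 (by positivity)).ne'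
  obtain ⟨s, hs, hsle⟩ := exists_le_setLAverage (μ := volume) (f := φ)
    (s := Icc (5 / 4 * ℓ) (7 / 4 * ℓ)) (by rw [hvol]; exact hv0) (by rw [hvol]; simp)
    hφm.aemeasurable
  refine ⟨s, hs, ?_⟩
  rw [setLAverage_eq, hvol] at hsle
  calc ν (cube x (s + b) \ cube x s) + ∑ j ∈ J, μH[(N : ℝ) - 1] (cubeBdry x s ∩ W j) ≤ φ s := by
        refine add_le_add_right (Finset.sum_le_sum fun j hj => ?_) _
        refine (hausdorffMeasure_cubeBdry_inter_le x s (W j)).trans ?_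
        exact Finset.sum_le_sum fun k _ => add_le_add ((hψ j hj k).2.1 _) ((hψ j hj k).2.1 _)
    _ ≤ _ := hsle
    _ ≤ ENNReal.ofReal (2 * N * K + 1) *
      (ENNReal.ofReal b * ν univ + ∑ j ∈ J, volume (W j)) / ENNReal.ofReal (ℓ / 2) := by
        gcongr
        exact (setLIntegral_le_lintegral _ _).trans hle_int
    _ = _ := by
        rw [mul_comm, mul_div_assoc, mul_comm, ← ENNReal.ofReal_div_of_pos (by positivity)]
        congr 2
        field_simp

theorem densTendsto_congr_of_ae {E F U : Set (Pt N)} {x : Pt N} (hU : U ∈ nhds x)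
    (h : ∀ᵐ z, z ∈ U → (z ∈ E ↔ z ∈ F)) (l : ENNReal) :
    densTendsto E x l ↔ densTendsto F x l := by
  obtain ⟨δ, hδ, hδU⟩ := Metric.mem_nhds_iff.1 hU
  refine tendsto_congr' ?_
  filter_upwards [Ioo_mem_nhdsGT hδ] with r hr
  congr 1
  refine measure_congr ?_
  filter_upwards [h] with z hz
  refine propext ⟨fun h1 => ⟨(hz ?_).1 h1.1, h1.2⟩, fun h1 => ⟨(hz ?_).2 h1.1, h1.2⟩⟩
  · exact hδU (ball_subset_ball hr.2.le h1.2)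
  · exact hδU (ball_subset_ball hr.2.le h1.2)

theorem mem_essBdry_congr {E F U : Set (Pt N)} {x : Pt N} (hU : U ∈ nhds x)
    (h : ∀ᵐ z, z ∈ U → (z ∈ E ↔ z ∈ F)) : x ∈ essBdry E ↔ x ∈ essBdry F := by
  simp only [essBdry, mem_ofPred_eq, densTendsto_congr_of_ae hU h]

theorem essBdry_compl {E : Set (Pt N)} (hE : MeasurableSet E) : essBdry Eᶜ = essBdry E := by
  ext x
  have h1 := densTendsto_compl hE (x := x)
  have h2 := densTendsto_compl hE.compl (x := x)
  rw [compl_compl] at h2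
  simp only [essBdry, mem_ofPred_eq, h1, ← h2]
  exact and_comm

theorem densTendsto_preimage_add (E : Set (Pt N)) (a x : Pt N) (l : ENNReal) :
    densTendsto ((· + a) ⁻¹' E) x l ↔ densTendsto E (x + a) l := by
  refine tendsto_congr fun r => ?_
  have h1 : (· + a) ⁻¹' ball (x + a) r = ball x r := by
    ext z
    simp [mem_ball]
  rw [← h1, ← preimage_inter, measure_preimage_add_right, measure_preimage_add_right]

theorem densTendsto_zero_mono {E F : Set (Pt N)} {x : Pt N} (h : E ⊆ F)
    (hF : densTendsto F x 0) : densTendsto E x 0 :=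
  tendsto_of_tendsto_of_tendsto_of_le_of_le tendsto_const_nhds hF (fun _ => zero_le)
    fun _ => ENNReal.div_le_div_right (measure_mono (inter_subset_inter_left _ h)) _

theorem densTendsto_zero_union {E F : Set (Pt N)} {x : Pt N} (hE : densTendsto E x 0)
    (hF : densTendsto F x 0) : densTendsto (E ∪ F) x 0 := by
  have h := Tendsto.add hE hF
  rw [add_zero] at h
  refine tendsto_of_tendsto_of_tendsto_of_le_of_le tendsto_const_nhds h (fun _ => zero_le)
    fun r => ?_
  simp only
  rw [← ENNReal.add_div, union_inter_distrib_right]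
  exact ENNReal.div_le_div_right (measure_union_le _ _) _

theorem densTendsto_one_of_inter {E F : Set (Pt N)} {x : Pt N} (hEm : MeasurableSet E)
    (hFm : MeasurableSet F) (hE : densTendsto E x 1) (hF : densTendsto F x 1) :
    densTendsto (E ∩ F) x 1 := by
  have h1 : densTendsto Eᶜ x 0 := (densTendsto_compl hEm.compl).1 (by rwa [compl_compl])
  have h2 : densTendsto Fᶜ x 0 := (densTendsto_compl hFm.compl).1 (by rwa [compl_compl])
  have h3 := densTendsto_zero_union h1 h2
  rw [← compl_inter] at h3
  simpa using (densTendsto_compl (hEm.inter hFm).compl).2 h3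

theorem densTendsto_one_mono {E F : Set (Pt N)} {x : Pt N} (h : E ⊆ F) (hEm : MeasurableSet E)
    (hFm : MeasurableSet F) (hE : densTendsto E x 1) : densTendsto F x 1 := by
  have h1 : densTendsto Eᶜ x 0 := (densTendsto_compl hEm.compl).1 (by rwa [compl_compl])
  simpa using (densTendsto_compl hFm.compl).2
    (densTendsto_zero_mono (compl_subset_compl.2 h) h1)

theorem essBdry_union_subset {E F : Set (Pt N)} (hE : MeasurableSet E) (hF : MeasurableSet F) :
    essBdry (E ∪ F) ⊆ essBdry E ∪ essBdry F := by
  intro x hx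
  by_contra h
  simp only [mem_union, not_or, essBdry, mem_ofPred_eq, not_and_or, not_not] at h
  obtain ⟨h1, h2⟩ := h
  rcases h1 with h1 | h1
  · rcases h2 with h2 | h2
    · exact hx.1 (densTendsto_zero_union h1 h2)
    · exact hx.2 (densTendsto_one_mono subset_union_right hF (hE.union hF) h2)
  · exact hx.2 (densTendsto_one_mono subset_union_left hE (hE.union hF) h1)

theorem isOpen_cube_sdiff_cubeBdry (x : Pt N) (s : ℝ) : IsOpen (cube x s \ cubeBdry x s) := by
  have : cube x s \ cubeBdry x s = ⋂ k, {z : Pt N | |z k - x k| < s} := by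
    ext z
    simp only [cubeBdry, cube, Set.mem_sdiff, mem_ofPred_eq, mem_iInter, not_and, not_exists]
    exact ⟨fun h k => lt_of_le_of_ne (h.1 k) (h.2 h.1 k), fun h =>
      ⟨fun k => (h k).le, fun _ k => (h k).ne⟩⟩
  rw [this]
  exact isOpen_iInter_of_finite fun k => isOpen_lt (by fun_prop) continuous_const

/-- The points where `E` and its translate by `-a` fail to be both of density one or both of
density zero. -/
def mismatch (E : Set (Pt N)) (a : Pt N) : Set (Pt N) :=
  {z | ¬ (densTendsto E z 1 ∧ densTendsto E (z + a) 1) ∧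
    ¬ (densTendsto E z 0 ∧ densTendsto E (z + a) 0)}

theorem ae_mismatch [Nontrivial (Pt N)] {E : Set (Pt N)} (hE : MeasurableSet E) (a : Pt N) :
    ∀ᵐ z, z ∈ mismatch E a → ¬ (z ∈ E ↔ z + a ∈ E) := by
  have h := ae_densTendsto hE
  have h2 := (measurePreserving_add_right (volume : Measure (Pt N)) a).quasiMeasurePreserving.ae h
  filter_upwards [h, h2] with z h3 h4 hz hiff
  by_cases hzE : z ∈ E
  · rw [indicator_of_mem hzE] at h3
    rw [indicator_of_mem (hiff.1 hzE)] at h4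
    exact hz.1 ⟨h3, h4⟩
  · rw [indicator_of_notMem hzE] at h3
    rw [indicator_of_notMem (fun h => hzE (hiff.2 h))] at h4
    exact hz.2 ⟨h3, h4⟩

open Classical in
/-- The labelling `c`, translated by `-a` inside `Q`. -/
def shiftIn {m : ℕ} (c : Pt N → Fin (m + 1)) (Q : Set (Pt N)) (a : Pt N) : Pt N → Fin (m + 1) :=
  fun z => if z ∈ Q then c (z + a) else c z

section ShiftIn

variable {m : ℕ} {c : Pt N → Fin (m + 1)}

theorem shiftIn_of_mem {Q : Set (Pt N)} {a z : Pt N} (hz : z ∈ Q) :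
    shiftIn c Q a z = c (z + a) := if_pos hz

theorem shiftIn_of_notMem {Q : Set (Pt N)} {a z : Pt N} (hz : z ∉ Q) :
    shiftIn c Q a z = c z := if_neg hz

theorem measurable_shiftIn (hc : Measurable c) {Q : Set (Pt N)} (hQ : MeasurableSet Q)
    (a : Pt N) : Measurable (shiftIn c Q a) := by
  classical
  exact Measurable.ite hQ (hc.comp (measurable_add_const a)) hc

theorem essBdry_shiftIn_subset (hc : Measurable c) (x a : Pt N) (s : ℝ) (h : Fin (m + 1)) :
    essBdry (shiftIn c (cube x s) a ⁻¹' {h}) ⊆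
      ((· + a) ⁻¹' essBdry (c ⁻¹' {h}) ∩ cube x s) ∪ (essBdry (c ⁻¹' {h}) \ cube x s) ∪
        (cubeBdry x s ∩ mismatch (c ⁻¹' {h}) a) := by
  intro z hz
  set E := c ⁻¹' {h} with hEdef
  have hE : MeasurableSet E := hc (measurableSet_singleton h)
  have hE2 : MeasurableSet ((· + a) ⁻¹' E) := (measurable_add_const a) hE
  set E' := shiftIn c (cube x s) a ⁻¹' {h} with hE'def
  have hE' : MeasurableSet E' :=
    measurable_shiftIn hc (measurableSet_cube x s) a (measurableSet_singleton h)
  by_cases hzQ : z ∈ cube x s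
  · by_cases hzB : z ∈ cubeBdry x s
    · refine Or.inr ⟨hzB, fun h1 => hz.2 ?_, fun h1 => hz.1 ?_⟩
      · refine densTendsto_one_mono ?_ (hE.inter hE2) hE'
          (densTendsto_one_of_inter hE hE2 h1.1 ((densTendsto_preimage_add E a z 1).2 h1.2))
        rintro y ⟨hy1, hy2⟩
        by_cases hyQ : y ∈ cube x s
        · exact (shiftIn_of_mem hyQ).trans hy2
        · exact (shiftIn_of_notMem hyQ).trans hy1
      · refine densTendsto_zero_mono ?_
          (densTendsto_zero_union h1.1 ((densTendsto_preimage_add E a z 0).2 h1.2))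
        intro y hy
        by_cases hyQ : y ∈ cube x s
        · exact Or.inr ((shiftIn_of_mem hyQ).symm.trans hy)
        · exact Or.inl ((shiftIn_of_notMem hyQ).symm.trans hy)
    · refine Or.inl (Or.inl ⟨?_, hzQ⟩)
      have h1 : z ∈ essBdry ((· + a) ⁻¹' E) := by
        refine (mem_essBdry_congr
          ((isOpen_cube_sdiff_cubeBdry x s).mem_nhds ⟨hzQ, hzB⟩) ?_).1 hz
        refine Eventually.of_forall fun y hy => ?_
        simp only [hE'def, hEdef, mem_preimage, shiftIn_of_mem hy.1]
      simpa only [essBdry, mem_ofPred_eq, mem_preimage, densTendsto_preimage_add] using h1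
  · refine Or.inl (Or.inr ⟨?_, hzQ⟩)
    refine (mem_essBdry_congr ((isClosed_cube x s).isOpen_compl.mem_nhds hzQ) ?_).1 hz
    refine Eventually.of_forall fun y hy => ?_
    simp only [hE'def, hEdef, mem_preimage, shiftIn_of_notMem hy]

theorem hausdorffMeasure_essBdry_inter_le (h : Fin (m + 1)) {A : Set (Pt N)}
    (hA : MeasurableSet A) : μH[(N : ℝ) - 1] (essBdry (c ⁻¹' {h}) ∩ A) ≤ bdryMeas c A := by
  rw [bdryMeas, Measure.restrict_apply hA, inter_comm A]
  exact measure_mono (inter_subset_inter_left _ (subset_iUnion_of_subset h subset_rfl))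

theorem setLIntegral_essBdry_inter_le (h : Fin (m + 1)) {A : Set (Pt N)} (hA : MeasurableSet A)
    {G : Pt N → ENNReal} {κ : ENNReal} (hG : ∀ z ∈ A, G z ≤ κ) :
    ∫⁻ z in essBdry (c ⁻¹' {h}) ∩ A, G z ∂μH[(N : ℝ) - 1] ≤ κ * bdryMeas c A := by
  calc ∫⁻ z in essBdry (c ⁻¹' {h}) ∩ A, G z ∂μH[(N : ℝ) - 1]
      ≤ ∫⁻ z in essBdry (c ⁻¹' {h}) ∩ A, κ ∂μH[(N : ℝ) - 1] :=
        setLIntegral_mono measurable_const fun z hz => hG z hz.2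
    _ = κ * μH[(N : ℝ) - 1] (essBdry (c ⁻¹' {h}) ∩ A) := setLIntegral_const _ _
    _ ≤ _ := mul_le_mul_right (hausdorffMeasure_essBdry_inter_le h hA) _

/-- The perimeter cost, in a single chamber, of translating the labelling inside a cube. -/
theorem lintegral_essBdry_shiftIn_le (hc : Measurable c) {x a : Pt N} {s b : ℝ} (hab : ‖a‖ ≤ b)
    {B W : Set (Pt N)} (hB : cube x (s + b) ⊆ B) (h : Fin (m + 1))
    (hW : cubeBdry x s ∩ mismatch (c ⁻¹' {h}) a ⊆ W)
    {G : Pt N → ENNReal} (hGm : Measurable G) {κ ω : ENNReal} (hG : ∀ z ∈ cube x (s + b), G z ≤ κ)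
    (hω : ∀ z ∈ cube x s, G z ≤ G (z + a) + ω) :
    ∫⁻ z in essBdry (shiftIn c (cube x s) a ⁻¹' {h}) ∩ B, G z ∂μH[(N : ℝ) - 1] ≤
      (∫⁻ z in essBdry (c ⁻¹' {h}) ∩ B, G z ∂μH[(N : ℝ) - 1]) + (ω * bdryMeas c (cube x (s + b)) +
        κ * (bdryMeas c (cube x (s + b) \ cube x s) +
          μH[(N : ℝ) - 1] (cubeBdry x s ∩ W))) := by
  set E := c ⁻¹' {h} with hEdef
  set ν : Measure (Pt N) := μH[(N : ℝ) - 1] with hν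
  have hb : 0 ≤ b := (norm_nonneg a).trans hab
  have hsub : cube x s ⊆ cube x (s + b) := cube_mono x (by linarith)
  have hmS : MeasurableSet (cube x (s + b) \ cube x s) :=
    (measurableSet_cube _ _).diff (measurableSet_cube _ _)
  have h1 : ∫⁻ z in (· + a) ⁻¹' essBdry E ∩ cube x s, G z ∂ν ≤
      (∫⁻ z in essBdry E ∩ cube x s, G z ∂ν) + κ * bdryMeas c (cube x (s + b) \ cube x s) +
        ω * bdryMeas c (cube x (s + b)) := by
    have hmp : MeasurePreserving (· + a) ν ν :=
      (IsometryEquiv.addRight a).measurePreserving_hausdorffMeasure _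
    have hme : MeasurableEmbedding (fun z : Pt N => z + a) :=
      (MeasurableEquiv.addRight a).measurableEmbedding
    set T : Set (Pt N) := essBdry E ∩ {y | y - a ∈ cube x s} with hT
    have hpre : (· + a) ⁻¹' essBdry E ∩ cube x s = (fun z => z + a) ⁻¹' T := by
      ext z
      simp [hT]
    have hTsub : T ⊆ essBdry E ∩ cube x (s + b) := by
      rintro y ⟨hy1, hy2⟩
      refine ⟨hy1, ?_⟩
      have := mem_cube_trans hy2 (cube_mono _ hab (add_mem_cube (y - a) a))
      simpa using this
    calc ∫⁻ z in (· + a) ⁻¹' essBdry E ∩ cube x s, G z ∂ν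
        ≤ ∫⁻ z in (· + a) ⁻¹' essBdry E ∩ cube x s, (G (z + a) + ω) ∂ν :=
          setLIntegral_mono ((hGm.comp (measurable_add_const a)).add_const _)
            fun z hz => hω z hz.2
      _ = ∫⁻ z in T, (G z + ω) ∂ν := by
          rw [hpre]
          exact hmp.setLIntegral_comp_preimage_emb hme (fun y => G y + ω) T
      _ ≤ ∫⁻ z in essBdry E ∩ cube x (s + b), (G z + ω) ∂ν := lintegral_mono_set hTsub
      _ = (∫⁻ z in essBdry E ∩ cube x (s + b), G z ∂ν) +
          ω * ν (essBdry E ∩ cube x (s + b)) := by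
          rw [lintegral_add_right _ measurable_const, setLIntegral_const]
      _ ≤ _ := by
          refine add_le_add ?_ (mul_le_mul_right
            (hausdorffMeasure_essBdry_inter_le h (measurableSet_cube _ _)) _)
          rw [← lintegral_inter_add_sdiff G (essBdry E ∩ cube x (s + b)) (measurableSet_cube x s)]
          refine add_le_add (lintegral_mono_set fun z hz => ⟨hz.1.1, hz.2⟩) ?_
          rw [inter_sdiff_assoc]
          exact setLIntegral_essBdry_inter_le h hmS fun z hz => hG z hz.1
  have h2 : ∫⁻ z in cubeBdry x s ∩ W, G z ∂ν ≤ κ * ν (cubeBdry x s ∩ W) := by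
    refine (setLIntegral_mono measurable_const fun z hz => ?_).trans (setLIntegral_const _ _).le
    exact hG z (hsub hz.1.1)
  have hQB : cube x s ⊆ B := hsub.trans hB
  calc ∫⁻ z in essBdry (shiftIn c (cube x s) a ⁻¹' {h}) ∩ B, G z ∂ν
      ≤ ∫⁻ z in (((· + a) ⁻¹' essBdry E ∩ cube x s) ∪ ((essBdry E ∩ B) \ cube x s)) ∪
        (cubeBdry x s ∩ W), G z ∂ν := by
        refine lintegral_mono_set ?_
        rintro z ⟨hz, hzB⟩
        rcases essBdry_shiftIn_subset hc x a s h hz with (h3 | h3) | h3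
        · exact Or.inl (Or.inl h3)
        · exact Or.inl (Or.inr ⟨⟨h3.1, hzB⟩, h3.2⟩)
        · exact Or.inr ⟨h3.1, hW h3⟩
    _ ≤ (∫⁻ z in (· + a) ⁻¹' essBdry E ∩ cube x s, G z ∂ν) +
        (∫⁻ z in (essBdry E ∩ B) \ cube x s, G z ∂ν) + ∫⁻ z in cubeBdry x s ∩ W, G z ∂ν :=
        (lintegral_union_le _ _ _).trans (add_le_add_left (lintegral_union_le _ _ _) _)
    _ ≤ ((∫⁻ z in essBdry E ∩ cube x s, G z ∂ν) + κ * bdryMeas c (cube x (s + b) \ cube x s) +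
        ω * bdryMeas c (cube x (s + b))) + (∫⁻ z in (essBdry E ∩ B) \ cube x s, G z ∂ν) +
        κ * ν (cubeBdry x s ∩ W) := by gcongr
    _ = ((∫⁻ z in essBdry E ∩ B ∩ cube x s, G z ∂ν) + ∫⁻ z in (essBdry E ∩ B) \ cube x s, G z ∂ν) +
        (ω * bdryMeas c (cube x (s + b)) + κ * (bdryMeas c (cube x (s + b) \ cube x s) +
          ν (cubeBdry x s ∩ W))) := by
        rw [inter_assoc, inter_eq_self_of_subset_right hQB]
        ring
    _ = _ := by rw [lintegral_inter_add_sdiff _ _ (measurableSet_cube x s)]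

end ShiftIn

section FineMove

variable {m : ℕ} {c : Pt N → Fin (m + 1)}

/-- The signed fractions `± (k / n) • w` of a vector. -/
def fracShift (n : ℕ) (w : Pt N) (p : Bool × Fin (n + 1)) : Pt N :=
  (if p.1 then ((p.2 : ℕ) : ℝ) / n else -(((p.2 : ℕ) : ℝ) / n)) • w

theorem norm_fracShift_le (n : ℕ) (w : Pt N) (p : Bool × Fin (n + 1)) :
    ‖fracShift n w p‖ ≤ ‖w‖ := by
  have h1 : ((p.2 : ℕ) : ℝ) / n ≤ 1 :=
    div_le_one_of_le₀ (by exact_mod_cast Nat.lt_succ_iff.1 p.2.2) (by positivity)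
  have h2 : |if p.1 then ((p.2 : ℕ) : ℝ) / n else -(((p.2 : ℕ) : ℝ) / n)| ≤ 1 := by
    split_ifs
    · rwa [abs_of_nonneg (by positivity)]
    · rwa [abs_neg, abs_of_nonneg (by positivity)]
  rw [fracShift, norm_smul, Real.norm_eq_abs]
  exact mul_le_of_le_one_left (norm_nonneg _) h2

theorem volume_cube_inter_shift_ne_le (hN : 2 ≤ N) (hc : Measurable c) (x a : Pt N) {s t : ℝ}
    (h : s + ‖a‖ ≤ t) : volume (cube x s ∩ {z | c (z + a) ≠ c z}) ≤
      ENNReal.ofReal (tubeConst N * ‖a‖) * bdryMeas c (cube x t) := by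
  refine volume_ne_shift_le hN hc a (measurableSet_cube x t) fun z hz r hr => ?_
  refine cube_mono x h (mem_cube_trans hz (cube_mono z ?_ (add_mem_cube z (r • a))))
  rw [norm_smul, Real.norm_of_nonneg hr.1]
  exact mul_le_of_le_one_left (norm_nonneg _) hr.2

theorem volume_cube_inter_mismatch_le (hN : 2 ≤ N) (hc : Measurable c) (x a : Pt N) {s t : ℝ}
    (h : s + ‖a‖ ≤ t) (k : Fin (m + 1)) : volume (cube x s ∩ mismatch (c ⁻¹' {k}) a) ≤
      ENNReal.ofReal (tubeConst N * ‖a‖) * bdryMeas c (cube x t) := by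
  have : NeZero N := ⟨by omega⟩
  refine le_trans (measure_mono_ae ?_) (volume_cube_inter_shift_ne_le hN hc x a h)
  filter_upwards [ae_mismatch (hc (measurableSet_singleton k)) a] with z hz
  rintro ⟨h1, h2⟩
  refine ⟨h1, fun h3 => hz h2 ?_⟩
  simp only [mem_preimage, h3]

/-- A cube may be chosen so that all the fractional translations inside it have small
perimeter cost in every chamber. -/
theorem exists_shift_cube (hN : 2 ≤ N) : ∃ K : ℝ, 0 < K ∧ ∀ {m : ℕ} {c : Pt N → Fin (m + 1)},
    Measurable c → bdryMeas c univ ≠ ⊤ →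
    ∀ (x w : Pt N) (ℓ P A ω : ℝ) (n : ℕ) (G : Pt N → ENNReal), 0 < ℓ → ‖w‖ ≤ ℓ / 4 → 0 ≤ P →
      0 ≤ A → 0 ≤ ω → Measurable G → bdryMeas c (cube x (8 * ℓ)) ≤ ENNReal.ofReal P →
      (∀ z ∈ cube x (2 * ℓ), G z ≤ ENNReal.ofReal A) →
      (∀ z ∈ cube x (2 * ℓ), ∀ a : Pt N, ‖a‖ ≤ ‖w‖ → G z ≤ G (z + a) + ENNReal.ofReal ω) →
      ∃ s ∈ Icc (5 / 4 * ℓ) (7 / 4 * ℓ), ∀ (p : Bool × Fin (n + 1)) (h : Fin (m + 1))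
        (B : Set (Pt N)), cube x (2 * ℓ) ⊆ B →
        ∫⁻ z in essBdry (shiftIn c (cube x s) (fracShift n w p) ⁻¹' {h}) ∩ B, G z
          ∂μH[(N : ℝ) - 1] ≤ (∫⁻ z in essBdry (c ⁻¹' {h}) ∩ B, G z ∂μH[(N : ℝ) - 1]) +
            ENNReal.ofReal (P * (ω + K * (A * (‖w‖ / ℓ)) *
              (1 + 2 * (n + 1) * (m + 1) * tubeConst N))) := by
  obtain ⟨K, hK, hgood⟩ := exists_good_radius (N := N) (by omega)
  refine ⟨K, hK, ?_⟩
  intro m c hc hM x w ℓ P A ω n G hℓ hw hP hA hω hG hμ hGA hGω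
  have hfin : IsFiniteMeasure (bdryMeas c) := ⟨hM.lt_top⟩
  have hCB : 0 < tubeConst N := tubeConst_pos
  set W : (Bool × Fin (n + 1)) × Fin (m + 1) → Set (Pt N) := fun q =>
    toMeasurable volume (cube x (2 * ℓ) ∩ mismatch (c ⁻¹' {q.2}) (fracShift n w q.1)) with hW
  obtain ⟨s, hs, hsle⟩ := hgood ((bdryMeas c).restrict (cube x (8 * ℓ))) x ℓ ‖w‖ Finset.univ W hℓ
    (fun _ _ => measurableSet_toMeasurable _ _)
  refine ⟨s, hs, fun p h B hB => ?_⟩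
  have hsw : s + ‖w‖ ≤ 2 * ℓ := by linarith [hs.2]
  have hs0 : 0 ≤ s := by linarith [hs.1]
  have hvol : ∀ q, volume (W q) ≤ ENNReal.ofReal (tubeConst N * ‖w‖ * P) := by
    intro q
    have hq := norm_fracShift_le n w q.1
    rw [hW, measure_toMeasurable, ENNReal.ofReal_mul (by positivity)]
    refine (volume_cube_inter_mismatch_le hN hc x _ (t := 8 * ℓ) (by linarith) _).trans ?_
    exact mul_le_mul' (ENNReal.ofReal_le_ofReal (by gcongr)) hμ
  have hsum : ∑ q, volume (W q) ≤
      ENNReal.ofReal (2 * (n + 1) * (m + 1) * (tubeConst N * ‖w‖ * P)) := by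
    refine (Finset.sum_le_sum fun q _ => hvol q).trans ?_
    rw [Finset.sum_const, Finset.card_univ, nsmul_eq_mul, Fintype.card_prod, Fintype.card_prod,
      Fintype.card_bool, Fintype.card_fin, Fintype.card_fin, ← ENNReal.ofReal_natCast,
      ← ENNReal.ofReal_mul (by positivity)]
    push_cast
    exact le_rfl
  have hsub : cube x (s + ‖w‖) ⊆ cube x (8 * ℓ) := cube_mono x (by linarith)
  have hmain := lintegral_essBdry_shiftIn_le hc (norm_fracShift_le n w p)
    ((cube_mono x hsw).trans hB) h (W := W (p, h)) (κ := ENNReal.ofReal A)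
    (ω := ENNReal.ofReal ω) (s := s) ?_ hG (fun z hz => hGA z (cube_mono x hsw hz))
    (fun z hz => hGω z (cube_mono x (by linarith [norm_nonneg w]) hz) _ (norm_fracShift_le n w p))
  · refine hmain.trans (add_le_add_right ?_ _)
    have h1 : bdryMeas c (cube x (s + ‖w‖) \ cube x s) +
        μH[(N : ℝ) - 1] (cubeBdry x s ∩ W (p, h)) ≤ ENNReal.ofReal (K / ℓ *
          (‖w‖ * P + 2 * (n + 1) * (m + 1) * (tubeConst N * ‖w‖ * P))) := by
      have h2 : bdryMeas c (cube x (s + ‖w‖) \ cube x s) =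
          (bdryMeas c).restrict (cube x (8 * ℓ)) (cube x (s + ‖w‖) \ cube x s) := by
        rw [Measure.restrict_apply ((measurableSet_cube _ _).diff (measurableSet_cube _ _)),
          inter_eq_self_of_subset_left (sdiff_subset.trans hsub)]
      rw [h2]
      refine le_trans (add_le_add_right ?_ _) (hsle.trans ?_)
      · exact Finset.single_le_sum (f := fun q => μH[(N : ℝ) - 1] (cubeBdry x s ∩ W q))
          (fun _ _ => zero_le) (Finset.mem_univ (p, h))
      · rw [ENNReal.ofReal_mul (by positivity), ENNReal.ofReal_add (by positivity) (by positivity),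
          ENNReal.ofReal_mul (p := ‖w‖) (by positivity), Measure.restrict_apply_univ]
        gcongr
    calc ENNReal.ofReal ω * bdryMeas c (cube x (s + ‖w‖)) + ENNReal.ofReal A *
          (bdryMeas c (cube x (s + ‖w‖) \ cube x s) + μH[(N : ℝ) - 1] (cubeBdry x s ∩ W (p, h)))
        ≤ ENNReal.ofReal ω * ENNReal.ofReal P + ENNReal.ofReal A * ENNReal.ofReal (K / ℓ *
          (‖w‖ * P + 2 * (n + 1) * (m + 1) * (tubeConst N * ‖w‖ * P))) :=
          add_le_add (mul_le_mul_right ((measure_mono hsub).trans hμ) _) (mul_le_mul_right h1 _)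
      _ = _ := by
          rw [← ENNReal.ofReal_mul hω, ← ENNReal.ofReal_mul hA,
            ← ENNReal.ofReal_add (by positivity) (by positivity)]
          congr 1
          field_simp
  · rintro z ⟨hz1, hz2⟩
    exact subset_toMeasurable _ _ ⟨cube_mono x (by linarith [norm_nonneg w]) hz1.1, hz2⟩

theorem exists_fraction_near {τ : ℕ → ℝ} {n : ℕ} {t T δ : ℝ} (h0 : τ 0 = 0)
    (hstep : ∀ k < n, τ (k + 1) ≤ τ k + δ) (hT : T ≤ τ n) (ht0 : 0 ≤ t) (htT : t ≤ T)
    (hδ : 0 ≤ δ) : ∃ k ≤ n, |τ k - t| ≤ δ := by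
  classical
  have hex : ∃ k, t ≤ τ k := ⟨n, htT.trans hT⟩
  have hkn : Nat.find hex ≤ n := Nat.find_min' hex (htT.trans hT)
  have hk := Nat.find_spec hex
  refine ⟨Nat.find hex, hkn, ?_⟩
  rw [abs_of_nonneg (by linarith)]
  rcases Nat.eq_zero_or_pos (Nat.find hex) with h | h
  · rw [h, h0]
    linarith
  · obtain ⟨k, hk'⟩ := Nat.exists_eq_add_of_lt h
    rw [zero_add] at hk'
    have h1 := Nat.find_min hex (m := k) (by omega)
    have h2 := hstep k (by omega)
    rw [hk']
    push Not at h1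
    linarith

/-- Translations by suitable fractions of `w` inside `Q` transfer a prescribed volume from the
chamber `i` to the chamber `j`, up to a small error. -/
theorem exists_shift_transfer (ν : Measure (Pt N)) (hc : Measurable c) {Q : Set (Pt N)}
    (hQ : MeasurableSet Q) (hνQ : ν Q ≠ ⊤) {i j : Fin (m + 1)} (hij : i ≠ j) {n : ℕ} (hn : 0 < n)
    (w : Pt N) {T δ : ℝ} (hδ : 0 ≤ δ)
    (h1 : ENNReal.ofReal T ≤ ν (Q ∩ {z | c z = i ∧ c (z + w) = j}))
    (h2 : ∀ k ≤ n, ν (Q ∩ {z | c z ≠ c (z + ((k : ℝ) / n) • w) ∧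
      ¬ (c z = i ∧ c (z + ((k : ℝ) / n) • w) = j)}) ≤ ENNReal.ofReal δ)
    (h3 : ∀ k < n, ν (Q ∩ {z | c (z + ((k : ℝ) / n) • w) ≠ c (z + (((k + 1 : ℕ) : ℝ) / n) • w)}) ≤
      ENNReal.ofReal δ) {t : ℝ} (ht0 : 0 ≤ t) (htT : t ≤ T) :
    ∃ k ≤ n, ∀ h, |ν.real (shiftIn c Q (((k : ℝ) / n) • w) ⁻¹' {h} ∩ Q) - ν.real (c ⁻¹' {h} ∩ Q) -
      t * ((if h = j then 1 else 0) - (if h = i then 1 else 0))| ≤ 2 * δ := by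
  have hfin : ∀ U : Set (Pt N), ν (Q ∩ U) ≠ ⊤ := fun U =>
    ne_top_of_le_ne_top hνQ (measure_mono inter_subset_left)
  have hreal : ∀ U : Set (Pt N), ν (Q ∩ U) ≤ ENNReal.ofReal δ → ν.real (Q ∩ U) ≤ δ := fun U hU =>
    ENNReal.toReal_le_of_le_ofReal hδ hU
  set tr : ℕ → Set (Pt N) := fun k => {z | c z = i ∧ c (z + ((k : ℝ) / n) • w) = j} with htr
  set bad : ℕ → Set (Pt N) := fun k => {z | c z ≠ c (z + ((k : ℝ) / n) • w) ∧
    ¬ (c z = i ∧ c (z + ((k : ℝ) / n) • w) = j)} with hbad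
  have hcs : ∀ (a : Pt N) (h : Fin (m + 1)), MeasurableSet {z | c (z + a) = h} := fun a h =>
    (hc.comp (measurable_add_const a)) (measurableSet_singleton h)
  have hc0 : ∀ h : Fin (m + 1), MeasurableSet {z | c z = h} := fun h =>
    hc (measurableSet_singleton h)
  have htrm : ∀ k, MeasurableSet (tr k) := fun k => (hc0 i).inter (hcs _ j)
  have hn0 : (n : ℝ) ≠ 0 := by positivity
  have e0 : ν.real (Q ∩ tr 0) = 0 := by
    have : tr 0 = ∅ := by
      ext z
      simp only [htr, Nat.cast_zero, zero_div, zero_smul, add_zero, mem_ofPred_eq,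
        mem_empty_iff_false, iff_false, not_and]
      exact fun h => by rw [h]; exact hij
    simp [this]
  have estep : ∀ k < n, ν.real (Q ∩ tr (k + 1)) ≤ ν.real (Q ∩ tr k) + δ := by
    intro k hk
    have : Q ∩ tr (k + 1) ⊆ (Q ∩ tr k) ∪
        (Q ∩ {z | c (z + ((k : ℝ) / n) • w) ≠ c (z + (((k + 1 : ℕ) : ℝ) / n) • w)}) := by
      rintro z ⟨hzQ, hz⟩
      by_cases hz' : c (z + ((k : ℝ) / n) • w) = c (z + (((k + 1 : ℕ) : ℝ) / n) • w)
      · exact Or.inl ⟨hzQ, hz.1, hz'.trans hz.2⟩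
      · exact Or.inr ⟨hzQ, hz'⟩
    refine (measureReal_mono this ?_).trans ((measureReal_union_le _ _).trans
      (add_le_add_right (hreal _ (h3 k hk)) _))
    rw [← inter_union_distrib_left]
    exact hfin _
  have eT : T ≤ ν.real (Q ∩ tr n) := by
    have : tr n = {z | c z = i ∧ c (z + w) = j} := by
      simp only [htr, div_self hn0, one_smul]
    rw [this]
    exact (ENNReal.ofReal_le_iff_le_toReal (hfin _)).1 h1
  obtain ⟨k, hkn, hk⟩ :=
    exists_fraction_near (τ := fun k => ν.real (Q ∩ tr k)) e0 estep eT ht0 htT hδ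
  refine ⟨k, hkn, fun h => ?_⟩
  set a : Pt N := ((k : ℝ) / n) • w with ha
  have hS : shiftIn c Q a ⁻¹' {h} ∩ Q = Q ∩ {z | c (z + a) = h} := by
    ext z
    refine ⟨fun hz => ⟨hz.2, ?_⟩, fun hz => ⟨?_, hz.1⟩⟩
    · exact (shiftIn_of_mem hz.2).symm.trans hz.1
    · exact (shiftIn_of_mem hz.1).trans hz.2
  have hC : c ⁻¹' {h} ∩ Q = Q ∩ {z | c z = h} := by
    rw [inter_comm]; rfl
  rw [hS, hC]
  have hb := hreal _ (h2 k hkn)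
  have hle2 : ∀ U V : Set (Pt N), U ⊆ V ∪ bad k →
      ν.real (Q ∩ U) ≤ ν.real (Q ∩ V) + δ := by
    intro U V hUV
    have : Q ∩ U ⊆ (Q ∩ V) ∪ (Q ∩ bad k) := by
      rw [← inter_union_distrib_left]
      exact inter_subset_inter_right _ hUV
    refine (measureReal_mono this ?_).trans ((measureReal_union_le _ _).trans
      (add_le_add_right hb _))
    rw [← inter_union_distrib_left]
    exact hfin _
  have hle3 : ∀ U V : Set (Pt N), ν.real (Q ∩ (U ∪ V)) ≤ ν.real (Q ∩ U) + ν.real (Q ∩ V) := by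
    intro U V
    rw [inter_union_distrib_left]
    exact measureReal_union_le _ _
  have heq : ∀ U V : Set (Pt N), MeasurableSet V → Disjoint U V →
      ν.real (Q ∩ (U ∪ V)) = ν.real (Q ∩ U) + ν.real (Q ∩ V) := by
    intro U V hV hd
    rw [inter_union_distrib_left]
    exact measureReal_union (hd.mono inter_subset_right inter_subset_right) (hQ.inter hV)
      (hfin _) (hfin _)
  have hcov1 : {z | c (z + a) = h} ⊆ ({z | c z = h} ∪ tr k) ∪ bad k := by
    intro z hz
    by_cases hzt : z ∈ tr k
    · exact Or.inl (Or.inr hzt)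
    by_cases hzc : c z = c (z + a)
    · exact Or.inl (Or.inl (hzc.trans hz))
    · exact Or.inr ⟨hzc, hzt⟩
  have hcov2 : {z | c z = h} ⊆ ({z | c (z + a) = h} ∪ tr k) ∪ bad k := by
    intro z hz
    by_cases hzt : z ∈ tr k
    · exact Or.inl (Or.inr hzt)
    by_cases hzc : c z = c (z + a)
    · exact Or.inl (Or.inl (hzc.symm.trans hz))
    · exact Or.inr ⟨hzc, hzt⟩
  have hk' := abs_le.1 hk
  by_cases hhj : h = j
  · have hhi : h ≠ i := fun e => hij (e.symm.trans hhj)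
    rw [if_pos hhj, if_neg hhi, abs_le]
    have e1 := (hle2 _ _ hcov1).trans (add_le_add_left (hle3 _ _) _)
    have e2 : ν.real (Q ∩ ({z | c z = h} ∪ tr k)) ≤ ν.real (Q ∩ {z | c (z + a) = h}) + δ := by
      refine hle2 _ _ (union_subset (fun z hz => ?_) fun z hz => Or.inl (hz.2.trans hhj.symm))
      by_cases hzc : c z = c (z + a)
      · exact Or.inl (hzc.symm.trans hz)
      · exact Or.inr ⟨hzc, fun h' => hhi ((show c z = h from hz).symm.trans h'.1)⟩
    rw [heq _ _ (htrm k) ?_] at e2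
    · constructor <;> linarith
    · exact Set.disjoint_left.2 fun z hz hz' => hhi ((show c z = h from hz).symm.trans hz'.1)
  · by_cases hhi : h = i
    · rw [if_neg hhj, if_pos hhi, abs_le]
      have e1 := (hle2 _ _ hcov2).trans (add_le_add_left (hle3 _ _) _)
      have e2 : ν.real (Q ∩ ({z | c (z + a) = h} ∪ tr k)) ≤ ν.real (Q ∩ {z | c z = h}) + δ := by
        refine hle2 _ _ (union_subset (fun z hz => ?_) fun z hz => Or.inl (hz.1.trans hhi.symm))
        by_cases hzc : c z = c (z + a)
        · exact Or.inl (hzc.trans hz)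
        · exact Or.inr ⟨hzc, fun h' => hhj ((show c (z + a) = h from hz).symm.trans h'.2)⟩
      rw [heq _ _ (htrm k) ?_] at e2
      · constructor <;> linarith
      · exact Set.disjoint_left.2 fun z hz hz' =>
          hhj ((show c (z + a) = h from hz).symm.trans hz'.2)
    · rw [if_neg hhj, if_neg hhi, abs_le]
      have e1 : ν.real (Q ∩ {z | c (z + a) = h}) ≤ ν.real (Q ∩ {z | c z = h}) + δ := by
        refine hle2 _ _ fun z hz => ?_
        by_cases hzc : c z = c (z + a)
        · exact Or.inl (hzc.trans hz)
        · exact Or.inr ⟨hzc, fun h' => hhj ((show c (z + a) = h from hz).symm.trans h'.2)⟩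
      have e2 : ν.real (Q ∩ {z | c z = h}) ≤ ν.real (Q ∩ {z | c (z + a) = h}) + δ := by
        refine hle2 _ _ fun z hz => ?_
        by_cases hzc : c z = c (z + a)
        · exact Or.inl (hzc.symm.trans hz)
        · exact Or.inr ⟨hzc, fun h' => hhi ((show c z = h from hz).symm.trans h'.1)⟩
      constructor <;> linarith

end FineMove

section FineTransfer

variable {m : ℕ} {c : Pt N → Fin (m + 1)}

theorem volume_le_of_add_mem {U V : Set (Pt N)} (b : Pt N) (h : ∀ z ∈ U, z + b ∈ V) :
    volume U ≤ volume V := by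
  rw [← measure_preimage_add_right volume b V]
  exact measure_mono h

theorem le_volume_of_add_mem {U V : Set (Pt N)} (b : Pt N) (h : ∀ z, z + b ∈ U → z ∈ V) :
    volume U ≤ volume V := by
  rw [← measure_preimage_add_right volume b U]
  exact measure_mono fun z hz => h z hz

theorem volume_consecutive_ne_le (hN : 2 ≤ N) (hc : Measurable c) (x u : Pt N) {ℓ s : ℝ}
    (hℓ : 0 < ℓ) (hu : ‖u‖ ≤ ℓ / 4) (hs : s ≤ 7 / 4 * ℓ) {n k : ℕ} (hk : k < n) :
    volume (cube x s ∩ {z | c (z + ((k : ℝ) / n) • u) ≠ c (z + (((k + 1 : ℕ) : ℝ) / n) • u)}) ≤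
      ENNReal.ofReal (tubeConst N * (‖u‖ / n)) * bdryMeas c (cube x (8 * ℓ)) := by
  have hn : (0 : ℝ) < n := by exact_mod_cast (by omega : 0 < n)
  set d : Pt N := ((n : ℝ)⁻¹) • u with hd
  have hdn : ‖d‖ = ‖u‖ / n := by
    rw [hd, norm_smul, Real.norm_of_nonneg (by positivity), div_eq_inv_mul]
  have hdu : ‖d‖ ≤ ‖u‖ := by
    rw [hdn]
    exact div_le_self (norm_nonneg _) (by exact_mod_cast (by omega : 1 ≤ n))
  rw [← hdn]
  refine le_trans ?_ (volume_cube_inter_shift_ne_le hN hc x d (s := 2 * ℓ) (by linarith))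
  refine volume_le_of_add_mem (((k : ℝ) / n) • u) ?_
  rintro z ⟨hz1, hz2⟩
  have hk1 : (k : ℝ) / n ≤ 1 := div_le_one_of_le₀ (by exact_mod_cast hk.le) hn.le
  have hku : ‖((k : ℝ) / n) • u‖ ≤ ‖u‖ := by
    rw [norm_smul, Real.norm_of_nonneg (by positivity)]
    exact mul_le_of_le_one_left (norm_nonneg _) hk1
  refine ⟨?_, ?_⟩
  · exact cube_mono x (by linarith) (mem_cube_trans hz1 (add_mem_cube z _))
  · rw [mem_ofPred_eq]
    have : z + ((k : ℝ) / n) • u + d = z + (((k + 1 : ℕ) : ℝ) / n) • u := by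
      rw [hd]
      push_cast
      module
    rw [this]
    exact fun h => hz2 h.symm

theorem exists_fracShift_transfer (hN : 2 ≤ N) (hc : Measurable c) (ν : Measure (Pt N))
    {x w : Pt N} {ℓ s a A : ℝ} {n : ℕ} (hn : 0 < n) (hℓ : 0 < ℓ) (hw : ‖w‖ ≤ ℓ / 4)
    (hs : s ∈ Icc (5 / 4 * ℓ) (7 / 4 * ℓ)) {i j : Fin (m + 1)} (hij : i ≠ j) {T δ : ℝ}
    (hδ : 0 ≤ δ)
    (hνA : ∀ U ⊆ cube x (2 * ℓ), ν U ≤ ENNReal.ofReal A * volume U)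
    (hνa : ∀ U ⊆ cube x (2 * ℓ), ENNReal.ofReal a * volume U ≤ ν U)
    (h1 : ENNReal.ofReal T ≤
      ENNReal.ofReal a * volume {z | z ∈ cube x ℓ ∧ c z = i ∧ c (z + w) = j})
    (h2 : ∀ k ≤ n, ENNReal.ofReal A * volume {z | z ∈ cube x (2 * ℓ) ∧
      c z ≠ c (z + ((k : ℝ) / n) • w) ∧ ¬ (c z = i ∧ c (z + ((k : ℝ) / n) • w) = j)} ≤
        ENNReal.ofReal δ)
    (h3 : ENNReal.ofReal A * (ENNReal.ofReal (tubeConst N * (‖w‖ / n)) *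
      bdryMeas c (cube x (8 * ℓ))) ≤ ENNReal.ofReal δ) {t : ℝ} (ht : |t| ≤ T) :
    ∃ p : Bool × Fin (n + 1), ∀ h,
      |ν.real (shiftIn c (cube x s) (fracShift n w p) ⁻¹' {h} ∩ cube x s) -
        ν.real (c ⁻¹' {h} ∩ cube x s) -
        t * ((if h = j then 1 else 0) - (if h = i then 1 else 0))| ≤ 2 * δ := by
  have hQs : cube x s ⊆ cube x (2 * ℓ) := cube_mono x (by linarith [hs.2])
  have hQm := measurableSet_cube x s
  have hνQ : ν (cube x s) ≠ ⊤ := by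
    refine ne_top_of_le_ne_top ?_ (hνA _ hQs)
    refine ENNReal.mul_ne_top ENNReal.ofReal_ne_top ?_
    rw [volume_cube x (by linarith [hs.1])]
    exact ENNReal.ofReal_ne_top
  have hQi : ∀ U : Set (Pt N), ν (cube x s ∩ U) ≤ ENNReal.ofReal A * volume (cube x s ∩ U) :=
    fun U => hνA _ (inter_subset_left.trans hQs)
  have hQi' : ∀ U : Set (Pt N), ENNReal.ofReal a * volume (cube x s ∩ U) ≤ ν (cube x s ∩ U) :=
    fun U => hνa _ (inter_subset_left.trans hQs)
  rcases le_total 0 t with ht0 | ht0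
  · rw [abs_of_nonneg ht0] at ht
    have key := exists_shift_transfer ν hc hQm hνQ hij hn w (T := T) hδ ?_ ?_ ?_ ht0 ht
    · obtain ⟨k, hkn, hk⟩ := key
      exact ⟨(true, ⟨k, by omega⟩), hk⟩
    · refine h1.trans (le_trans (mul_le_mul_right (measure_mono ?_) _) (hQi' _))
      rintro z ⟨hz1, hz2⟩
      exact ⟨cube_mono x (by linarith [hs.1]) hz1, hz2⟩
    · intro k hk
      refine (hQi _).trans (le_trans (mul_le_mul_right (measure_mono ?_) _) (h2 k hk))
      rintro z ⟨hz1, hz2⟩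
      exact ⟨hQs hz1, hz2⟩
    · intro k hk
      refine (hQi _).trans (le_trans (mul_le_mul_right ?_ _) h3)
      exact volume_consecutive_ne_le hN hc x w hℓ hw hs.2 hk
  · rw [abs_of_nonpos ht0] at ht
    have key := exists_shift_transfer ν hc hQm hνQ hij.symm hn (-w) (T := T) hδ ?_ ?_ ?_
      (neg_nonneg.2 ht0) ht
    · obtain ⟨k, hkn, hk⟩ := key
      refine ⟨(false, ⟨k, by omega⟩), fun h => ?_⟩
      have e1 : fracShift n w (false, ⟨k, by omega⟩) = ((k : ℝ) / n) • -w := by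
        simp [fracShift]
      have e2 : t * ((if h = j then (1 : ℝ) else 0) - (if h = i then 1 else 0)) =
          -t * ((if h = i then 1 else 0) - (if h = j then 1 else 0)) := by ring
      rw [e1, e2]
      exact hk h
    · refine h1.trans (le_trans (mul_le_mul_right ?_ _) (hQi' _))
      refine le_volume_of_add_mem (-w) ?_
      rintro z ⟨hz1, hz2, hz3⟩
      rw [neg_add_cancel_right] at hz3
      refine ⟨?_, hz3, hz2⟩
      have := mem_cube_trans hz1 (add_mem_cube (z + -w) w)
      rw [neg_add_cancel_right] at this
      exact cube_mono x (by linarith [hs.1]) this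
    · intro k hk
      refine (hQi _).trans (le_trans (mul_le_mul_right ?_ _) (h2 k hk))
      refine volume_le_of_add_mem (((k : ℝ) / n) • -w) ?_
      rintro z ⟨hz1, hz2, hz3⟩
      have e1 : z + ((k : ℝ) / n) • -w + ((k : ℝ) / n) • w = z := by simp
      refine ⟨?_, ?_, ?_⟩
      · have hk1 : (k : ℝ) / n ≤ 1 := div_le_one_of_le₀ (by exact_mod_cast hk) (by positivity)
        have hku : ‖((k : ℝ) / n) • -w‖ ≤ ‖w‖ := by
          rw [norm_smul, norm_neg, Real.norm_of_nonneg (by positivity)]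
          exact mul_le_of_le_one_left (norm_nonneg _) hk1
        exact cube_mono x (by linarith [hs.2]) (mem_cube_trans hz1 (add_mem_cube z _))
      · rw [e1]
        exact hz2.symm
      · rw [e1]
        exact fun h => hz3 ⟨h.2, h.1⟩
    · intro k hk
      refine (hQi _).trans (le_trans (mul_le_mul_right ?_ _) h3)
      have := volume_consecutive_ne_le hN hc x (-w) hℓ (by rwa [norm_neg]) hs.2 hk
      rwa [norm_neg] at this

end FineTransfer

/-- `c'` is a modification of the labelling `c` inside the ball `ball x ρ`, changing the volumes
of the chambers by `Δ` and increasing the perimeter of each chamber by at most `s`. -/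
structure IsMod {m : ℕ} (ν : Measure (Pt N)) (G : Pt N → ENNReal) (c c' : Pt N → Fin (m + 1))
    (x : Pt N) (ρ : ℝ) (Δ : Fin (m + 1) → ℝ) (s : ℝ) : Prop where
  measurable : Measurable c'
  eq_off : ∃ r < ρ, ∀ z ∉ closedBall x r, c' z = c z
  vol : ∀ h, ν.real (c' ⁻¹' {h} ∩ ball x ρ) = ν.real (c ⁻¹' {h} ∩ ball x ρ) + Δ h
  per : ∀ h, ∫⁻ z in essBdry (c' ⁻¹' {h}) ∩ ball x ρ, G z ∂μH[(N : ℝ) - 1] ≤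
    (∫⁻ z in essBdry (c ⁻¹' {h}) ∩ ball x ρ, G z ∂μH[(N : ℝ) - 1]) + ENNReal.ofReal s

theorem measureReal_inter_ball_of_eqOn_compl {m : ℕ} (ν : Measure (Pt N))
    {c c' : Pt N → Fin (m + 1)} {Q B : Set (Pt N)} (hQ : MeasurableSet Q) (hQB : Q ⊆ B)
    (hB : ν B ≠ ⊤) (h : ∀ z ∉ Q, c' z = c z) (k : Fin (m + 1)) :
    ν.real (c' ⁻¹' {k} ∩ B) =
      ν.real (c ⁻¹' {k} ∩ B) + (ν.real (c' ⁻¹' {k} ∩ Q) - ν.real (c ⁻¹' {k} ∩ Q)) := by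
  have key : ∀ U : Set (Pt N), ν.real (U ∩ B) = ν.real (U ∩ Q) + ν.real ((U ∩ B) \ Q) := by
    intro U
    rw [← measureReal_inter_add_sdiff hQ (ne_top_of_le_ne_top hB (measure_mono inter_subset_right)),
      inter_assoc, inter_eq_self_of_subset_right hQB]
  have e : (c' ⁻¹' {k} ∩ B) \ Q = (c ⁻¹' {k} ∩ B) \ Q := by
    ext z
    simp only [Set.mem_sdiff, mem_inter_iff, mem_preimage, mem_singleton_iff]
    refine ⟨fun hz => ⟨⟨?_, hz.1.2⟩, hz.2⟩, fun hz => ⟨⟨?_, hz.1.2⟩, hz.2⟩⟩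
    · rw [← h z hz.2]; exact hz.1.1
    · rw [h z hz.2]; exact hz.1.1
  rw [key (c' ⁻¹' {k}), key (c ⁻¹' {k}), e]
  ring

theorem measure_ne_top_of_comparable {ν : Measure (Pt N)}
    (hν : ∀ R : ℝ, ∃ a > 0, ∃ A > 0, ∀ U ⊆ closedBall (0 : Pt N) R,
      ENNReal.ofReal a * volume U ≤ ν U ∧ ν U ≤ ENNReal.ofReal A * volume U)
    (x : Pt N) (ρ : ℝ) : ν (closedBall x ρ) ≠ ⊤ := by
  obtain ⟨a, -, A, -, h⟩ := hν (‖x‖ + ρ)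
  have hsub : closedBall x ρ ⊆ closedBall (0 : Pt N) (‖x‖ + ρ) := by
    refine closedBall_subset_closedBall' ?_
    rw [dist_zero_right, add_comm]
  refine ne_top_of_le_ne_top ?_ (h _ hsub).2
  exact ENNReal.mul_ne_top ENNReal.ofReal_ne_top measure_closedBall_lt_top.ne

theorem cube_subset_closedBall (x : Pt N) {s : ℝ} (hs : 0 ≤ s) :
    cube x s ⊆ closedBall x (N * s) := fun z hz => by
  rw [mem_closedBall, dist_eq_norm]
  exact norm_sub_le_of_mem_cube hs hz

section FineBox

theorem IsMod.mono {m : ℕ} {ν : Measure (Pt N)} {G : Pt N → ENNReal} {c c' : Pt N → Fin (m + 1)}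
    {x : Pt N} {ρ s s' : ℝ} {Δ : Fin (m + 1) → ℝ} (h : IsMod ν G c c' x ρ Δ s) (hs : s ≤ s') :
    IsMod ν G c c' x ρ Δ s' :=
  ⟨h.measurable, h.eq_off, h.vol,
    fun k => (h.per k).trans (add_le_add_right (ENNReal.ofReal_le_ofReal hs) _)⟩

variable {m : ℕ} {c : Pt N → Fin (m + 1)}

/-- Deterministic core of the fine exchange. -/
theorem isMod_shiftIn (hN : 2 ≤ N) : ∃ K : ℝ, 0 < K ∧ ∀ {m : ℕ} {c : Pt N → Fin (m + 1)},
    Measurable c → bdryMeas c univ ≠ ⊤ → ∀ (ν : Measure (Pt N)) {g : Pt N → ℝ}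
    (_ : Continuous g) {x w : Pt N} {ℓ P A B a ω ρ : ℝ} {n : ℕ} (_ : 0 < n) (_ : 0 < ℓ)
    (_ : ‖w‖ ≤ ℓ / 4) (_ : 0 ≤ P) (_ : 0 ≤ B) (_ : 0 ≤ ω) (_ : 2 * N * ℓ < ρ)
    {i j : Fin (m + 1)} (_ : i ≠ j) {T δ : ℝ} (_ : 0 ≤ δ) (_ : ν (ball x ρ) ≠ ⊤)
    (_ : bdryMeas c (cube x (8 * ℓ)) ≤ ENNReal.ofReal P)
    (_ : ∀ z ∈ cube x (2 * ℓ), g z ≤ B)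
    (_ : ∀ z ∈ cube x (2 * ℓ), ∀ a : Pt N, ‖a‖ ≤ ‖w‖ → g z ≤ g (z + a) + ω)
    (_ : ∀ U ⊆ cube x (2 * ℓ), ν U ≤ ENNReal.ofReal A * volume U)
    (_ : ∀ U ⊆ cube x (2 * ℓ), ENNReal.ofReal a * volume U ≤ ν U)
    (_ : ENNReal.ofReal T ≤
      ENNReal.ofReal a * volume {z | z ∈ cube x ℓ ∧ c z = i ∧ c (z + w) = j})
    (_ : ∀ k ≤ n, ENNReal.ofReal A * volume {z | z ∈ cube x (2 * ℓ) ∧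
      c z ≠ c (z + ((k : ℝ) / n) • w) ∧ ¬ (c z = i ∧ c (z + ((k : ℝ) / n) • w) = j)} ≤
        ENNReal.ofReal δ)
    (_ : ENNReal.ofReal A * (ENNReal.ofReal (tubeConst N * (‖w‖ / n)) *
      bdryMeas c (cube x (8 * ℓ))) ≤ ENNReal.ofReal δ) {t : ℝ} (_ : |t| ≤ T),
    ∃ (c' : Pt N → Fin (m + 1)) (Δ : Fin (m + 1) → ℝ),
      IsMod ν (fun z => ENNReal.ofReal (g z)) c c' x ρ Δ
        (P * (ω + K * (B * (‖w‖ / ℓ)) * (1 + 2 * (n + 1) * (m + 1) * tubeConst N))) ∧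
      ∀ h, |Δ h - t * ((if h = j then 1 else 0) - (if h = i then 1 else 0))| ≤ 2 * δ := by
  obtain ⟨K, hK, hshift⟩ := exists_shift_cube hN
  refine ⟨K, hK, ?_⟩
  intro m c hc hM ν g hg x w ℓ P A B a ω ρ n hn hℓ hw hP hB hω hρ i j hij T δ hδ hνρ hμ hgB hgω
    hνA hνa h1 h2 h3 t ht
  obtain ⟨s, hs, hper⟩ := hshift hc hM x w ℓ P B ω n (fun z => ENNReal.ofReal (g z)) hℓ hw hP hB
    hω hg.measurable.ennreal_ofReal hμ (fun z hz => ENNReal.ofReal_le_ofReal (hgB z hz))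
    (fun z hz a ha => (ENNReal.ofReal_le_ofReal (hgω z hz a ha)).trans ENNReal.ofReal_add_le)
  obtain ⟨p, hp⟩ := exists_fracShift_transfer hN hc ν hn hℓ hw hs hij hδ hνA hνa h1 h2 h3 ht
  have hsub : cube x (2 * ℓ) ⊆ closedBall x (2 * N * ℓ) := by
    refine (cube_subset_closedBall x (by positivity)).trans (closedBall_subset_closedBall ?_)
    exact le_of_eq (by ring)
  have hsub2 : cube x (2 * ℓ) ⊆ ball x ρ := hsub.trans (closedBall_subset_ball hρ)
  have hsub3 : cube x s ⊆ cube x (2 * ℓ) := cube_mono x (by linarith [hs.2])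
  refine ⟨shiftIn c (cube x s) (fracShift n w p), _,
    ⟨measurable_shiftIn hc (measurableSet_cube x s) _, ⟨2 * N * ℓ, hρ, fun z hz => ?_⟩,
      fun h => ?_, fun h => hper p h _ hsub2⟩, hp⟩
  · exact shiftIn_of_notMem fun h => hz (hsub (hsub3 h))
  · exact measureReal_inter_ball_of_eqOn_compl ν (measurableSet_cube x s) (hsub3.trans hsub2) hνρ
      (fun z hz => shiftIn_of_notMem hz) h

set_option maxHeartbeats 1000000 in
/-- Fine exchange of volume between some chamber in `S` and some chamber outside `S`: cheap in
perimeter, but with volumes controlled only up to a small relative error. -/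
theorem exists_fine_box (hN : 2 ≤ N) (hc : Measurable c) (hM : bdryMeas c univ ≠ ⊤)
    {ν : Measure (Pt N)} (hν : ∀ R : ℝ, ∃ a > 0, ∃ A > 0, ∀ U ⊆ closedBall (0 : Pt N) R,
      ENNReal.ofReal a * volume U ≤ ν U ∧ ν U ≤ ENNReal.ofReal A * volume U)
    {g : Pt N → ℝ} (hg : Continuous g) {S : Set (Fin (m + 1))} (hS : volume (c ⁻¹' S) ≠ 0)
    (hSc : volume (c ⁻¹' Sᶜ) ≠ 0) :
    ∃ η : ℝ, 0 < η ∧ ∀ κ D ρ R : ℝ, 0 < κ → 0 < D → 0 < ρ → 0 ≤ R →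
      ∀ᶠ θ in nhdsWithin (0 : ℝ) (Ioi 0), ∀ Z Z' : Set (Pt N), MeasurableSet Z →
        MeasurableSet Z' → (∀ z ∈ Z, closedBall z ρ ⊆ Z') → bdryMeas c Z' ≤ ENNReal.ofReal η →
        (ball 0 R)ᶜ ⊆ Z → ∃ x : Pt N, (∃ z ∈ closedBall x ρ, z ∉ Z) ∧ ∃ i ∈ S, ∃ j ∉ S,
          ∀ t : ℝ, |t| ≤ D * θ ^ N → ∃ (c' : Pt N → Fin (m + 1)) (Δ : Fin (m + 1) → ℝ),
            IsMod ν (fun z => ENNReal.ofReal (g z)) c c' x ρ Δ (κ * θ ^ (N - 1)) ∧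
            ∀ h, |Δ h - t * ((if h = j then 1 else 0) - (if h = i then 1 else 0))| ≤
              κ * θ ^ N := by
  obtain ⟨v, hv, β, hβ, hrate⟩ := exists_exit_rate hN hc hM S hS hSc
  obtain ⟨c₁, hc₁, C₁, hC₁, hpure⟩ := exists_pure_cube hN hc hM hβ hrate
  obtain ⟨K, hK, hmod⟩ := isMod_shiftIn hN
  have hCB : 0 < tubeConst N := tubeConst_pos
  have hv0 : 0 < ‖v‖ := norm_pos_iff.2 hv
  have hN0 : (0 : ℝ) < N := by exact_mod_cast (by omega : 0 < N)
  refine ⟨β / (2 * (tubeConst N * ‖v‖)), by positivity, fun κ D ρ R hκ hD hρ hR => ?_⟩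
  obtain ⟨a, ha, A, hA, hνaA⟩ := hν (R + 1)
  obtain ⟨B, hB, hgB⟩ : ∃ B : ℝ, 0 < B ∧ ∀ z ∈ closedBall (0 : Pt N) (R + 1), g z ≤ B := by
    obtain ⟨B, hB⟩ := (isCompact_closedBall (0 : Pt N) (R + 1)).exists_bound_of_continuousOn
      hg.continuousOn
    refine ⟨max B 1, by positivity, fun z hz => ?_⟩
    exact (le_abs_self _).trans ((hB z hz).trans (le_max_left _ _))
  set q₀ : ℝ := a * c₁ / D with hq₀
  have hq₀p : 0 < q₀ := by positivity
  obtain ⟨b, hb, hbN⟩ : ∃ b : ℝ, 0 < b ∧ b ^ N = q₀ :=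
    ⟨q₀ ^ ((N : ℝ)⁻¹), Real.rpow_pos_of_pos hq₀p _,
      Real.rpow_inv_natCast_pow hq₀p.le (by omega)⟩
  obtain ⟨n, hn⟩ := exists_nat_gt (max 0 (2 * (A * tubeConst N * ‖v‖ * C₁) / (q₀ * κ)))
  have hn0 : 0 < n := by exact_mod_cast (le_max_left _ _).trans_lt hn
  have hn1 : A * tubeConst N * ‖v‖ * C₁ / n ≤ q₀ * (κ / 2) := by
    have h := ((le_max_right _ _).trans_lt hn).le
    have hn' : (0 : ℝ) < n := by exact_mod_cast hn0
    rw [div_le_iff₀ (by positivity)] at h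
    rw [div_le_iff₀ hn']
    linarith
  set τ : ℝ := κ * q₀ / (2 * A) with hτ
  have hτ0 : 0 < τ := by positivity
  set Γ : ℝ := K * B * ‖v‖ * (1 + 2 * (n + 1) * (m + 1) * tubeConst N) with hΓ
  have hΓ0 : 0 < Γ := by positivity
  obtain ⟨Y, hY⟩ := exists_nat_gt (max 1 (max (4 * ‖v‖) (2 * (C₁ * Γ) / (κ * b ^ (N - 1)))))
  have hY1 : (1 : ℝ) < Y := (le_max_left _ _).trans_lt hY
  have hY0 : (0 : ℝ) < Y := by linarith
  have hYv : 4 * ‖v‖ ≤ Y := (((le_max_left _ _).trans (le_max_right _ _)).trans_lt hY).le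
  have hYΓ : C₁ * Γ / (b ^ (N - 1) * Y) ≤ κ / 2 := by
    have h := (((le_max_right (4 * ‖v‖) _).trans (le_max_right _ _)).trans_lt hY).le
    rw [div_le_iff₀ (by positivity)] at h
    rw [div_le_iff₀ (by positivity)]
    linarith
  have hYN : (Y : ℝ) ≤ (Y : ℝ) ^ N := le_self_pow₀ hY1.le (by omega)
  set ω : ℝ := κ * b ^ (N - 1) / (2 * C₁ * (Y : ℝ) ^ (N - 1)) with hω
  have hω0 : 0 < ω := by positivity
  obtain ⟨δ, hδ, hgδ⟩ : ∃ δ > 0, ∀ z ∈ closedBall (0 : Pt N) (R + 1),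
      ∀ z' ∈ closedBall (0 : Pt N) (R + 1), dist z z' < δ → g z ≤ g z' + ω := by
    have h := (isCompact_closedBall (0 : Pt N) (R + 1)).uniformContinuousOn_of_continuous
      hg.continuousOn
    rw [Metric.uniformContinuousOn_iff] at h
    obtain ⟨δ, hδ, h⟩ := h ω hω0
    refine ⟨δ, hδ, fun z hz z' hz' hd => ?_⟩
    have := h z hz z' hz' hd
    rw [Real.dist_eq] at this
    linarith [(abs_lt.1 this).2]
  have hbY : 0 < b * (Y : ℝ) ^ (N - 1) := by positivity
  have hH : Tendsto (fun θ : ℝ => θ / (b * (Y : ℝ) ^ (N - 1))) (nhdsWithin 0 (Ioi 0))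
      (nhdsWithin 0 (Ioi 0)) := by
    refine tendsto_nhdsWithin_iff.2 ⟨?_, ?_⟩
    · have : Tendsto (fun θ : ℝ => θ / (b * (Y : ℝ) ^ (N - 1))) (nhds 0) (nhds 0) := by
        have h := (tendsto_id (α := ℝ) (x := nhds 0)).div_const (b * (Y : ℝ) ^ (N - 1))
        rwa [zero_div] at h
      exact this.mono_left nhdsWithin_le_nhds
    · filter_upwards [self_mem_nhdsWithin] with θ hθ
      exact div_pos hθ hbY
  have hYL : 1 ≤ Y ^ N := Nat.one_le_pow _ _ (by exact_mod_cast hY0)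
  have hev := hH.eventually (hpure n (Y ^ N) τ hn0 hYL (by push_cast; linarith) hτ0)
  set θ₀ : ℝ := min (b / Y / (9 * N)) (min (b / Y * ρ / (9 * N)) (b / Y * δ)) with hθ₀
  have hθ₀p : 0 < θ₀ := by positivity
  filter_upwards [hev, Ioo_mem_nhdsGT hθ₀p] with θ hθev hθ Z Z' hZ hZ' hZZ hμZ hRZ
  have hθ0 : 0 < θ := hθ.1
  set H : ℝ := θ / (b * (Y : ℝ) ^ (N - 1)) with hHdef
  have hH0 : 0 < H := by positivity
  set ℓ : ℝ := Y * θ / b with hℓ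
  have hℓ0 : 0 < ℓ := by positivity
  have hpow : (Y : ℝ) ^ N = Y ^ (N - 1) * Y := by rw [← pow_succ, Nat.sub_add_cancel (by omega)]
  have hLH : ((Y ^ N : ℕ) : ℝ) * H = ℓ := by
    rw [hHdef, hℓ]
    push_cast
    rw [hpow]
    field_simp
  have hℓH : (Y : ℝ) ^ N * H = ℓ := by rw [← hLH]; push_cast; rfl
  have hℓ1 : 9 * N * ℓ ≤ 1 := by
    have h : θ ≤ b / Y / (9 * N) := hθ.2.le.trans (min_le_left _ _)
    rw [le_div_iff₀ (by positivity), le_div_iff₀ hY0] at h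
    rw [hℓ, mul_div_assoc', div_le_one hb]
    linarith
  have hℓ2 : 9 * N * ℓ ≤ ρ := by
    have h : θ ≤ b / Y * ρ / (9 * N) :=
      hθ.2.le.trans ((min_le_right _ _).trans (min_le_left _ _))
    rw [le_div_iff₀ (by positivity), div_mul_eq_mul_div, le_div_iff₀ hY0] at h
    rw [hℓ, mul_div_assoc', div_le_iff₀ hb]
    linarith
  have hℓ3 : ℓ < δ := by
    have h : θ < b / Y * δ :=
      hθ.2.trans_le ((min_le_right _ _).trans (min_le_right _ _))
    rw [div_mul_eq_mul_div, lt_div_iff₀ hY0] at h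
    rw [hℓ, div_lt_iff₀ hb]
    linarith
  have hw : ‖H • v‖ = H * ‖v‖ := by rw [norm_smul, Real.norm_of_nonneg hH0.le]
  have hwℓ : ‖H • v‖ ≤ ℓ / 4 := by
    rw [hw, ← hℓH]
    nlinarith
  have hN1 : (1 : ℝ) ≤ N := by exact_mod_cast (by omega : 1 ≤ N)
  have hNℓ : ℓ ≤ N * ℓ := le_mul_of_one_le_left hℓ0.le hN1
  have hwρ : ‖H • v‖ ≤ ρ := by linarith
  have hθ1 : ∀ z ∈ Z, ∀ t ∈ Icc (0 : ℝ) 1, z + t • H • v ∈ Z' := fun z hz t ht => by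
    refine hZZ z hz ?_
    rw [mem_closedBall, dist_eq_norm, add_sub_cancel_left, norm_smul,
      Real.norm_of_nonneg ht.1]
    exact (mul_le_of_le_one_left (norm_nonneg _) ht.2).trans hwρ
  have hθ2 : ENNReal.ofReal (tubeConst N * ‖v‖) * bdryMeas c Z' ≤ ENNReal.ofReal (β / 2) := by
    refine (mul_le_mul_right hμZ _).trans ?_
    rw [← ENNReal.ofReal_mul (by positivity)]
    refine ENNReal.ofReal_le_ofReal (le_of_eq ?_)
    field_simp
  obtain ⟨x, i, hi, j, hj, ⟨z₀, hz₀, hz₀Z⟩, hμ8, hlow, hbad⟩ := hθev Z Z' hZ hZ' hθ1 hθ2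
  rw [hLH] at hz₀ hμ8 hlow
  simp only [hLH] at hbad
  have hz₀R : ‖z₀‖ < R := by
    by_contra h
    refine hz₀Z (hRZ ?_)
    simpa using not_lt.1 h
  have hsub8 : cube x (8 * ℓ) ⊆ closedBall (0 : Pt N) (R + 1) := fun z hz => by
    have e1 := norm_sub_le_of_mem_cube (by positivity) hz
    have e2 := norm_sub_le_of_mem_cube hℓ0.le hz₀
    rw [mem_closedBall, dist_zero_right]
    calc ‖z‖ = ‖(z - x) - (z₀ - x) + z₀‖ := by congr 1; abel
      _ ≤ ‖z - x‖ + ‖z₀ - x‖ + ‖z₀‖ :=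
        (norm_add_le _ _).trans (add_le_add_left (norm_sub_le _ _) _)
      _ ≤ R + 1 := by linarith
  have hsub2 : cube x (2 * ℓ) ⊆ cube x (8 * ℓ) := cube_mono x (by linarith)
  have hsubU : ∀ U ⊆ cube x (2 * ℓ), U ⊆ closedBall (0 : Pt N) (R + 1) :=
    fun U hU => hU.trans (hsub2.trans hsub8)
  have hn' : (0 : ℝ) < n := by exact_mod_cast hn0
  have hθN : θ ^ N = θ ^ (N - 1) * θ := by rw [← pow_succ, Nat.sub_add_cancel (by omega)]
  have hbN' : b ^ (N - 1) * b = q₀ := by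
    rw [← hbN, ← pow_succ, Nat.sub_add_cancel (by omega)]
  have hℓpow : ℓ ^ (N - 1) = Y ^ (N - 1) * θ ^ (N - 1) / b ^ (N - 1) := by
    rw [hℓ, div_pow, mul_pow]
  have hV : q₀ * (H * ℓ ^ (N - 1)) = θ ^ N := by
    rw [hℓpow, hHdef, ← hbN', hθN]
    field_simp
  have hV0 : 0 < H * ℓ ^ (N - 1) := by positivity
  refine ⟨x, ⟨z₀, ?_, hz₀Z⟩, i, hi, j, hj, fun t ht => ?_⟩
  · refine closedBall_subset_closedBall ?_ (cube_subset_closedBall x hℓ0.le hz₀)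
    nlinarith
  have h1 : ENNReal.ofReal (D * θ ^ N) ≤
      ENNReal.ofReal a * volume {z | z ∈ cube x ℓ ∧ c z = i ∧ c (z + H • v) = j} := by
    refine le_trans ?_ (mul_le_mul_right hlow _)
    rw [← ENNReal.ofReal_mul ha.le]
    refine ENNReal.ofReal_le_ofReal (le_of_eq ?_)
    rw [← hV, hq₀]
    field_simp
  have h2 : ∀ k ≤ n, ENNReal.ofReal A * volume {z | z ∈ cube x (2 * ℓ) ∧
      c z ≠ c (z + ((k : ℝ) / n) • H • v) ∧
        ¬ (c z = i ∧ c (z + ((k : ℝ) / n) • H • v) = j)} ≤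
        ENNReal.ofReal (κ / 2 * θ ^ N) := fun k hk => by
    refine (mul_le_mul_right (hbad k hk) _).trans ?_
    rw [← ENNReal.ofReal_mul hA.le]
    refine ENNReal.ofReal_le_ofReal (le_of_eq ?_)
    rw [← hV, hτ]
    field_simp
  have h3 : ENNReal.ofReal A * (ENNReal.ofReal (tubeConst N * (‖H • v‖ / n)) *
      bdryMeas c (cube x (8 * ℓ))) ≤ ENNReal.ofReal (κ / 2 * θ ^ N) := by
    refine (mul_le_mul_right (mul_le_mul_right hμ8 _) _).trans ?_
    rw [← ENNReal.ofReal_mul (by positivity), ← ENNReal.ofReal_mul hA.le]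
    refine ENNReal.ofReal_le_ofReal ?_
    calc A * (tubeConst N * (‖H • v‖ / n) * (C₁ * ℓ ^ (N - 1)))
        = A * tubeConst N * ‖v‖ * C₁ / n * (H * ℓ ^ (N - 1)) := by rw [hw]; ring
      _ ≤ q₀ * (κ / 2) * (H * ℓ ^ (N - 1)) := by gcongr
      _ = κ / 2 * θ ^ N := by rw [← hV]; ring
  have hres := hmod hc hM ν hg (x := x) (w := H • v) (ρ := ρ) (B := B) (ω := ω) (n := n) hn0 hℓ0
    hwℓ (by positivity) hB.le hω0.le (by nlinarith) (i := i) (j := j)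
    (fun h => hj (h ▸ hi)) (by positivity)
    (ne_top_of_le_ne_top (measure_ne_top_of_comparable hν x ρ)
      (measure_mono ball_subset_closedBall)) hμ8
    (fun z hz => hgB z (hsub8 (hsub2 hz)))
    (fun z hz u hu => by
      have hz2 : z + u ∈ cube x (8 * ℓ) :=
        cube_mono x (by linarith : 2 * ℓ + ‖u‖ ≤ 8 * ℓ) (mem_cube_trans hz (add_mem_cube z u))
      refine hgδ z (hsub8 (hsub2 hz)) _ (hsub8 hz2) ?_
      rw [dist_self_add_right]
      linarith)
    (fun U hU => (hνaA U (hsubU U hU)).2) (fun U hU => (hνaA U (hsubU U hU)).1) h1 h2 h3 ht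
  obtain ⟨c', Δ, hcΔ, hΔ⟩ := hres
  refine ⟨c', Δ, hcΔ.mono ?_, fun h => (hΔ h).trans (le_of_eq (by ring))⟩
  have e1 : C₁ * ℓ ^ (N - 1) * ω = κ / 2 * θ ^ (N - 1) := by
    rw [hℓpow, hω]
    field_simp
  have e2 : C₁ * ℓ ^ (N - 1) * (K * (B * (‖H • v‖ / ℓ)) *
      (1 + 2 * (n + 1) * (m + 1) * tubeConst N)) =
        C₁ * Γ / (b ^ (N - 1) * Y) * θ ^ (N - 1) := by
    have : ‖H • v‖ / ℓ = ‖v‖ / (Y : ℝ) ^ N := by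
      rw [hw, ← hℓH]
      field_simp
    rw [this, hℓpow, hΓ, hpow]
    field_simp
  rw [mul_add, e1, e2]
  have := mul_le_mul_of_nonneg_right hYΓ (by positivity : 0 ≤ θ ^ (N - 1))
  linarith

end FineBox

section CrudeBox

variable {m : ℕ} {c : Pt N → Fin (m + 1)}

/-- A point at which its own chamber has density one and the boundary measure has finite density
with respect to Lebesgue measure. -/
def IsGood (c : Pt N → Fin (m + 1)) (p : Pt N) : Prop :=
  densTendsto (c ⁻¹' {c p}) p 1 ∧ ∃ C : ℝ, 0 < C ∧
    ∀ᶠ s in nhdsWithin (0 : ℝ) (Ioi 0), bdryMeas c (closedBall p s) ≤ ENNReal.ofReal (C * s ^ N)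

theorem ae_isGood (hN : 1 ≤ N) (hc : Measurable c) (hM : bdryMeas c univ ≠ ⊤) :
    ∀ᵐ p, IsGood c p := by
  have : Nonempty (Fin N) := ⟨⟨0, hN⟩⟩
  have : IsFiniteMeasure (bdryMeas c) := ⟨hM.lt_top⟩
  have h1 : ∀ᵐ p : Pt N, ∀ i, densTendsto (c ⁻¹' {i}) p ((c ⁻¹' {i}).indicator 1 p) :=
    ae_all_iff.2 fun i => ae_densTendsto (hc (measurableSet_singleton i))
  filter_upwards [h1, Besicovitch.ae_tendsto_rnDeriv (bdryMeas c) (volume : Measure (Pt N)),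
    Measure.rnDeriv_lt_top (bdryMeas c) (volume : Measure (Pt N))] with p hp1 hp2 hp3
  refine ⟨by simpa using hp1 (c p), ?_⟩
  obtain ⟨D, hD1, hD2⟩ := exists_between hp3
  have hu := volume_ball_pos_ne (0 : Pt N) one_pos
  refine ⟨D.toReal * (volume (ball (0 : Pt N) 1)).toReal + 1, by positivity, ?_⟩
  filter_upwards [hp2.eventually (gt_mem_nhds hD1), self_mem_nhdsWithin] with s hs hs0
  have hs0 : 0 < s := hs0
  have hv0 : volume (closedBall p s) ≠ 0 := (measure_closedBall_pos volume p hs0).ne'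
  have hv1 : volume (closedBall p s) ≠ ⊤ := measure_closedBall_lt_top.ne
  calc bdryMeas c (closedBall p s)
      = bdryMeas c (closedBall p s) / volume (closedBall p s) * volume (closedBall p s) :=
        (ENNReal.div_mul_cancel hv0 hv1).symm
    _ ≤ D * volume (closedBall p s) := mul_le_mul_left hs.le _
    _ = ENNReal.ofReal (D.toReal * (volume (ball (0 : Pt N) 1)).toReal * s ^ N) := by
        rw [Measure.addHaar_closedBall volume p hs0.le, finrank_euclideanSpace_fin,
          ENNReal.ofReal_mul (by positivity), ENNReal.ofReal_mul (by positivity),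
          ENNReal.ofReal_toReal hD2.ne, ENNReal.ofReal_toReal hu.2]
        ring
    _ ≤ _ := ENNReal.ofReal_le_ofReal (by gcongr; linarith)

theorem continuousOn_of_abs_sub_le {φ ψ : ℝ → ℝ} {S : Set ℝ} (hψ : Continuous ψ)
    (h : ∀ x ∈ S, ∀ y ∈ S, x ≤ y → φ x ≤ φ y ∧ φ y - φ x ≤ ψ y - ψ x) : ContinuousOn φ S := by
  intro x hx
  have h0 : Tendsto (fun y => |ψ y - ψ x|) (nhdsWithin x S) (nhds 0) := by
    have : Continuous fun y => |ψ y - ψ x| := by fun_prop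
    have h2 := this.tendsto x
    simp only [sub_self, abs_zero] at h2
    exact h2.mono_left nhdsWithin_le_nhds
  refine tendsto_iff_dist_tendsto_zero.2 (squeeze_zero' (Eventually.of_forall fun _ =>
    dist_nonneg) ?_ h0)
  filter_upwards [self_mem_nhdsWithin] with y hy
  rw [Real.dist_eq]
  rcases le_total x y with hxy | hxy
  · obtain ⟨h1, h2⟩ := h x hx y hy hxy
    rw [abs_of_nonneg (by linarith)]
    exact h2.trans (le_abs_self _)
  · obtain ⟨h1, h2⟩ := h y hy x hx hxy
    rw [abs_sub_comm, abs_sub_comm (ψ y), abs_of_nonneg (by linarith)]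
    exact h2.trans (le_abs_self _)

/-- Relabelling of chamber `i` as chamber `j` inside `Q`. -/
def relabel (c : Pt N → Fin (m + 1)) (Q : Set (Pt N)) (i j : Fin (m + 1)) : Pt N → Fin (m + 1) :=
  open Classical in fun z => if z ∈ Q ∧ c z = i then j else c z

theorem relabel_of_notMem {Q : Set (Pt N)} {i j : Fin (m + 1)} {z : Pt N} (hz : z ∉ Q) :
    relabel c Q i j z = c z := by simp [relabel, hz]

theorem relabel_of_mem {Q : Set (Pt N)} {i j : Fin (m + 1)} {z : Pt N} (hz : z ∈ Q) :
    relabel c Q i j z = if c z = i then j else c z := by simp [relabel, hz]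

theorem measurable_relabel (hc : Measurable c) {Q : Set (Pt N)} (hQ : MeasurableSet Q)
    (i j : Fin (m + 1)) : Measurable (relabel c Q i j) :=
  Measurable.ite (hQ.inter (hc (measurableSet_singleton i))) measurable_const hc

theorem essBdry_empty : essBdry (∅ : Set (Pt N)) = ∅ := by
  refine eq_empty_of_forall_notMem fun x hx => hx.1 ?_
  simp [densTendsto]

theorem essBdry_relabel_subset (hc : Measurable c) (x : Pt N) (s : ℝ) (i j h : Fin (m + 1)) :
    essBdry (relabel c (cube x s) i j ⁻¹' {h}) ⊆
      (essBdry (c ⁻¹' {h}) ∪ (essBdry (c ⁻¹' {i}) ∩ cube x s)) ∪ cubeBdry x s := by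
  intro z hz
  by_cases hzQ : z ∈ cube x s
  · by_cases hzB : z ∈ cubeBdry x s
    · exact Or.inr hzB
    refine Or.inl ?_
    have hnhds := (isOpen_cube_sdiff_cubeBdry x s).mem_nhds ⟨hzQ, hzB⟩
    by_cases hh : h = j
    · have h1 : z ∈ essBdry (c ⁻¹' {h} ∪ c ⁻¹' {i}) := by
        refine (mem_essBdry_congr hnhds (Eventually.of_forall fun y hy => ?_)).1 hz
        simp only [mem_preimage, mem_singleton_iff, relabel_of_mem hy.1, mem_union]
        split_ifs with hy2 <;> simp [hy2, hh]
      rcases essBdry_union_subset (hc (measurableSet_singleton h))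
        (hc (measurableSet_singleton i)) h1 with h2 | h2
      · exact Or.inl h2
      · exact Or.inr ⟨h2, hzQ⟩
    · by_cases hi : h = i
      · have h1 : z ∈ essBdry (∅ : Set (Pt N)) := by
          refine (mem_essBdry_congr hnhds (Eventually.of_forall fun y hy => ?_)).1 hz
          simp only [mem_preimage, mem_singleton_iff, relabel_of_mem hy.1, mem_empty_iff_false,
            iff_false]
          split_ifs with hy2
          · exact fun h3 => hh h3.symm
          · exact fun h3 => hy2 (h3.trans hi)
        rw [essBdry_empty] at h1
        exact h1.elim
      · refine Or.inl ((mem_essBdry_congr hnhds (Eventually.of_forall fun y hy => ?_)).1 hz)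
        simp only [mem_preimage, mem_singleton_iff, relabel_of_mem hy.1]
        split_ifs with hy2
        · rw [hy2]
          exact ⟨fun h3 => absurd h3.symm hh, fun h3 => absurd h3.symm hi⟩
        · rfl
  · refine Or.inl (Or.inl ((mem_essBdry_congr ((isClosed_cube x s).isOpen_compl.mem_nhds hzQ)
      (Eventually.of_forall fun y hy => ?_)).1 hz))
    simp only [mem_preimage, relabel_of_notMem hy]

theorem lintegral_essBdry_relabel_le (hc : Measurable c) {x : Pt N} {s : ℝ} {W : Set (Pt N)}
    {G : Pt N → ENNReal} {κ : ENNReal} (hG : ∀ z ∈ cube x s, G z ≤ κ) (i j h : Fin (m + 1)) :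
    ∫⁻ z in essBdry (relabel c (cube x s) i j ⁻¹' {h}) ∩ W, G z ∂μH[(N : ℝ) - 1] ≤
      (∫⁻ z in essBdry (c ⁻¹' {h}) ∩ W, G z ∂μH[(N : ℝ) - 1]) +
        κ * (bdryMeas c (cube x s) + μH[(N : ℝ) - 1] (cubeBdry x s)) := by
  calc ∫⁻ z in essBdry (relabel c (cube x s) i j ⁻¹' {h}) ∩ W, G z ∂μH[(N : ℝ) - 1]
      ≤ ∫⁻ z in ((essBdry (c ⁻¹' {h}) ∩ W) ∪ (essBdry (c ⁻¹' {i}) ∩ cube x s)) ∪ cubeBdry x s,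
          G z ∂μH[(N : ℝ) - 1] := by
        refine lintegral_mono_set ?_
        rintro z ⟨hz, hzW⟩
        rcases essBdry_relabel_subset hc x s i j h hz with (h1 | h1) | h1
        · exact Or.inl (Or.inl ⟨h1, hzW⟩)
        · exact Or.inl (Or.inr h1)
        · exact Or.inr h1
    _ ≤ ((∫⁻ z in essBdry (c ⁻¹' {h}) ∩ W, G z ∂μH[(N : ℝ) - 1]) +
          ∫⁻ z in essBdry (c ⁻¹' {i}) ∩ cube x s, G z ∂μH[(N : ℝ) - 1]) +
          ∫⁻ z in cubeBdry x s, G z ∂μH[(N : ℝ) - 1] :=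
        (lintegral_union_le _ _ _).trans (add_le_add_left (lintegral_union_le _ _ _) _)
    _ ≤ ((∫⁻ z in essBdry (c ⁻¹' {h}) ∩ W, G z ∂μH[(N : ℝ) - 1]) +
          κ * bdryMeas c (cube x s)) + κ * μH[(N : ℝ) - 1] (cubeBdry x s) := by
        refine add_le_add (add_le_add_right
          (setLIntegral_essBdry_inter_le i (measurableSet_cube x s) hG) _) ?_
        exact (setLIntegral_mono measurable_const fun z hz => hG z hz.1).trans
          (setLIntegral_const _ _).le
    _ = _ := by rw [mul_add, add_assoc]

theorem IsMod.refl {ν : Measure (Pt N)} {G : Pt N → ENNReal} (hc : Measurable c) (x : Pt N)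
    (ρ : ℝ) {s : ℝ} : IsMod ν G c c x ρ 0 s :=
  ⟨hc, ⟨ρ - 1, by linarith, fun _ _ => rfl⟩, fun h => by simp, fun h => le_self_add⟩

theorem measureReal_relabel (hc : Measurable c) {ν : Measure (Pt N)} {Q : Set (Pt N)}
    (hQν : ν Q ≠ ⊤) {i j : Fin (m + 1)} (hij : i ≠ j) (h : Fin (m + 1)) :
    ν.real (relabel c Q i j ⁻¹' {h} ∩ Q) - ν.real (c ⁻¹' {h} ∩ Q) =
      ν.real (c ⁻¹' {i} ∩ Q) * ((if h = j then 1 else 0) - (if h = i then 1 else 0)) := by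
  by_cases hj : h = j
  · have hi : h ≠ i := fun h1 => hij (h1.symm.trans hj)
    have e : relabel c Q i j ⁻¹' {h} ∩ Q = (c ⁻¹' {h} ∩ Q) ∪ (c ⁻¹' {i} ∩ Q) := by
      ext z
      simp only [mem_inter_iff, mem_preimage, mem_singleton_iff, mem_union]
      by_cases hz : z ∈ Q
      · simp only [relabel_of_mem hz, hz, and_true]
        split_ifs with h1 <;> simp [h1, hj]
      · simp [hz]
    have hd : Disjoint (c ⁻¹' {h} ∩ Q) (c ⁻¹' {i} ∩ Q) := by
      rw [Set.disjoint_left]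
      rintro z ⟨h1, -⟩ ⟨h2, -⟩
      exact hi (h1.symm.trans h2)
    rw [e, if_pos hj, if_neg hi]
    have hadd : ν.real ((c ⁻¹' {h} ∩ Q) ∪ (c ⁻¹' {i} ∩ Q)) =
        ν.real (c ⁻¹' {h} ∩ Q) + ν.real (c ⁻¹' {i} ∩ Q) := by
      rw [← measureReal_inter_add_sdiff (s := (c ⁻¹' {h} ∩ Q) ∪ (c ⁻¹' {i} ∩ Q))
        (hc (measurableSet_singleton h))
        (ne_top_of_le_ne_top hQν (measure_mono (union_subset inter_subset_right
          inter_subset_right)))]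
      congr 2
      · ext z
        simp only [mem_inter_iff, mem_preimage, mem_singleton_iff, mem_union]
        constructor
        · rintro ⟨h1 | h1, h2⟩
          · exact h1
          · exact absurd (h2.symm.trans h1.1) hi
        · exact fun h1 => ⟨Or.inl h1, h1.1⟩
      · ext z
        simp only [mem_inter_iff, mem_preimage, mem_singleton_iff, mem_union, Set.mem_sdiff]
        constructor
        · rintro ⟨h1 | h1, h2⟩
          · exact absurd h1.1 h2
          · exact h1
        · exact fun h1 => ⟨Or.inr h1, fun h2 => hi (h2.symm.trans h1.1)⟩
    rw [hadd]
    ring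
  · by_cases hi : h = i
    · have e : relabel c Q i j ⁻¹' {h} ∩ Q = ∅ := by
        refine eq_empty_of_forall_notMem ?_
        rintro z ⟨h1, hz⟩
        rw [mem_preimage, mem_singleton_iff, relabel_of_mem hz] at h1
        split_ifs at h1 with h2
        · exact hj h1.symm
        · exact h2 (h1.trans hi)
      rw [e, if_neg hj, if_pos hi, hi]
      simp
    · have e : relabel c Q i j ⁻¹' {h} ∩ Q = c ⁻¹' {h} ∩ Q := by
        ext z
        simp only [mem_inter_iff, mem_preimage, mem_singleton_iff]
        refine and_congr_left fun hz => ?_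
        rw [relabel_of_mem hz]
        split_ifs with h2
        · rw [h2]
          exact ⟨fun h3 => absurd h3.symm hj, fun h3 => absurd h3.symm hi⟩
        · rfl
      rw [e, if_neg hj, if_neg hi]
      simp

/-- Exact exchange of volume between two chambers near a good point. -/
theorem exists_crude_box (hN : 2 ≤ N) (hc : Measurable c)
    {ν : Measure (Pt N)} (hν : ∀ R : ℝ, ∃ a > 0, ∃ A > 0, ∀ U ⊆ closedBall (0 : Pt N) R,
      ENNReal.ofReal a * volume U ≤ ν U ∧ ν U ≤ ENNReal.ofReal A * volume U)
    {g : Pt N → ℝ} (hg : Continuous g) {p : Pt N} (hp : IsGood c p) {j : Fin (m + 1)}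
    (hj : c p ≠ j) :
    ∃ K : ℝ, 0 < K ∧ ∀ ρ : ℝ, 0 < ρ → ∀ᶠ θ in nhdsWithin (0 : ℝ) (Ioi 0),
      ∀ t ∈ Icc 0 (θ ^ N), ∃ c' : Pt N → Fin (m + 1),
        IsMod ν (fun z => ENNReal.ofReal (g z)) c c' p ρ
          (fun h => t * ((if h = j then 1 else 0) - (if h = c p then 1 else 0)))
          (K * θ ^ (N - 1)) := by
  obtain ⟨hdens, C, hC, hμ⟩ := hp
  obtain ⟨a, ha, A, hA, hνaA⟩ := hν (‖p‖ + 1)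
  obtain ⟨B, hB, hgB⟩ : ∃ B : ℝ, 0 < B ∧ ∀ z ∈ closedBall (0 : Pt N) (‖p‖ + 1), g z ≤ B := by
    obtain ⟨B, hB⟩ := (isCompact_closedBall (0 : Pt N) (‖p‖ + 1)).exists_bound_of_continuousOn
      hg.continuousOn
    refine ⟨max B 1, by positivity, fun z hz => ?_⟩
    exact (le_abs_self _).trans ((hB z hz).trans (le_max_left _ _))
  obtain ⟨K₀, hK₀, hQB⟩ := exists_hausdorffMeasure_cubeBdry_le (N := N) (by omega)
  have hN1 : (1 : ℝ) ≤ N := by exact_mod_cast (by omega : 1 ≤ N)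
  have : Nonempty (Fin N) := ⟨⟨0, by omega⟩⟩
  have hu := volume_ball_pos_ne (0 : Pt N) one_pos
  set u : ℝ := (volume (ball (0 : Pt N) 1)).toReal with hudef
  have hu0 : 0 < u := ENNReal.toReal_pos hu.1 hu.2
  set a' : ℝ := a / 2 * u with ha'
  have ha'0 : 0 < a' := by positivity
  obtain ⟨b, hb, hbN⟩ : ∃ b : ℝ, 0 < b ∧ b ^ N = a' :=
    ⟨a' ^ ((N : ℝ)⁻¹), Real.rpow_pos_of_pos ha'0 _,
      Real.rpow_inv_natCast_pow ha'0.le (by omega)⟩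
  refine ⟨B * (C * N ^ N + K₀) / b ^ (N - 1), by positivity, fun ρ hρ => ?_⟩
  set E : Set (Pt N) := c ⁻¹' {c p} with hE
  have hhalf : ∀ᶠ s in nhdsWithin (0 : ℝ) (Ioi 0),
      (1 / 2 : ENNReal) < volume (E ∩ ball p s) / volume (ball p s) :=
    hdens.eventually (lt_mem_nhds (by simp))
  obtain ⟨s₁, hs₁, hs₁P⟩ : ∃ s₁ : ℝ, 0 < s₁ ∧ ∀ s, 0 < s → s ≤ s₁ →
      (1 / 2 : ENNReal) < volume (E ∩ ball p s) / volume (ball p s) ∧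
        bdryMeas c (closedBall p s) ≤ ENNReal.ofReal (C * s ^ N) := by
    obtain ⟨s₁, hs₁, h⟩ := mem_nhdsGT_iff_exists_Ioc_subset.1 (hhalf.and hμ)
    exact ⟨s₁, hs₁, fun s h1 h2 => h ⟨h1, h2⟩⟩
  set s₂ : ℝ := min s₁ (min 1 (ρ / 2)) / N with hs₂
  have hs₂0 : 0 < s₂ := by positivity
  have hNs : N * s₂ = min s₁ (min 1 (ρ / 2)) := by
    rw [hs₂]
    field_simp
  have hNs1 : N * s₂ ≤ s₁ := hNs.le.trans (min_le_left _ _)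
  have hNs2 : N * s₂ ≤ 1 := hNs.le.trans ((min_le_right _ _).trans (min_le_left _ _))
  have hNs3 : N * s₂ ≤ ρ / 2 := hNs.le.trans ((min_le_right _ _).trans (min_le_right _ _))
  have hcb : ∀ s, 0 ≤ s → s ≤ s₂ → cube p s ⊆ closedBall p (N * s₂) := fun s h0 h1 =>
    (cube_subset_closedBall p h0).trans (closedBall_subset_closedBall (by gcongr))
  have hcb0 : closedBall p (N * s₂) ⊆ closedBall (0 : Pt N) (‖p‖ + 1) := by
    refine closedBall_subset_closedBall' ?_
    rw [dist_zero_right]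
    linarith
  have hfin : ∀ x r, ν (closedBall x r) ≠ ⊤ := fun x r => measure_ne_top_of_comparable hν x r
  have hνcube : ∀ s, 0 ≤ s → s ≤ s₂ → ∀ U ⊆ cube p s, ν U ≠ ⊤ := fun s h0 h1 U hU =>
    ne_top_of_le_ne_top (hfin p (N * s₂)) (measure_mono (hU.trans (hcb s h0 h1)))
  set φ : ℝ → ℝ := fun s => ν.real (E ∩ cube p s) with hφ
  have hφ0 : φ 0 = 0 := by
    have h1 := (hνaA (E ∩ cube p 0) (inter_subset_right.trans
      ((hcb 0 le_rfl hs₂0.le).trans hcb0))).2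
    have h2 : volume (E ∩ cube p 0) = 0 := by
      refine measure_mono_null inter_subset_right ?_
      rw [volume_cube p le_rfl, mul_zero, zero_pow (by omega), ENNReal.ofReal_zero]
    rw [h2, mul_zero] at h1
    simp only [hφ, measureReal_def, le_antisymm h1 bot_le]
    simp
  have hφlow : ∀ s, 0 < s → s ≤ s₂ → (b * s) ^ N ≤ φ s := by
    intro s hs0 hs
    have hs1 : s ≤ s₁ := hs.trans ((le_mul_of_one_le_left hs₂0.le hN1).trans hNs1)
    have h1 := (hs₁P s hs0 hs1).1
    have hv := volume_ball_pos_ne p hs0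
    have h2 : (1 / 2 : ENNReal) * volume (ball p s) ≤ volume (E ∩ ball p s) := by
      rw [ENNReal.lt_div_iff_mul_lt (Or.inl hv.1) (Or.inl hv.2)] at h1
      exact h1.le
    have hbc : ball p s ⊆ cube p s := fun z hz => by
      rw [mem_ball, dist_eq_norm] at hz
      have := add_mem_cube p (z - p)
      rw [add_sub_cancel] at this
      exact cube_mono p hz.le this
    have h3 : ENNReal.ofReal ((b * s) ^ N) ≤ ν (E ∩ cube p s) := by
      refine le_trans ?_ (hνaA (E ∩ cube p s) (inter_subset_right.trans
        ((hcb s hs0.le hs).trans hcb0))).1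
      refine le_trans (le_of_eq ?_) (mul_le_mul_right
        (h2.trans (measure_mono (inter_subset_inter_right _ hbc))) _)
      rw [Measure.addHaar_ball volume p hs0.le, finrank_euclideanSpace_fin, mul_pow, hbN, ha',
        ENNReal.ofReal_mul (by positivity), ENNReal.ofReal_mul (by positivity),
        ENNReal.ofReal_div_of_pos two_pos, hudef, ENNReal.ofReal_toReal hu.2, div_eq_mul_inv]
      simp only [ENNReal.ofReal_ofNat, one_div]
      ring
    have h4 := ENNReal.toReal_mono (hνcube s hs0.le hs _ inter_subset_right) h3
    rwa [ENNReal.toReal_ofReal (by positivity)] at h4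
  have hφc : ContinuousOn φ (Icc 0 s₂) := by
    refine continuousOn_of_abs_sub_le (ψ := fun s => A * (2 * s) ^ N) (by fun_prop) ?_
    intro x hx y hy hxy
    have hyt := hνcube y hy.1 hy.2 (E ∩ cube p y) inter_subset_right
    refine ⟨measureReal_mono (inter_subset_inter_right _ (cube_mono p hxy)) hyt, ?_⟩
    have h1 := measureReal_inter_add_sdiff (μ := ν) (s := E ∩ cube p y) (measurableSet_cube p x) hyt
    rw [inter_assoc, inter_eq_self_of_subset_right (cube_mono p hxy)] at h1
    have h2 : ν ((E ∩ cube p y) \ cube p x) ≤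
        ENNReal.ofReal (A * (2 * y) ^ N - A * (2 * x) ^ N) := by
      have hsub : (E ∩ cube p y) \ cube p x ⊆ cube p y \ cube p x :=
        sdiff_subset_sdiff_left inter_subset_right
      refine ((hνaA _ (hsub.trans (sdiff_subset.trans
        ((hcb y hy.1 hy.2).trans hcb0)))).2).trans ?_
      refine (mul_le_mul_right (measure_mono hsub) _).trans ?_
      rw [measure_sdiff (cube_mono p hxy) (measurableSet_cube p x).nullMeasurableSet
        (isCompact_cube p hx.1).measure_lt_top.ne, volume_cube p hy.1, volume_cube p hx.1,
        ← ENNReal.ofReal_sub _ (by have := hx.1; positivity), ← ENNReal.ofReal_mul hA.le, mul_sub]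
    have h3 : ν.real ((E ∩ cube p y) \ cube p x) ≤ A * (2 * y) ^ N - A * (2 * x) ^ N := by
      refine ENNReal.toReal_le_of_le_ofReal ?_ h2
      have hx0 := hx.1
      have : (2 * x) ^ N ≤ (2 * y) ^ N := by gcongr
      nlinarith
    simp only [hφ]
    linarith
  filter_upwards [Ioo_mem_nhdsGT (by positivity : 0 < b * s₂)] with θ hθ t ht
  have hθ0 : 0 < θ := hθ.1
  have htφ : t ∈ Icc (φ 0) (φ s₂) := by
    rw [hφ0]
    refine ⟨ht.1, ht.2.trans (le_trans ?_ (hφlow s₂ hs₂0 le_rfl))⟩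
    exact pow_le_pow_left₀ hθ0.le hθ.2.le N
  obtain ⟨s, hs, hst⟩ := intermediate_value_Icc hs₂0.le hφc htφ
  rcases hs.1.eq_or_lt with hs0 | hs0
  · have ht0 : t = 0 := by rw [← hst, ← hs0, hφ0]
    refine ⟨c, ?_⟩
    have := IsMod.refl (ν := ν) (G := fun z => ENNReal.ofReal (g z)) hc p ρ
      (s := B * (C * N ^ N + K₀) / b ^ (N - 1) * θ ^ (N - 1))
    convert this using 1
    ext h
    simp [ht0]
  have hbs : b * s ≤ θ := by
    refine le_of_pow_le_pow_left₀ (by omega : N ≠ 0) hθ0.le ?_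
    exact (hφlow s hs0 hs.2).trans (hst.le.trans ht.2)
  have hQ := measurableSet_cube p s
  have hsubρ : cube p s ⊆ ball p ρ :=
    (hcb s hs.1 hs.2).trans (closedBall_subset_ball (by linarith))
  refine ⟨relabel c (cube p s) (c p) j, measurable_relabel hc hQ _ _,
    ⟨N * s₂, by linarith, fun z hz => relabel_of_notMem fun h => hz (hcb s hs.1 hs.2 h)⟩,
    fun h => ?_, fun h => ?_⟩
  · rw [measureReal_inter_ball_of_eqOn_compl ν hQ hsubρ (ne_top_of_le_ne_top (hfin p ρ)
      (measure_mono ball_subset_closedBall)) (fun z hz => relabel_of_notMem hz) h,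
      measureReal_relabel hc (hνcube s hs.1 hs.2 _ subset_rfl) hj h]
    rw [← hst]
  · refine (lintegral_essBdry_relabel_le hc (κ := ENNReal.ofReal B) (fun z hz =>
      ENNReal.ofReal_le_ofReal (hgB z (hcb0 (hcb s hs.1 hs.2 hz)))) (c p) j h).trans ?_
    refine add_le_add_right ?_ _
    have hNs0 : 0 < N * s := by positivity
    have hNss : N * s ≤ N * s₂ := by gcongr; exact hs.2
    have hs1 : s ≤ 1 := (le_mul_of_one_le_left hs.1 hN1).trans (hNss.trans hNs2)
    have e1 : bdryMeas c (cube p s) ≤ ENNReal.ofReal (C * N ^ N * s ^ (N - 1)) := by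
      refine (measure_mono (cube_subset_closedBall p hs.1)).trans
        ((hs₁P (N * s) hNs0 (hNss.trans hNs1)).2.trans (ENNReal.ofReal_le_ofReal ?_))
      rw [mul_pow, mul_assoc C]
      refine mul_le_mul_of_nonneg_left (mul_le_mul_of_nonneg_left ?_ (by positivity)) hC.le
      exact pow_le_pow_of_le_one hs.1 hs1 (by omega)
    refine (mul_le_mul_right (add_le_add e1 (hQB p s hs.1)) _).trans ?_
    rw [← ENNReal.ofReal_add (by positivity) (by positivity), ← ENNReal.ofReal_mul hB.le]
    refine ENNReal.ofReal_le_ofReal ?_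
    have h5 : s ^ (N - 1) ≤ θ ^ (N - 1) / b ^ (N - 1) := by
      rw [← div_pow]
      refine pow_le_pow_left₀ hs.1 ?_ _
      rw [le_div_iff₀ hb]
      linarith
    calc B * (C * N ^ N * s ^ (N - 1) + K₀ * s ^ (N - 1))
        = B * (C * N ^ N + K₀) * s ^ (N - 1) := by ring
      _ ≤ B * (C * N ^ N + K₀) * (θ ^ (N - 1) / b ^ (N - 1)) := by gcongr
      _ = _ := by ring

end CrudeBox

/-- The weighted volume as a measure. -/
def volMeas (f : Pt N → ℝ) : Measure (Pt N) :=
  (μH[(N : ℝ)]).withDensity fun x => ENNReal.ofReal (f x)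

theorem volMeas_apply (f : Pt N → ℝ) {E : Set (Pt N)} (hE : MeasurableSet E) :
    volMeas f E = wVolE f E := withDensity_apply _ hE

theorem exists_hausdorffMeasure_eq_smul :
    ∃ k : NNReal, k ≠ 0 ∧ (μH[(N : ℝ)] : Measure (Pt N)) = k • volume := by
  have h : Measure.IsAddHaarMeasure (μH[(N : ℝ)] : Measure (Pt N)) := by
    have := isAddHaarMeasure_hausdorffMeasure (E := Pt N)
    rwa [finrank_euclideanSpace_fin] at this
  exact ⟨_, (Measure.addHaarScalarFactor_pos_of_isAddHaarMeasure _ _).ne',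
    Measure.isAddLeftInvariant_eq_smul (μH[(N : ℝ)] : Measure (Pt N)) volume⟩

theorem volMeas_absolutelyContinuous (f : Pt N → ℝ) : volMeas f ≪ volume := by
  obtain ⟨k, -, hk⟩ := exists_hausdorffMeasure_eq_smul (N := N)
  refine (withDensity_absolutelyContinuous _ _).trans ?_
  rw [hk]
  exact Measure.smul_absolutelyContinuous

theorem volMeas_comparable {f g : Pt N → ℝ} (hfg : IsDensityPair f g) (R : ℝ) :
    ∃ a > 0, ∃ A > 0, ∀ U ⊆ closedBall (0 : Pt N) R,
      ENNReal.ofReal a * volume U ≤ volMeas f U ∧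
        volMeas f U ≤ ENNReal.ofReal A * volume U := by
  obtain ⟨hf, -, hfpos, -, hbd⟩ := hfg
  obtain ⟨k, hk0, hk⟩ := exists_hausdorffMeasure_eq_smul (N := N)
  have hk1 : (0 : ℝ) < k := by exact_mod_cast pos_iff_ne_zero.2 hk0
  obtain ⟨C, hC⟩ := hbd _ (isCompact_closedBall (0 : Pt N) R)
  obtain ⟨a₀, ha₀, hfa⟩ : ∃ a₀ : ℝ, 0 < a₀ ∧ ∀ z ∈ closedBall (0 : Pt N) R, a₀ ≤ f z := by
    rcases (closedBall (0 : Pt N) R).eq_empty_or_nonempty with he | hne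
    · exact ⟨1, one_pos, fun z hz => by simp [he] at hz⟩
    · obtain ⟨z, -, hz⟩ := (hf.lowerSemicontinuousOn _).exists_isMinOn hne
        (isCompact_closedBall (0 : Pt N) R)
      exact ⟨f z, hfpos z, hz⟩
  have hk2 : (k : ENNReal) = ENNReal.ofReal k := by simp
  have hS : SFinite (k • (volume : Measure (Pt N))) := inferInstance
  have happ : ∀ U : Set (Pt N), volMeas f U =
      ENNReal.ofReal k * ∫⁻ z in U, ENNReal.ofReal (f z) := by
    intro U
    rw [volMeas, hk, withDensity_apply', Measure.restrict_smul, lintegral_smul_measure, ← hk2]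
    rfl
  have hfm : Measurable fun z => ENNReal.ofReal (f z) := hf.measurable.ennreal_ofReal
  refine ⟨k * a₀, by positivity, k * (max C 1), by positivity, fun U hU => ⟨?_, ?_⟩⟩
  · rw [happ, ENNReal.ofReal_mul hk1.le, mul_assoc]
    refine mul_le_mul_right ?_ _
    rw [← setLIntegral_const]
    exact setLIntegral_mono hfm fun z hz => ENNReal.ofReal_le_ofReal (hfa z (hU hz))
  · rw [happ, ENNReal.ofReal_mul hk1.le, mul_assoc]
    refine mul_le_mul_right ?_ _
    rw [← setLIntegral_const]
    exact setLIntegral_mono measurable_const fun z hz =>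
      ENNReal.ofReal_le_ofReal ((hC z (hU hz)).1.trans (le_max_left _ _))

section Labels

variable {m : ℕ}

/-- `c` labels almost every point of `F i` by `i + 1` and almost every exterior point by `0`. -/
def Labels (c : Pt N → Fin (m + 1)) (F : Fin m → Set (Pt N)) : Prop :=
  Measurable c ∧ ∀ᵐ z, ∀ i, z ∈ F i ↔ c z = i.succ

theorem essBdry_congr {E F : Set (Pt N)} (h : ∀ᵐ z, z ∈ E ↔ z ∈ F) : essBdry E = essBdry F := by
  ext x
  exact mem_essBdry_congr univ_mem (h.mono fun z hz _ => hz)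

theorem Labels.ae_mem_iUnion_iff {c : Pt N → Fin (m + 1)} {F : Fin m → Set (Pt N)}
    (h : Labels c F) : ∀ᵐ z, z ∈ (⋃ i, F i) ↔ z ∈ (c ⁻¹' {0})ᶜ := by
  filter_upwards [h.2] with z hz
  simp only [mem_iUnion, hz, mem_compl_iff, mem_preimage, mem_singleton_iff]
  constructor
  · rintro ⟨i, hi⟩
    rw [hi]
    exact Fin.succ_ne_zero i
  · intro h0
    obtain ⟨i, hi⟩ := Fin.exists_succ_eq.2 h0
    exact ⟨i, hi.symm⟩

theorem Labels.essBdry_eq {c : Pt N → Fin (m + 1)} {F : Fin m → Set (Pt N)}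
    (h : Labels c F) (i : Fin m) : essBdry (F i) = essBdry (c ⁻¹' {i.succ}) :=
  essBdry_congr (h.2.mono fun _ hz => hz i)

theorem Labels.essBdry_iUnion_eq {c : Pt N → Fin (m + 1)} {F : Fin m → Set (Pt N)}
    (h : Labels c F) : essBdry (⋃ i, F i) = essBdry (c ⁻¹' {0}) :=
  (essBdry_congr h.ae_mem_iUnion_iff).trans (essBdry_compl (h.1 (measurableSet_singleton 0)))

theorem Labels.clPer_eq (g : Pt N → ℝ) {c : Pt N → Fin (m + 1)} {F : Fin m → Set (Pt N)}
    (h : Labels c F) : clPer g F = (∑ k, wPer g (c ⁻¹' {k})) / 2 := by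
  rw [clPer, Fin.sum_univ_succ, wPer, wPer, h.essBdry_iUnion_eq, add_comm]
  congr 2
  exact Finset.sum_congr rfl fun i _ => by rw [wPer, wPer, h.essBdry_eq]

theorem Labels.wVol_eq (f : Pt N → ℝ) {c : Pt N → Fin (m + 1)} {F : Fin m → Set (Pt N)}
    (h : Labels c F) {i : Fin m} (hF : MeasurableSet (F i)) :
    wVol f (F i) = (volMeas f).real (c ⁻¹' {i.succ}) := by
  rw [wVol, ← volMeas_apply f hF, measureReal_def]
  congr 1
  refine measure_congr ?_
  filter_upwards [(volMeas_absolutelyContinuous f).ae_le h.2] with z hz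
  exact propext (hz i)

theorem Labels.volume_eq {c : Pt N → Fin (m + 1)} {F : Fin m → Set (Pt N)}
    (h : Labels c F) (i : Fin m) : volume (c ⁻¹' {i.succ}) = volume (F i) := by
  refine measure_congr ?_
  filter_upwards [h.2] with z hz
  exact propext (hz i).symm

theorem Labels.volume_zero_eq {c : Pt N → Fin (m + 1)} {F : Fin m → Set (Pt N)}
    (h : Labels c F) : volume (c ⁻¹' {0}) = volume (⋃ i, F i)ᶜ := by
  refine measure_congr ?_
  filter_upwards [h.ae_mem_iUnion_iff] with z hz
  have h1 : z ∈ c ⁻¹' {0} ↔ z ∈ (⋃ i, F i)ᶜ := by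
    rw [mem_compl_iff, hz, mem_compl_iff, not_not]
  exact propext h1

theorem Labels.isCluster {c : Pt N → Fin (m + 1)} {F : Fin m → Set (Pt N)}
    (h : Labels c F) (hF : ∀ i, MeasurableSet (F i)) : IsCluster F := by
  refine ⟨hF, fun i j hij => ?_⟩
  refine measure_eq_zero_iff_ae_notMem.2 ?_
  filter_upwards [h.2] with z hz hz'
  exact hij (Fin.succ_injective _ (((hz i).1 hz'.1).symm.trans ((hz j).1 hz'.2)))

theorem exists_labels {E : Fin m → Set (Pt N)} (hE : IsCluster E) : ∃ c, Labels c E := by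
  classical
  set T : Fin m → Set (Pt N) := fun i => E i \ ⋃ j, ⋃ _ : j < i, E j with hT
  have hTm : ∀ i, MeasurableSet (T i) := fun i =>
    (hE.1 i).diff (MeasurableSet.iUnion fun j => MeasurableSet.iUnion fun _ => hE.1 j)
  have hTd : ∀ z i j, z ∈ T i → z ∈ T j → i = j := by
    intro z i j hi hj
    rcases lt_trichotomy i j with h | h | h
    · exact absurd (mem_iUnion₂.2 ⟨i, h, hi.1⟩) hj.2
    · exact h
    · exact absurd (mem_iUnion₂.2 ⟨j, h, hj.1⟩) hi.2
  set c : Pt N → Fin (m + 1) := fun z => if h : ∃ i, z ∈ T i then h.choose.succ else 0 with hc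
  have hcT : ∀ z i, c z = i.succ ↔ z ∈ T i := by
    intro z i
    simp only [hc]
    split_ifs with h
    · rw [Fin.succ_inj]
      exact ⟨fun h1 => h1 ▸ h.choose_spec, fun h1 => hTd z _ _ h.choose_spec h1⟩
    · exact ⟨fun h1 => absurd h1.symm (Fin.succ_ne_zero i), fun h1 => absurd ⟨i, h1⟩ h⟩
  have hcm : Measurable c := by
    have hsucc : ∀ i : Fin m, MeasurableSet (c ⁻¹' {i.succ}) := fun i => by
      have : c ⁻¹' {i.succ} = T i := by
        ext z
        exact hcT z i
      rw [this]
      exact hTm i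
    refine measurable_to_countable' fun k => ?_
    refine Fin.cases ?_ hsucc k
    have : c ⁻¹' {0} = (⋃ i : Fin m, c ⁻¹' {i.succ})ᶜ := by
      ext z
      simp only [mem_preimage, mem_singleton_iff, mem_compl_iff, mem_iUnion, not_exists]
      constructor
      · intro h i hi
        exact Fin.succ_ne_zero i (hi.symm.trans h)
      · intro h
        by_contra h0
        obtain ⟨i, hi⟩ := Fin.exists_succ_eq.2 h0
        exact h i hi.symm
    rw [this]
    exact (MeasurableSet.iUnion hsucc).compl
  refine ⟨c, hcm, ?_⟩
  have hd : ∀ᵐ z, ∀ i j, i ≠ j → z ∉ E i ∩ E j :=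
    ae_all_iff.2 fun i => ae_all_iff.2 fun j => ae_all_iff.2 fun hij =>
      measure_eq_zero_iff_ae_notMem.1 (hE.2 i j hij)
  filter_upwards [hd] with z hz i
  rw [hcT]
  refine ⟨fun h => ⟨h, ?_⟩, fun h => h.1⟩
  simp only [mem_iUnion, not_exists]
  exact fun j hj h' => hz i j hj.ne' ⟨h, h'⟩

theorem Labels.bdryMeas_ne_top {c : Pt N → Fin (m + 1)} {E : Fin m → Set (Pt N)}
    (h : Labels c E) (hE : ∀ i, MeasurableSet (E i)) (hEper : FinPerCluster E) :
    bdryMeas c univ ≠ ⊤ := by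
  have hU : ∀ s : Finset (Fin m), essBdry (⋃ i ∈ s, E i) ⊆ ⋃ i ∈ s, essBdry (E i) := by
    classical
    intro s
    induction s using Finset.induction_on with
    | empty => simp [essBdry_empty]
    | insert a s _ ih =>
      simp only [Finset.mem_insert, iUnion_iUnion_eq_or_left]
      exact (essBdry_union_subset (hE a) (Finset.measurableSet_biUnion s fun i _ => hE i)).trans
        (union_subset_union_right _ ih)
  have hsub : (⋃ k, essBdry (c ⁻¹' {k})) ⊆ ⋃ i, essBdry (E i) := by
    refine iUnion_subset fun k => Fin.cases ?_ (fun i => ?_) k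
    · rw [← h.essBdry_iUnion_eq]
      simpa using hU Finset.univ
    · rw [← h.essBdry_eq i]
      exact subset_iUnion (fun i => essBdry (E i)) i
  rw [bdryMeas, Measure.restrict_apply_univ]
  refine ne_top_of_le_ne_top ?_ ((measure_mono hsub).trans (measure_iUnion_fintype_le _ _))
  exact (ENNReal.sum_lt_top.2 fun i _ => hEper i).ne

end Labels

section Glue

variable {m : ℕ} {ι : Type*}

/-- The labelling equal to `c' k` on `b k` and to `c` elsewhere. -/
def glue (c : Pt N → Fin (m + 1)) (c' : ι → Pt N → Fin (m + 1)) (b : ι → Set (Pt N)) :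
    Pt N → Fin (m + 1) :=
  open Classical in fun z => if h : ∃ k, z ∈ b k then c' h.choose z else c z

variable {c : Pt N → Fin (m + 1)} {c' : ι → Pt N → Fin (m + 1)} {b : ι → Set (Pt N)}

theorem glue_of_mem (hb : Pairwise (Function.onFun Disjoint b)) {k : ι} {z : Pt N}
    (hz : z ∈ b k) : glue c c' b z = c' k z := by
  have h : ∃ k, z ∈ b k := ⟨k, hz⟩
  have hk : h.choose = k := by
    by_contra hne
    exact Set.disjoint_left.1 (hb hne) h.choose_spec hz
  simp only [glue, h, dif_pos]
  rw [hk]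

theorem glue_of_notMem {z : Pt N} (hz : z ∉ ⋃ k, b k) : glue c c' b z = c z := by
  have h : ¬ ∃ k, z ∈ b k := fun h => hz (mem_iUnion.2 h)
  simp only [glue, h, dif_neg, not_false_eq_true]

theorem glue_preimage_inter (hb : Pairwise (Function.onFun Disjoint b)) (k : ι)
    (h : Fin (m + 1)) : glue c c' b ⁻¹' {h} ∩ b k = c' k ⁻¹' {h} ∩ b k := by
  ext z
  simp only [mem_inter_iff, mem_preimage, mem_singleton_iff]
  exact and_congr_left fun hz => by rw [glue_of_mem hb hz]

theorem glue_preimage_sdiff (h : Fin (m + 1)) :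
    glue c c' b ⁻¹' {h} \ (⋃ k, b k) = c ⁻¹' {h} \ ⋃ k, b k := by
  ext z
  simp only [Set.mem_sdiff, mem_preimage, mem_singleton_iff]
  exact and_congr_left fun hz => by rw [glue_of_notMem hz]

theorem measurable_glue [Countable ι] (hc : Measurable c) (hc' : ∀ k, Measurable (c' k))
    (hb : Pairwise (Function.onFun Disjoint b)) (hbm : ∀ k, MeasurableSet (b k)) :
    Measurable (glue c c' b) := by
  refine measurable_to_countable' fun h => ?_
  rw [← inter_union_sdiff (glue c c' b ⁻¹' {h}) (⋃ k, b k), glue_preimage_sdiff, inter_iUnion]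
  simp only [glue_preimage_inter hb]
  exact (MeasurableSet.iUnion fun k => (hc' k (measurableSet_singleton h)).inter (hbm k)).union
    ((hc (measurableSet_singleton h)).diff (MeasurableSet.iUnion hbm))

theorem measureReal_eq_sum_inter_add [Fintype ι] {ν : Measure (Pt N)}
    (hb : Pairwise (Function.onFun Disjoint b)) (hbm : ∀ k, MeasurableSet (b k))
    {T : Set (Pt N)} (hT : MeasurableSet T) (hν : ν T ≠ ⊤) :
    ν.real T = (∑ k, ν.real (T ∩ b k)) + ν.real (T \ ⋃ k, b k) := by
  rw [← measureReal_inter_add_sdiff (s := T) (MeasurableSet.iUnion hbm) hν, inter_iUnion]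
  congr 1
  refine measureReal_iUnion_fintype (fun k l hkl => ?_) (fun k => hT.inter (hbm k))
    (fun k => ne_top_of_le_ne_top hν (measure_mono inter_subset_left))
  exact (hb hkl).mono inter_subset_right inter_subset_right

theorem lintegral_eq_sum_inter_add [Fintype ι] (μ : Measure (Pt N)) (G : Pt N → ENNReal)
    (hb : Pairwise (Function.onFun Disjoint b)) (hbm : ∀ k, MeasurableSet (b k))
    (T : Set (Pt N)) :
    ∫⁻ z in T, G z ∂μ = (∑ k, ∫⁻ z in T ∩ b k, G z ∂μ) + ∫⁻ z in T \ ⋃ k, b k, G z ∂μ := by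
  have hU := MeasurableSet.iUnion hbm
  rw [← lintegral_inter_add_sdiff G T hU]
  congr 1
  have e : ∀ B : Set (Pt N), MeasurableSet B → μ.restrict (T ∩ B) = (μ.restrict T).restrict B :=
    fun B hB => by rw [Measure.restrict_restrict hB, inter_comm]
  rw [e _ hU, lintegral_iUnion hbm hb, tsum_fintype]
  exact Finset.sum_congr rfl fun k _ => by rw [e _ (hbm k)]

end Glue

section GlueCluster

variable {m : ℕ} {ι : Type*} {f g : Pt N → ℝ} {E : Fin m → Set (Pt N)}
  {c : Pt N → Fin (m + 1)} {c' : ι → Pt N → Fin (m + 1)} {x : ι → Pt N} {ρ : ℝ}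
  {Δ : ι → Fin (m + 1) → ℝ} {s : ι → ℝ}

theorem essBdry_glue_inter (hd : Pairwise (Function.onFun Disjoint fun k => ball (x k) ρ))
    (k : ι) (h : Fin (m + 1)) :
    essBdry (glue c c' (fun k => ball (x k) ρ) ⁻¹' {h}) ∩ ball (x k) ρ =
      essBdry (c' k ⁻¹' {h}) ∩ ball (x k) ρ := by
  ext z
  refine and_congr_left fun hz => mem_essBdry_congr (isOpen_ball.mem_nhds hz) ?_
  refine Eventually.of_forall fun y hy => ?_
  rw [mem_preimage, glue_of_mem hd hy]
  rfl

variable [Fintype ι]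

theorem essBdry_glue_sdiff {ν : Measure (Pt N)} {G : Pt N → ENNReal}
    (hd : Pairwise (Function.onFun Disjoint fun k => ball (x k) ρ))
    (hmod : ∀ k, IsMod ν G c (c' k) (x k) ρ (Δ k) (s k)) (h : Fin (m + 1)) :
    essBdry (glue c c' (fun k => ball (x k) ρ) ⁻¹' {h}) \ (⋃ k, ball (x k) ρ) =
      essBdry (c ⁻¹' {h}) \ ⋃ k, ball (x k) ρ := by
  choose r hr hoff using fun k => (hmod k).eq_off
  have hcl : IsClosed (⋃ k, closedBall (x k) (r k)) :=
    isClosed_iUnion_of_finite fun k => isClosed_closedBall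
  ext z
  refine and_congr_left fun hz => mem_essBdry_congr (hcl.isOpen_compl.mem_nhds ?_) ?_
  · intro hz'
    obtain ⟨k, hk⟩ := mem_iUnion.1 hz'
    exact hz (mem_iUnion.2 ⟨k, closedBall_subset_ball (hr k) hk⟩)
  · refine Eventually.of_forall fun y hy => ?_
    have : glue c c' (fun k => ball (x k) ρ) y = c y := by
      by_cases hyU : y ∈ ⋃ k, ball (x k) ρ
      · obtain ⟨k, hk⟩ := mem_iUnion.1 hyU
        rw [glue_of_mem hd hk]
        exact hoff k y fun h' => hy (mem_iUnion.2 ⟨k, h'⟩)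
      · exact glue_of_notMem hyU
    rw [mem_preimage, this]
    rfl

theorem wPer_glue_le (hM : bdryMeas c univ ≠ ⊤) (hg : Continuous g) {ν : Measure (Pt N)}
    (hd : Pairwise (Function.onFun Disjoint fun k => ball (x k) ρ)) (hs : ∀ k, 0 ≤ s k)
    (hmod : ∀ k, IsMod ν (fun z => ENNReal.ofReal (g z)) c (c' k) (x k) ρ (Δ k) (s k))
    (h : Fin (m + 1)) :
    wPer g (glue c c' (fun k => ball (x k) ρ) ⁻¹' {h}) ≤ wPer g (c ⁻¹' {h}) + ∑ k, s k := by
  have hs0 : 0 ≤ ∑ k, s k := Finset.sum_nonneg fun k _ => hs k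
  have hF := lintegral_eq_sum_inter_add (μH[(N : ℝ) - 1]) (fun z => ENNReal.ofReal (g z)) hd
    (fun k => measurableSet_ball) (essBdry (glue c c' (fun k => ball (x k) ρ) ⁻¹' {h}))
  have hE := lintegral_eq_sum_inter_add (μH[(N : ℝ) - 1]) (fun z => ENNReal.ofReal (g z)) hd
    (fun k => measurableSet_ball) (essBdry (c ⁻¹' {h}))
  rw [essBdry_glue_sdiff hd hmod h] at hF
  simp only [essBdry_glue_inter hd] at hF
  rw [wPer, wPer]
  have hle : ∫⁻ z in essBdry (glue c c' (fun k => ball (x k) ρ) ⁻¹' {h}),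
      ENNReal.ofReal (g z) ∂μH[(N : ℝ) - 1] ≤
      (∫⁻ z in essBdry (c ⁻¹' {h}), ENNReal.ofReal (g z) ∂μH[(N : ℝ) - 1]) +
        ENNReal.ofReal (∑ k, s k) := by
    rw [hF, hE, ENNReal.ofReal_sum_of_nonneg fun k _ => hs k, add_right_comm,
      ← Finset.sum_add_distrib]
    exact add_le_add_left (Finset.sum_le_sum fun k _ => (hmod k).per h) _
  by_cases htop : ∫⁻ z in essBdry (c ⁻¹' {h}), ENNReal.ofReal (g z) ∂μH[(N : ℝ) - 1] = ⊤
  · have hfin : ∑ k, ∫⁻ z in essBdry (c ⁻¹' {h}) ∩ ball (x k) ρ,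
        ENNReal.ofReal (g z) ∂μH[(N : ℝ) - 1] ≠ ⊤ := by
      refine (ENNReal.sum_lt_top.2 fun k _ => ?_).ne
      obtain ⟨B, hB⟩ := (isCompact_closedBall (x k) ρ).exists_bound_of_continuousOn
        hg.continuousOn
      refine (setLIntegral_essBdry_inter_le h measurableSet_ball (κ := ENNReal.ofReal B)
        fun z hz => ENNReal.ofReal_le_ofReal ?_).trans_lt ?_
      · exact (le_abs_self _).trans (hB z (ball_subset_closedBall hz))
      · exact ENNReal.mul_lt_top ENNReal.ofReal_lt_top
          ((measure_mono (subset_univ _)).trans_lt hM.lt_top)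
    rw [htop] at hE
    have hrest := (ENNReal.add_eq_top.1 hE.symm).resolve_left hfin
    rw [hF, hrest, htop, add_top]
    simpa using hs0
  · have h1 := ENNReal.toReal_mono (ENNReal.add_ne_top.2 ⟨htop, ENNReal.ofReal_ne_top⟩) hle
    rwa [ENNReal.toReal_add htop ENNReal.ofReal_ne_top, ENNReal.toReal_ofReal hs0] at h1

theorem measureReal_glue {ν : Measure (Pt N)} {G : Pt N → ENNReal} (hc : Measurable c)
    (hν : ∀ y r, ν (closedBall y r) ≠ ⊤)
    (hd : Pairwise (Function.onFun Disjoint fun k => ball (x k) ρ))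
    (hmod : ∀ k, IsMod ν G c (c' k) (x k) ρ (Δ k) (s k)) {h : Fin (m + 1)}
    (hfin : ν (c ⁻¹' {h}) ≠ ⊤) :
    ν.real (glue c c' (fun k => ball (x k) ρ) ⁻¹' {h}) = ν.real (c ⁻¹' {h}) + ∑ k, Δ k h := by
  have hbm : ∀ k, MeasurableSet (ball (x k) ρ) := fun k => measurableSet_ball
  have hcm := measurable_glue hc (fun k => (hmod k).measurable) hd hbm
  have hfin' : ν (glue c c' (fun k => ball (x k) ρ) ⁻¹' {h}) ≠ ⊤ := by
    have hsub : glue c c' (fun k => ball (x k) ρ) ⁻¹' {h} ⊆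
        c ⁻¹' {h} ∪ ⋃ k, closedBall (x k) ρ := by
      rw [← inter_union_sdiff (glue c c' (fun k => ball (x k) ρ) ⁻¹' {h})
        (⋃ k, ball (x k) ρ), glue_preimage_sdiff, union_comm]
      exact union_subset_union sdiff_subset
        (inter_subset_right.trans (iUnion_mono fun k => ball_subset_closedBall))
    refine ne_top_of_le_ne_top ?_ ((measure_mono hsub).trans (measure_union_le _ _))
    refine ENNReal.add_ne_top.2 ⟨hfin, ne_top_of_le_ne_top ?_ (measure_iUnion_fintype_le _ _)⟩
    exact (ENNReal.sum_lt_top.2 fun k _ => (hν (x k) ρ).lt_top).ne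
  rw [measureReal_eq_sum_inter_add hd hbm (hcm (measurableSet_singleton h)) hfin',
    measureReal_eq_sum_inter_add hd hbm (hc (measurableSet_singleton h)) hfin,
    glue_preimage_sdiff, add_right_comm, ← Finset.sum_add_distrib]
  congr 1
  exact Finset.sum_congr rfl fun k _ => by rw [glue_preimage_inter hd, (hmod k).vol h]

/-- Modifications in disjoint balls can be performed simultaneously. -/
theorem exists_cluster_of_isMod (hfg : IsDensityPair f g) (hg : Continuous g) (hE : IsCluster E)
    (hEper : FinPerCluster E) (hEvol : FinVolCluster f E) (hL : Labels c E)
    (hd : Pairwise (Function.onFun Disjoint fun k => ball (x k) ρ)) (hs : ∀ k, 0 ≤ s k)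
    (hmod : ∀ k, IsMod (volMeas f) (fun z => ENNReal.ofReal (g z)) c (c' k) (x k) ρ (Δ k) (s k)) :
    ∃ F : Fin m → Set (Pt N), IsCluster F ∧
      (⋃ i, symmDiff (E i) (F i)) ⊆ ⋃ k, ball (x k) ρ ∧
      (∀ i, wVol f (F i) = wVol f (E i) + ∑ k, Δ k i.succ) ∧
      clPer g F ≤ clPer g E + ((m : ℝ) + 1) / 2 * ∑ k, s k := by
  have hbm : ∀ k, MeasurableSet (ball (x k) ρ) := fun k => measurableSet_ball
  have hU := MeasurableSet.iUnion hbm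
  have hcm := measurable_glue hL.1 (fun k => (hmod k).measurable) hd hbm
  set C := glue c c' (fun k => ball (x k) ρ) with hC
  set F : Fin m → Set (Pt N) := fun i =>
    (E i \ ⋃ k, ball (x k) ρ) ∪ (C ⁻¹' {i.succ} ∩ ⋃ k, ball (x k) ρ) with hF
  have hFm : ∀ i, MeasurableSet (F i) := fun i =>
    ((hE.1 i).diff hU).union ((hcm (measurableSet_singleton _)).inter hU)
  have hFL : Labels C F := by
    refine ⟨hcm, ?_⟩
    filter_upwards [hL.2] with z hz i
    by_cases hzU : z ∈ ⋃ k, ball (x k) ρ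
    · have : z ∈ F i ↔ z ∈ C ⁻¹' {i.succ} := by
        simp only [hF, mem_union, Set.mem_sdiff, hzU, not_true, and_false, false_or,
          mem_inter_iff, and_true]
      exact this
    · have : z ∈ F i ↔ z ∈ E i := by
        simp only [hF, mem_union, Set.mem_sdiff, hzU, not_false_iff, and_true,
          mem_inter_iff, and_false, or_false]
      rw [this, hz i, hC, glue_of_notMem hzU]
  refine ⟨F, hFL.isCluster hFm, ?_, fun i => ?_, ?_⟩
  · refine iUnion_subset fun i z hz => ?_
    by_contra hzU
    have : z ∈ F i ↔ z ∈ E i := by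
      simp only [hF, mem_union, Set.mem_sdiff, hzU, not_false_iff, and_true,
        mem_inter_iff, and_false, or_false]
    rcases hz with h | h
    · exact h.2 (this.2 h.1)
    · exact h.2 (this.1 h.1)
  · rw [hFL.wVol_eq f (hFm i), hL.wVol_eq f (hE.1 i)]
    refine measureReal_glue hL.1
      (fun y r => measure_ne_top_of_comparable (volMeas_comparable hfg) y r) hd hmod ?_
    have h1 : volMeas f (c ⁻¹' {i.succ}) = volMeas f (E i) := by
      refine measure_congr ?_
      filter_upwards [(volMeas_absolutelyContinuous f).ae_le hL.2] with z hz
      exact propext (hz i).symm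
    rw [h1, volMeas_apply f (hE.1 i)]
    exact (hEvol i).ne
  · rw [hFL.clPer_eq g, hL.clPer_eq g]
    have h1 : ∑ k, wPer g (C ⁻¹' {k}) ≤ ∑ k : Fin (m + 1), (wPer g (c ⁻¹' {k}) + ∑ l, s l) :=
      Finset.sum_le_sum fun k _ =>
        wPer_glue_le (hL.bdryMeas_ne_top hE.1 hEper) hg hd hs hmod k
    rw [Finset.sum_add_distrib, Finset.sum_const, Finset.card_univ, Fintype.card_fin,
      nsmul_eq_mul] at h1
    push_cast at h1
    linarith

end GlueCluster

theorem exists_injective_mem {ι α : Type*} [Fintype ι] {s : ι → Set α} (hs : ∀ a, (s a).Infinite) :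
    ∃ p : ι → α, Function.Injective p ∧ ∀ a, p a ∈ s a := by
  classical
  choose t ht htc using fun a => (hs a).exists_subset_card_eq (Fintype.card ι)
  obtain ⟨p, hp, hpt⟩ := (Finset.all_card_le_biUnion_card_iff_exists_injective t).1 fun u => by
    rcases u.eq_empty_or_nonempty with rfl | ⟨a, ha⟩
    · simp
    · exact (Finset.card_le_univ u).trans
        ((htc a).symm.le.trans (Finset.card_le_card (Finset.subset_biUnion_of_mem t ha)))
  exact ⟨p, hp, fun a => ht a (hpt a)⟩

/-- Successively joining a label outside the set reached so far to a label inside it produces a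
spanning tree of labels, along which every exchange of mass between labels can be routed. -/
theorem exists_transport_tree {m : ℕ} {α : Type*} [PseudoMetricSpace α]
    {P : α → Fin (m + 1) → Fin (m + 1) → Prop} {r : ℝ} (A₀ : Finset α)
    (h : ∀ S : Finset (Fin (m + 1)), S.Nonempty → S ≠ Finset.univ → ∀ A : Finset α,
      A.card ≤ A₀.card + m → ∃ x, (∀ p ∈ A, r ≤ dist x p) ∧ ∃ i ∈ S, ∃ j ∉ S, P x i j) :
    ∃ (x : Fin m → α) (i j : Fin m → Fin (m + 1)), (∀ k, P (x k) (i k) (j k)) ∧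
      (∀ k l, k ≠ l → r ≤ dist (x k) (x l)) ∧ (∀ k, ∀ p ∈ A₀, r ≤ dist (x k) p) ∧
      ∀ δ : Fin (m + 1) → ℝ, ∑ a, δ a = 0 → ∃ t : Fin m → ℝ, (∀ k, |t k| ≤ ∑ a, |δ a|) ∧
        ∀ a, ∑ k, t k * ((if a = j k then 1 else 0) - (if a = i k then 1 else 0)) = δ a := by
  classical
  suffices key : ∀ l ≤ m, ∃ S : Finset (Fin (m + 1)), S.card = l + 1 ∧
      ∃ (x : Fin l → α) (i j : Fin l → Fin (m + 1)), (∀ k, P (x k) (i k) (j k)) ∧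
      (∀ k l, k ≠ l → r ≤ dist (x k) (x l)) ∧ (∀ k, ∀ p ∈ A₀, r ≤ dist (x k) p) ∧
      ∀ δ : Fin (m + 1) → ℝ, ∑ a, δ a = 0 → (∀ a ∉ S, δ a = 0) →
        ∃ t : Fin l → ℝ, (∀ k, |t k| ≤ ∑ a, |δ a|) ∧
        ∀ a, ∑ k, t k * ((if a = j k then 1 else 0) - (if a = i k then 1 else 0)) = δ a by
    obtain ⟨S, hS, x, i, j, h1, h2, h3, h4⟩ := key m le_rfl
    have hSu : S = Finset.univ := Finset.eq_univ_of_card S (by simpa using hS)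
    exact ⟨x, i, j, h1, h2, h3, fun δ hδ => h4 δ hδ (by simp [hSu])⟩
  intro l
  induction l with
  | zero =>
    refine fun _ => ⟨{0}, rfl, fun k => k.elim0, fun k => k.elim0, fun k => k.elim0,
      fun k => k.elim0, fun k => k.elim0, fun k => k.elim0, fun δ hδ hs => ⟨fun k => k.elim0,
        fun k => k.elim0, fun a => ?_⟩⟩
    have h0 : δ 0 = 0 := by
      rw [← hδ, Finset.sum_eq_single 0 (fun b _ hb => hs b (by simpa using hb)) (by simp)]
    rcases eq_or_ne a 0 with rfl | ha
    · simp [h0]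
    · simp [hs a (by simpa using ha)]
  | succ l ih =>
    intro hl
    obtain ⟨S, hS, x, i, j, h1, h2, h3, h4⟩ := ih (by omega)
    have hSne : S.Nonempty := Finset.card_pos.1 (by omega)
    have hSu : S ≠ Finset.univ := fun hu => by
      rw [hu, Finset.card_univ, Fintype.card_fin] at hS
      omega
    obtain ⟨y, hy, i', hi', j', hj', hP⟩ := h S hSne hSu (A₀ ∪ Finset.univ.image x) (by
      refine (Finset.card_union_le _ _).trans (Nat.add_le_add_left ?_ _)
      refine Finset.card_image_le.trans ?_
      rw [Finset.card_univ, Fintype.card_fin]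
      omega)
    have hij : i' ≠ j' := fun hh => hj' (hh ▸ hi')
    have hyx : ∀ k, r ≤ dist y (x k) := fun k => hy _ (Finset.mem_union_right _
      (Finset.mem_image_of_mem x (Finset.mem_univ k)))
    refine ⟨insert j' S, by rw [Finset.card_insert_of_notMem hj', hS], Fin.cons y x, Fin.cons i' i,
      Fin.cons j' j, ?_, ?_, ?_, ?_⟩
    · refine Fin.cases ?_ fun k => ?_
      · simpa using hP
      · simpa using h1 k
    · refine Fin.cases ?_ fun k => ?_
      · refine Fin.cases (by simp) fun k' _ => by simpa using hyx k'
      · refine Fin.cases (fun _ => by simpa [dist_comm] using hyx k) fun k' hk => ?_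
        simpa using h2 k k' fun hh => hk (by rw [hh])
    · refine Fin.cases (fun p hp => ?_) fun k p hp => ?_
      · simpa using hy p (Finset.mem_union_left _ hp)
      · simpa using h3 k p hp
    · intro δ hδ hs
      set δ' : Fin (m + 1) → ℝ := fun a =>
        δ a - δ j' * ((if a = j' then 1 else 0) - (if a = i' then 1 else 0)) with hδ'
      have hδ's : ∑ a, δ' a = 0 := by
        simp [hδ', Finset.sum_sub_distrib, ← Finset.mul_sum, hδ]
      have hle : ∑ a, |δ' a| ≤ ∑ a, |δ a| := by
        have h5 : ∀ a, |δ' a| ≤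
            |δ a| + |δ j'| * ((if a = i' then 1 else 0) - (if a = j' then 1 else 0)) := by
          intro a
          rcases eq_or_ne a j' with rfl | haj
          · simp [hδ', hij.symm]
          · rcases eq_or_ne a i' with rfl | hai
            · simpa [hδ', hij] using abs_add_le (δ a) (δ j')
            · simp [hδ', haj, hai]
        refine (Finset.sum_le_sum fun a _ => h5 a).trans_eq ?_
        simp [Finset.sum_add_distrib, ← Finset.mul_sum, Finset.sum_sub_distrib]
      obtain ⟨t, ht, hts⟩ := h4 δ' hδ's fun a ha => by
        rcases eq_or_ne a j' with rfl | haj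
        · simp [hδ', hij.symm]
        · have hai : a ≠ i' := fun hh => ha (hh ▸ hi')
          simpa [hδ', haj, hai] using hs a (by simp [haj, ha])
      refine ⟨Fin.cons (δ j') t, ?_, fun a => ?_⟩
      · refine Fin.cases ?_ fun k => ?_
        · simpa using Finset.single_le_sum (f := fun a => |δ a|) (fun a _ => abs_nonneg _)
            (Finset.mem_univ j')
        · simpa using (ht k).trans hle
      · rw [Fin.sum_univ_succ]
        simp only [Fin.cons_zero, Fin.cons_succ, hts a, hδ']
        ring

theorem exists_measure_compl_ball_le (μ : Measure (Pt N)) [IsFiniteMeasure μ] {η : ENNReal}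
    (hη : η ≠ 0) : ∃ R : ℝ, 0 ≤ R ∧ μ ((ball 0 R)ᶜ) ≤ η := by
  obtain ⟨K, hK, hKη⟩ := isTightMeasureSet_iff_exists_isCompact_measure_compl_le.1
    (isTightMeasureSet_singleton (μ := μ)) η (pos_iff_ne_zero.2 hη)
  obtain ⟨R, hR0, hR⟩ := hK.isBounded.subset_ball_lt 0 0
  exact ⟨R, hR0.le, (measure_mono (compl_subset_compl.2 hR)).trans (hKη μ rfl)⟩

/-- A finite measure without atoms gives uniformly small mass to small balls. -/
theorem exists_forall_measure_closedBall_le (μ : Measure (Pt N)) [IsFiniteMeasure μ]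
    (h0 : ∀ p, μ {p} = 0) {η : ENNReal} (hη : η ≠ 0) :
    ∃ r > 0, ∀ p, μ (closedBall p r) ≤ η := by
  obtain ⟨R, -, hR⟩ := exists_measure_compl_ball_le μ hη
  have hloc : ∀ p : Pt N, ∃ s > 0, μ (closedBall p s) ≤ η := fun p => by
    have ht : Tendsto (fun s => μ (closedBall p s)) (nhdsWithin 0 (Ioi 0)) (nhds (μ {p})) := by
      have := tendsto_measure_biInter_gt (μ := μ) (s := fun s => closedBall p s) (a := (0 : ℝ))
        (fun s _ => measurableSet_closedBall.nullMeasurableSet)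
        (fun i j _ hij => closedBall_subset_closedBall hij) ⟨1, one_pos, measure_ne_top _ _⟩
      rwa [show (⋂ r > (0 : ℝ), closedBall p r) = {p} by
        rw [biInter_gt_closedBall, closedBall_zero]] at this
    rw [h0 p] at ht
    obtain ⟨s, hs, hs0⟩ := ((ht.eventually (gt_mem_nhds (pos_iff_ne_zero.2 hη))).and
      self_mem_nhdsWithin).exists
    exact ⟨s, hs0, hs.le⟩
  choose s hs0 hs using hloc
  obtain ⟨δ, hδ, hcov⟩ := lebesgue_number_lemma_of_metric (isCompact_closedBall (0 : Pt N) (R + 1))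
    (fun p => isOpen_ball (x := p) (ε := s p))
    (fun p _ => mem_iUnion.2 ⟨p, mem_ball_self (hs0 p)⟩)
  refine ⟨min (δ / 2) 1, by positivity, fun p => ?_⟩
  by_cases hp : p ∈ closedBall (0 : Pt N) (R + 1)
  · obtain ⟨q, hq⟩ := hcov p hp
    exact (measure_mono ((closedBall_subset_ball
      (by linarith [min_le_left (δ / 2) 1] : min (δ / 2) 1 < δ)).trans
        (hq.trans ball_subset_closedBall))).trans (hs q)
  · refine (measure_mono fun z hz => ?_).trans hR
    rw [mem_closedBall, not_le] at hp
    rw [mem_compl_iff, mem_ball, not_lt]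
    have := (mem_closedBall.1 hz).trans (min_le_right _ _)
    linarith [dist_triangle_left p 0 z]

theorem bdryMeas_singleton {m : ℕ} (hN : 2 ≤ N) (c : Pt N → Fin (m + 1)) (p : Pt N) :
    bdryMeas c {p} = 0 := by
  have hN' : (0 : ℝ) < (N : ℝ) - 1 := by
    have : (2 : ℝ) ≤ N := by exact_mod_cast hN
    linarith
  have := Measure.nullSingletonClass_hausdorff (Pt N) hN'
  exact Measure.restrict_le_self.absolutelyContinuous (measure_singleton p)

/-- Inside `ball x ρ`, any amount `t` of mass with `|t| ≤ D * θ ^ N` can be moved from label `i` to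
label `j`, up to an error `κ * θ ^ N` and with perimeter increment at most `κ * θ ^ (N - 1)`. -/
def IsFineBox {m : ℕ} (ν : Measure (Pt N)) (G : Pt N → ENNReal) (c : Pt N → Fin (m + 1))
    (κ D ρ θ : ℝ) (x : Pt N) (i j : Fin (m + 1)) : Prop :=
  ∀ t : ℝ, |t| ≤ D * θ ^ N → ∃ (c' : Pt N → Fin (m + 1)) (Δ : Fin (m + 1) → ℝ),
    IsMod ν G c c' x ρ Δ (κ * θ ^ (N - 1)) ∧
    ∀ h, |Δ h - t * ((if h = j then 1 else 0) - (if h = i then 1 else 0))| ≤ κ * θ ^ N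

theorem exists_fine_tree {m : ℕ} {c : Pt N → Fin (m + 1)} (hN : 2 ≤ N) (hc : Measurable c)
    (hM : bdryMeas c univ ≠ ⊤) {ν : Measure (Pt N)}
    (hν : ∀ R : ℝ, ∃ a > 0, ∃ A > 0, ∀ U ⊆ closedBall (0 : Pt N) R,
      ENNReal.ofReal a * volume U ≤ ν U ∧ ν U ≤ ENNReal.ofReal A * volume U)
    {g : Pt N → ℝ} (hg : Continuous g) (hpos : ∀ h, volume (c ⁻¹' {h}) ≠ 0) (n : ℕ) :
    ∃ ρ₀ > 0, ∀ ρ κ D : ℝ, 0 < ρ → ρ ≤ ρ₀ → 0 < κ → 0 < D →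
      ∀ᶠ θ in nhdsWithin (0 : ℝ) (Ioi 0), ∀ A₀ : Finset (Pt N), A₀.card ≤ n →
        ∃ (x : Fin m → Pt N) (i j : Fin m → Fin (m + 1)),
          (∀ k, IsFineBox ν (fun z => ENNReal.ofReal (g z)) c κ D ρ θ (x k) (i k) (j k)) ∧
          (∀ k l, k ≠ l → 4 * ρ ≤ dist (x k) (x l)) ∧
          (∀ k, ∀ p ∈ A₀, 4 * ρ ≤ dist (x k) p) ∧
          ∀ δ : Fin (m + 1) → ℝ, ∑ a, δ a = 0 → ∃ t : Fin m → ℝ, (∀ k, |t k| ≤ ∑ a, |δ a|) ∧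
            ∀ a, ∑ k, t k * ((if a = j k then 1 else 0) - (if a = i k then 1 else 0)) = δ a := by
  classical
  have : IsFiniteMeasure (bdryMeas c) := ⟨hM.lt_top⟩
  have hfine : ∀ S : Finset (Fin (m + 1)), ∃ η : ℝ, 0 < η ∧ (S.Nonempty → S ≠ Finset.univ →
      ∀ κ D ρ R : ℝ, 0 < κ → 0 < D → 0 < ρ → 0 ≤ R →
      ∀ᶠ θ in nhdsWithin (0 : ℝ) (Ioi 0), ∀ Z Z' : Set (Pt N), MeasurableSet Z →
        MeasurableSet Z' → (∀ z ∈ Z, closedBall z ρ ⊆ Z') → bdryMeas c Z' ≤ ENNReal.ofReal η →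
        (ball 0 R)ᶜ ⊆ Z → ∃ x : Pt N, (∃ z ∈ closedBall x ρ, z ∉ Z) ∧ ∃ i ∈ S, ∃ j ∉ S,
          IsFineBox ν (fun z => ENNReal.ofReal (g z)) c κ D ρ θ x i j) := by
    intro S
    by_cases hS : S.Nonempty ∧ S ≠ Finset.univ
    · obtain ⟨⟨a, ha⟩, hSu⟩ := hS
      obtain ⟨b, hb⟩ : ∃ b, b ∉ S := by simpa [Finset.eq_univ_iff_forall] using hSu
      have h1 : volume (c ⁻¹' (S : Set (Fin (m + 1)))) ≠ 0 := fun h0 =>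
        hpos a (measure_mono_null (preimage_mono (singleton_subset_iff.2 ha)) h0)
      have h2 : volume (c ⁻¹' (S : Set (Fin (m + 1)))ᶜ) ≠ 0 := fun h0 =>
        hpos b (measure_mono_null (preimage_mono (singleton_subset_iff.2 hb)) h0)
      obtain ⟨η, hη, H⟩ := exists_fine_box hN hc hM hν hg h1 h2
      exact ⟨η, hη, fun _ _ => H⟩
    · exact ⟨1, one_pos, fun h1 h2 => absurd ⟨h1, h2⟩ hS⟩
  choose η' hη' hbox using hfine
  obtain ⟨S₀, hS₀⟩ := Finite.exists_min η'
  set η : ℝ := η' S₀ / (n + m + 1) with hη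
  have hηp : 0 < η := div_pos (hη' S₀) (by positivity)
  have hη0 : ENNReal.ofReal η ≠ 0 := (ENNReal.ofReal_pos.2 hηp).ne'
  obtain ⟨R, hR0, hR⟩ := exists_measure_compl_ball_le (bdryMeas c) hη0
  obtain ⟨r, hr, hrη⟩ := exists_forall_measure_closedBall_le (bdryMeas c)
    (bdryMeas_singleton hN c) hη0
  refine ⟨min 1 (r / 6), by positivity, fun ρ κ D hρ hρ₀ hκ hD => ?_⟩
  have hρ1 : ρ ≤ 1 := hρ₀.trans (min_le_left _ _)
  have hρr : 6 * ρ ≤ r := by linarith [hρ₀.trans (min_le_right _ _)]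
  have hev := eventually_all.2 fun S : {S : Finset (Fin (m + 1)) // S.Nonempty ∧ S ≠ Finset.univ} =>
    hbox S.1 S.2.1 S.2.2 κ D ρ (R + 1) hκ hD hρ (by linarith)
  filter_upwards [hev] with θ hθ A₀ hA₀
  refine exists_transport_tree A₀ fun S hSn hSu A hA => ?_
  set Z : Set (Pt N) := (ball 0 (R + 1))ᶜ ∪ ⋃ p ∈ A, closedBall p (5 * ρ) with hZ
  set Z' : Set (Pt N) := (ball 0 R)ᶜ ∪ ⋃ p ∈ A, closedBall p (6 * ρ) with hZ'
  have hZm : MeasurableSet Z := measurableSet_ball.compl.union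
    (Finset.measurableSet_biUnion _ fun p _ => measurableSet_closedBall)
  have hZm' : MeasurableSet Z' := measurableSet_ball.compl.union
    (Finset.measurableSet_biUnion _ fun p _ => measurableSet_closedBall)
  have hZZ : ∀ z ∈ Z, closedBall z ρ ⊆ Z' := by
    rintro z (hz | hz) y hy
    · left
      rw [mem_compl_iff, mem_ball, not_lt] at hz ⊢
      linarith [mem_closedBall.1 hy, dist_triangle_left z 0 y]
    · right
      obtain ⟨p, hp, hzp⟩ := mem_iUnion₂.1 hz
      refine mem_iUnion₂.2 ⟨p, hp, mem_closedBall.2 ?_⟩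
      linarith [mem_closedBall.1 hy, mem_closedBall.1 hzp, dist_triangle y z p]
  have hZη : bdryMeas c Z' ≤ ENNReal.ofReal (η' S) := by
    calc bdryMeas c Z' ≤ bdryMeas c (ball 0 R)ᶜ + ∑ p ∈ A, bdryMeas c (closedBall p (6 * ρ)) :=
          (measure_union_le _ _).trans (add_le_add_right (measure_biUnion_finset_le _ _) _)
      _ ≤ ENNReal.ofReal η + ∑ _p ∈ A, ENNReal.ofReal η :=
          add_le_add hR (Finset.sum_le_sum fun p _ =>
            (measure_mono (closedBall_subset_closedBall hρr)).trans (hrη p))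
      _ = ENNReal.ofReal (η + A.card * η) := by
          rw [Finset.sum_const, nsmul_eq_mul, ENNReal.ofReal_add hηp.le (by positivity),
            ENNReal.ofReal_mul (by positivity), ENNReal.ofReal_natCast]
      _ ≤ ENNReal.ofReal (η' S) := by
          refine ENNReal.ofReal_le_ofReal (le_trans ?_ (hS₀ S))
          have hcard : (A.card : ℝ) ≤ n + m := by exact_mod_cast hA.trans (by omega)
          calc η + A.card * η ≤ (n + m + 1) * η := by nlinarith
            _ = η' S₀ := by rw [hη]; field_simp
  obtain ⟨x, ⟨z, hzx, hzZ⟩, i, hi, j, hj, hP⟩ := hθ ⟨S, hSn, hSu⟩ Z Z' hZm hZm' hZZ hZη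
    subset_union_left
  refine ⟨x, fun p hp => ?_, i, hi, j, hj, hP⟩
  have h5 : 5 * ρ < dist z p := by
    by_contra hcon
    exact hzZ (Or.inr (mem_iUnion₂.2 ⟨p, hp, mem_closedBall.2 (not_lt.1 hcon)⟩))
  linarith [mem_closedBall.1 hzx, dist_triangle z x p]

/-- Good points of prescribed labels, two for each `h` and each direction of exchange between the
labels `0` and `h.succ`. -/
theorem exists_crude_points {m : ℕ} {c : Pt N → Fin (m + 1)} (hN : 1 ≤ N) (hc : Measurable c)
    (hM : bdryMeas c univ ≠ ⊤) (hpos : ∀ h, volume (c ⁻¹' {h}) ≠ 0) :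
    ∃ p : Bool × Fin m × Bool → Pt N, Function.Injective p ∧
      ∀ a, IsGood c (p a) ∧ c (p a) = if a.1 then 0 else a.2.1.succ := by
  have : Nonempty (Fin N) := ⟨⟨0, hN⟩⟩
  refine exists_injective_mem (s := fun a : Bool × Fin m × Bool =>
    {q | IsGood c q ∧ c q = if a.1 then 0 else a.2.1.succ}) fun a hfin => ?_
  refine hpos (if a.1 then 0 else a.2.1.succ) ?_
  refine (measure_eq_zero_iff_ae_notMem).2 ?_
  filter_upwards [ae_isGood hN hc hM, measure_eq_zero_iff_ae_notMem.1
    (hfin.measure_zero volume)] with q hq hqs hqc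
  exact hqs ⟨hq, hqc⟩

theorem exists_crude_box_uniform {m : ℕ} {c : Pt N → Fin (m + 1)} (hN : 2 ≤ N) (hc : Measurable c)
    {ν : Measure (Pt N)} (hν : ∀ R : ℝ, ∃ a > 0, ∃ A > 0, ∀ U ⊆ closedBall (0 : Pt N) R,
      ENNReal.ofReal a * volume U ≤ ν U ∧ ν U ≤ ENNReal.ofReal A * volume U)
    {g : Pt N → ℝ} (hg : Continuous g) {p : Bool × Fin m × Bool → Pt N}
    (hp : ∀ a, IsGood c (p a) ∧ c (p a) = if a.1 then 0 else a.2.1.succ) :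
    ∃ K : ℝ, 0 < K ∧ ∀ ρ : ℝ, 0 < ρ → ∀ᶠ θ in nhdsWithin (0 : ℝ) (Ioi 0),
      ∀ t : ℝ, |t| ≤ θ ^ N → ∀ h b, ∃ (c' : Pt N → Fin (m + 1)) (Δ : Fin (m + 1) → ℝ),
        IsMod ν (fun z => ENNReal.ofReal (g z)) c c' (p (decide (0 ≤ t), h, b)) ρ Δ
          (K * θ ^ (N - 1)) ∧ ∀ i, Δ (Fin.succ i) = if i = h then t else 0 := by
  have hj : ∀ a : Bool × Fin m × Bool, c (p a) ≠ if a.1 then a.2.1.succ else 0 := fun a => by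
    rw [(hp a).2]
    cases a.1 <;> simp [Fin.succ_ne_zero, (Fin.succ_ne_zero _).symm]
  choose K hK hbox using fun a => exists_crude_box hN hc hν hg (hp a).1 (hj a)
  refine ⟨∑ a, K a + 1, add_pos_of_nonneg_of_pos (Finset.sum_nonneg fun a _ => (hK a).le) one_pos,
    fun ρ hρ => ?_⟩
  filter_upwards [eventually_all.2 fun a => hbox a ρ hρ, self_mem_nhdsWithin] with θ hθ hθ0 t ht h b
  obtain ⟨c', hc'⟩ := hθ (decide (0 ≤ t), h, b) |t| ⟨abs_nonneg t, ht⟩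
  refine ⟨c', _, hc'.mono ?_, fun i => ?_⟩
  · have : K (decide (0 ≤ t), h, b) ≤ ∑ a, K a :=
      Finset.single_le_sum (f := K) (fun a _ => (hK a).le) (Finset.mem_univ _)
    have h0 : (0 : ℝ) ≤ θ ^ (N - 1) := pow_nonneg (le_of_lt hθ0) _
    nlinarith
  · rw [(hp _).2]
    rcases le_or_gt 0 t with h0 | h0
    · simp [h0, abs_of_nonneg h0, Fin.succ_ne_zero]
    · by_cases hi : i = h <;> simp [h0.not_ge, abs_of_neg h0, Fin.succ_ne_zero, hi]

/-- For small `θ`, away from any given `w`, a volume vector of size `θ ^ N` can be realised by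
`2 * m` local modifications of total perimeter cost at most `C * θ ^ (N - 1)`. -/
theorem exists_isMod_family {m : ℕ} {c : Pt N → Fin (m + 1)} (hN : 2 ≤ N) (hm : 1 ≤ m)
    (hc : Measurable c) (hM : bdryMeas c univ ≠ ⊤) {ν : Measure (Pt N)}
    (hν : ∀ R : ℝ, ∃ a > 0, ∃ A > 0, ∀ U ⊆ closedBall (0 : Pt N) R,
      ENNReal.ofReal a * volume U ≤ ν U ∧ ν U ≤ ENNReal.ofReal A * volume U)
    {g : Pt N → ℝ} (hg : Continuous g) (hpos : ∀ h, volume (c ⁻¹' {h}) ≠ 0) {C : ℝ} (hC : 0 < C) :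
    ∃ ρ > 0, ∀ᶠ θ in nhdsWithin (0 : ℝ) (Ioi 0), ∀ (ε : Fin m → ℝ) (w : Pt N),
      (∀ i, |ε i| ≤ θ ^ N) → ∃ (x : Fin m ⊕ Fin m → Pt N)
        (c' : Fin m ⊕ Fin m → Pt N → Fin (m + 1)) (Δ : Fin m ⊕ Fin m → Fin (m + 1) → ℝ)
        (s : Fin m ⊕ Fin m → ℝ),
        Pairwise (Function.onFun Disjoint fun k => ball (x k) ρ) ∧
        (∀ k, Disjoint (ball (x k) ρ) (ball w ρ)) ∧ (∀ k, 0 ≤ s k) ∧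
        (∀ k, IsMod ν (fun z => ENNReal.ofReal (g z)) c (c' k) (x k) ρ (Δ k) (s k)) ∧
        (∀ i : Fin m, ∑ k, Δ k i.succ = ε i) ∧ ∑ k, s k ≤ C * θ ^ (N - 1) := by
  classical
  have hm0 : (0 : ℝ) < m := by exact_mod_cast hm
  obtain ⟨p, hpinj, hp⟩ := exists_crude_points (by omega) hc hM hpos
  obtain ⟨K, hK, hcrude⟩ := exists_crude_box_uniform hN hc hν hg hp
  obtain ⟨ρ₀, hρ₀, hfine⟩ := exists_fine_tree hN hc hM hν hg hpos
    (Fintype.card (Bool × Fin m × Bool) + 1)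
  obtain ⟨ρ₁, hρ₁, hsep⟩ : ∃ ρ₁ > 0, ∀ a b, a ≠ b → 4 * ρ₁ ≤ dist (p a) (p b) := by
    have : Nonempty {q : (Bool × Fin m × Bool) × (Bool × Fin m × Bool) // q.1 ≠ q.2} :=
      ⟨⟨((true, ⟨0, hm⟩, true), (false, ⟨0, hm⟩, true)), by simp⟩⟩
    obtain ⟨q₀, hq₀⟩ := Finite.exists_min
      fun q : {q : (Bool × Fin m × Bool) × (Bool × Fin m × Bool) // q.1 ≠ q.2} =>
        dist (p q.1.1) (p q.1.2)
    have hq0 : 0 < dist (p q₀.1.1) (p q₀.1.2) := dist_pos.2 (hpinj.ne q₀.2)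
    refine ⟨dist (p q₀.1.1) (p q₀.1.2) / 4, by positivity, fun a b hab => ?_⟩
    linarith [hq₀ ⟨(a, b), hab⟩]
  set ρ : ℝ := min ρ₀ ρ₁ with hρ
  have hρp : 0 < ρ := lt_min hρ₀ hρ₁
  have hρsep : ∀ a b, a ≠ b → 4 * ρ ≤ dist (p a) (p b) := fun a b hab =>
    (by linarith [min_le_right ρ₀ ρ₁] : 4 * ρ ≤ 4 * ρ₁).trans (hsep a b hab)
  set lam : ℝ := min 1 (C / (m * (1 + K))) with hlam
  have hlam0 : 0 < lam := by positivity
  have hlam1 : lam ≤ 1 := min_le_left _ _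
  have hlamC : m * (1 + K) * lam ≤ C := by
    have h1 : lam ≤ C / (m * (1 + K)) := min_le_right _ _
    rwa [le_div_iff₀' (by positivity)] at h1
  set κ : ℝ := lam ^ N / m with hκ
  have hκ0 : 0 < κ := by positivity
  have hκm : m * κ = lam ^ N := by rw [hκ]; field_simp
  have hscale : Tendsto (fun θ => lam * θ) (nhdsWithin (0 : ℝ) (Ioi 0))
      (nhdsWithin (0 : ℝ) (Ioi 0)) := by
    refine tendsto_nhdsWithin_iff.2 ⟨?_, ?_⟩
    · refine Tendsto.mono_left ?_ nhdsWithin_le_nhds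
      simpa using (continuous_const_mul lam).tendsto 0
    · filter_upwards [self_mem_nhdsWithin] with θ hθ using mul_pos hlam0 hθ
  refine ⟨ρ, hρp, ?_⟩
  filter_upwards [hfine ρ κ (2 * m) hρp (min_le_left _ _) hκ0 (by positivity),
    hscale.eventually (hcrude ρ hρp), self_mem_nhdsWithin] with θ hθf hθc hθ0 ε w hε
  have hθ0 : 0 < θ := hθ0
  obtain ⟨x, i, j, hbox, hxx, hxA, htree⟩ := hθf (insert w (Finset.univ.image p))
    ((Finset.card_insert_le _ _).trans (Nat.add_le_add_right Finset.card_image_le 1))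
  have hxw : ∀ k, 4 * ρ ≤ dist (x k) w := fun k => hxA k w (Finset.mem_insert_self _ _)
  have hxp : ∀ k a, 4 * ρ ≤ dist (x k) (p a) := fun k a => hxA k _
    (Finset.mem_insert_of_mem (Finset.mem_image_of_mem p (Finset.mem_univ a)))
  obtain ⟨t, ht, hts⟩ := htree (Fin.cons (-∑ a, ε a) ε) (by simp [Fin.sum_univ_succ])
  have hsum : ∑ a, |ε a| ≤ m * θ ^ N :=
    (Finset.sum_le_card_nsmul _ _ _ fun a _ => hε a).trans_eq (by simp)
  have ht' : ∀ k, |t k| ≤ 2 * m * θ ^ N := fun k => by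
    refine (ht k).trans ?_
    rw [Fin.sum_univ_succ]
    simp only [Fin.cons_zero, Fin.cons_succ, abs_neg]
    linarith [Finset.abs_sum_le_sum_abs ε Finset.univ]
  choose c₁ Δ₁ hmod₁ hΔ₁ using fun k => hbox k (t k) (ht' k)
  set δ : Fin m → ℝ := fun a => ε a - ∑ k, Δ₁ k a.succ with hδ
  have hδle : ∀ a, |δ a| ≤ (lam * θ) ^ N := fun a => by
    have h1 : δ a = -∑ k, (Δ₁ k a.succ -
        t k * ((if a.succ = j k then 1 else 0) - (if a.succ = i k then 1 else 0))) := by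
      rw [Finset.sum_sub_distrib, hts a.succ, Fin.cons_succ, hδ]
      ring
    rw [h1, abs_neg, mul_pow, ← hκm]
    refine (Finset.abs_sum_le_sum_abs _ _).trans
      ((Finset.sum_le_card_nsmul _ _ _ fun k _ => hΔ₁ k a.succ).trans_eq ?_)
    simp [mul_assoc]
  have hb : ∀ a : Fin m, ∃ b, 2 * ρ ≤ dist (p (decide (0 ≤ δ a), a, b)) w := fun a => by
    by_contra! hcon
    have h1 := hρsep (decide (0 ≤ δ a), a, true) (decide (0 ≤ δ a), a, false) (by simp)
    linarith [hcon true, hcon false, dist_triangle_right (p (decide (0 ≤ δ a), a, true))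
      (p (decide (0 ≤ δ a), a, false)) w]
  choose b hb using hb
  choose c₂ Δ₂ hmod₂ hΔ₂ using fun a => hθc (δ a) (hδle a) a (b a)
  refine ⟨Sum.elim x fun a => p (decide (0 ≤ δ a), a, b a), Sum.elim c₁ c₂, Sum.elim Δ₁ Δ₂,
    Sum.elim (fun _ => κ * θ ^ (N - 1)) (fun _ => K * (lam * θ) ^ (N - 1)), ?_, ?_, ?_, ?_, ?_, ?_⟩
  · have hdisj : ∀ y z : Pt N, 4 * ρ ≤ dist y z → Disjoint (ball y ρ) (ball z ρ) :=
      fun y z hyz => ball_disjoint_ball (by linarith)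
    rintro (k | a) (k' | a') hne
    · exact hdisj _ _ (hxx k k' fun hh => hne (by rw [hh]))
    · exact hdisj _ _ (hxp k _)
    · exact (hdisj _ _ (hxp k' _)).symm
    · refine hdisj _ _ (hρsep _ _ fun hh => hne ?_)
      exact congrArg Sum.inr (Prod.ext_iff.1 (Prod.ext_iff.1 hh).2).1
  · rintro (k | a)
    · exact ball_disjoint_ball (by simpa using (by linarith [hxw k] : ρ + ρ ≤ dist (x k) w))
    · exact ball_disjoint_ball (by simpa [two_mul] using hb a)
  · rintro (k | a) <;> simp only [Sum.elim_inl, Sum.elim_inr] <;> positivity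
  · rintro (k | a)
    · exact hmod₁ k
    · exact hmod₂ a
  · intro a
    rw [Fintype.sum_sum_type]
    simp [hΔ₂, hδ]
  · rw [Fintype.sum_sum_type]
    simp only [Sum.elim_inl, Sum.elim_inr, Finset.sum_const, Finset.card_univ, Fintype.card_fin,
      nsmul_eq_mul]
    have h1 : lam ^ (N - 1) ≤ lam := pow_le_of_le_one hlam0.le hlam1 (by omega)
    have h2 : m * κ ≤ m * lam := by
      rw [hκm]
      refine (pow_le_of_le_one hlam0.le hlam1 (by omega)).trans (le_mul_of_one_le_left hlam0.le ?_)
      exact_mod_cast hm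
    have h3 : m * κ + m * K * lam ^ (N - 1) ≤ C := by
      have : m * K * lam ^ (N - 1) ≤ m * K * lam := by gcongr
      linarith
    calc (m : ℝ) * (κ * θ ^ (N - 1)) + m * (K * (lam * θ) ^ (N - 1))
        = (m * κ + m * K * lam ^ (N - 1)) * θ ^ (N - 1) := by rw [mul_pow]; ring
      _ ≤ C * θ ^ (N - 1) := by gcongr

/-- if `g` is continuous, the `ε`–`ε^{(N−1)/N}` property holds with
arbitrarily small constant `C_per`. -/
theorem epsEps_arbitrarily_small_constant (N m : ℕ) (hN : 2 ≤ N) (hm : 1 ≤ m)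
    (f g : Pt N → ℝ) (hfg : IsDensityPair f g) (hgc : Continuous g)
    (E : Fin m → Set (Pt N)) (hE : IsCluster E) (hEnd : Nondegenerate E)
    (hEper : FinPerCluster E) (hEvol : FinVolCluster f E) :
    ∀ c : ℝ, 0 < c → ∃ rbar εbar : ℝ, 0 < rbar ∧ 0 < εbar ∧
      EpsEpsBeta f g E (((N : ℝ) - 1) / (N : ℝ)) rbar εbar c := by
  intro c hc
  have hN0 : (0 : ℝ) < N := by exact_mod_cast (by omega : 0 < N)
  obtain ⟨L, hL⟩ := exists_labels hE
  have hpos : ∀ h, volume (L ⁻¹' {h}) ≠ 0 := by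
    refine Fin.cases ?_ fun i => ?_
    · rw [hL.volume_zero_eq]
      exact hEnd.1.ne'
    · rw [hL.volume_eq i]
      exact (hEnd.2 i).ne'
  obtain ⟨ρ, hρ, hev⟩ := exists_isMod_family hN hm hL.1 (hL.bdryMeas_ne_top hE.1 hEper)
    (volMeas_comparable hfg) hgc hpos (C := 2 * c / (m + 1)) (by positivity)
  obtain ⟨θ₀, hθ₀, hθ⟩ := mem_nhdsGT_iff_exists_Ioo_subset.1 hev
  have hθ₀ : 0 < θ₀ := hθ₀
  refine ⟨ρ, θ₀ ^ N, hρ, by positivity, fun ε hε w => ?_⟩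
  rcases eq_or_ne ε 0 with rfl | hε0
  · refine ⟨E, hE, ⟨fun _ => w, fun _ => 0, fun _ => hρ.le, ?_, ?_⟩, ?_, ?_⟩
    · simp
    · simp
    · simp
    · simp only [norm_zero]
      exact le_add_of_nonneg_right (by positivity)
  have hε0' : 0 < ‖ε‖ := norm_pos_iff.2 hε0
  set θ : ℝ := ‖ε‖ ^ (N : ℝ)⁻¹ with hθdef
  have hθ0 : 0 < θ := Real.rpow_pos_of_pos hε0' _
  have hθN : θ ^ N = ‖ε‖ := Real.rpow_inv_natCast_pow (norm_nonneg _) (by omega)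
  have hθN' : θ ^ (N - 1) = ‖ε‖ ^ (((N : ℝ) - 1) / N) := by
    rw [hθdef, ← Real.rpow_natCast, ← Real.rpow_mul (norm_nonneg _),
      Nat.cast_sub (by omega : 1 ≤ N), Nat.cast_one, div_eq_inv_mul]
  have hlt : θ < θ₀ := lt_of_pow_lt_pow_left₀ N hθ₀.le (by rwa [hθN])
  obtain ⟨x, c', Δ, s, hd, hw, hs, hmod, hΔ, hcost⟩ := hθ ⟨hθ0, hlt⟩ (fun i => ε i) w fun i => by
    rw [hθN]
    exact PiLp.norm_apply_le ε i
  obtain ⟨F, hF, hFE, hFv, hFp⟩ := exists_cluster_of_isMod hfg hgc hE hEper hEvol hL hd hs hmod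
  refine ⟨F, hF, ?_, fun i => by rw [hFv i, hΔ i], ?_⟩
  · have hcard : Fintype.card (Fin m ⊕ Fin m) ≤ Fintype.card (Fin (m * (m + 1) / 2 + 1)) := by
      rw [Fintype.card_sum, Fintype.card_fin, Fintype.card_fin, ← Nat.sub_le_iff_le_add,
        Nat.le_div_iff_mul_le two_pos]
      obtain ⟨k, rfl⟩ : ∃ k, m = k + 1 := ⟨m - 1, by omega⟩
      have : k ≤ k * k := Nat.le_mul_self k
      have h2 : (k + 1 + (k + 1) - 1) = 2 * k + 1 := by omega
      rw [h2]
      nlinarith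
    obtain ⟨e⟩ := Function.Embedding.nonempty_of_card_le hcard
    refine ⟨Function.extend e x fun _ => w, Function.extend e (fun _ => ρ) fun _ => 0,
      fun k => ?_, fun k => ?_, hFE.trans (iUnion_subset fun k => ?_)⟩
    · by_cases hk : ∃ a, e a = k
      · obtain ⟨a, rfl⟩ := hk
        rw [e.injective.extend_apply]
      · rw [Function.extend_apply' _ _ _ hk]
        exact hρ.le
    · by_cases hk : ∃ a, e a = k
      · obtain ⟨a, rfl⟩ := hk
        rw [e.injective.extend_apply, e.injective.extend_apply]
        exact hw a
      · rw [Function.extend_apply' _ _ _ hk, Function.extend_apply' _ _ _ hk, ball_zero]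
        exact empty_disjoint _
    · refine subset_iUnion_of_subset (e k) ?_
      rw [e.injective.extend_apply, e.injective.extend_apply]
  · refine hFp.trans (add_le_add_right ?_ _)
    calc ((m : ℝ) + 1) / 2 * ∑ k, s k
        ≤ ((m : ℝ) + 1) / 2 * (2 * c / (m + 1) * θ ^ (N - 1)) := by gcongr
      _ = c * ‖ε‖ ^ (((N : ℝ) - 1) / N) := by rw [hθN']; field_simp
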